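/- Let (u_p)_{p>1} be a family of nodal solutions of (𝒫_p) satisfying condition (A), and let Ω̃_p⁺ := {x ∈ Ω : u_p(x) > 0} be the positive nodal domain. Then the rescaled sets Ω̃⁺(ε_p) := (Ω̃_p⁺ − x_p⁺)/ε_p exhaust ℝ² (every compact set is contained in Ω̃⁺(ε_p) for p large), and the restriction of z_p to Ω̃⁺(ε_p) converges in C²_loc(ℝ²), as p → +∞, to U(x) = −2·log(1 + |x|²/8). -/

import Mathlib

open MeasureTheory Real Set Filter Topology Metric

noncomputable section

/-- The Euclidean plane. -/
abbrev R2 : Type := EuclideanSpace ℝ (Fin 2)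

/-- The Laplacian: sum of the two pure second directional derivatives. -/
def lap (u : R2 → ℝ) (x : R2) : ℝ :=
  ∑ i : Fin 2,
    fderiv ℝ (fun y => fderiv ℝ u y (EuclideanSpace.single i 1)) x (EuclideanSpace.single i 1)

/-- Each point of ∂Ω has a neighborhood in which ∂Ω is the graph of a C^∞ function
(in suitable Euclidean coordinates). -/
def SmoothBoundary (Ω : Set R2) : Prop :=
  ∀ x ∈ frontier Ω, ∃ V : Set R2, IsOpen V ∧ x ∈ V ∧
    ∃ (e : R2 ≃ᵢ R2) (g : ℝ → ℝ), ContDiff ℝ (⊤ : ℕ∞) g ∧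
      frontier Ω ∩ V = {y | y ∈ V ∧ e y 1 = g (e y 0)}

/-- A (classical) solution of the Lane–Emden problem `(𝒫_p)` on Ω. -/
def IsSolution (Ω : Set R2) (p : ℝ) (u : R2 → ℝ) : Prop :=
  ContDiffOn ℝ 2 u Ω ∧ ContDiffOn ℝ 1 u (closure Ω) ∧
  (∀ x ∈ Ω, -lap u x = |u x| ^ (p - 1) * u x) ∧
  (∀ x ∈ frontier Ω, u x = 0)

/-- A nodal (sign-changing) function on Ω. -/
def IsNodal (Ω : Set R2) (u : R2 → ℝ) : Prop :=
  (∃ x ∈ Ω, 0 < u x) ∧ ∃ x ∈ Ω, u x < 0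

/-- The energy functional E_p. -/
def energy (Ω : Set R2) (p : ℝ) (u : R2 → ℝ) : ℝ :=
  (1 / 2) * ∫ x in Ω, ‖gradient u x‖ ^ 2 - (1 / (p + 1)) * ∫ x in Ω, |u x| ^ (p + 1)

/-- Condition (A): p·∫_Ω |∇u_p|² → 16πe. -/
def CondA (Ω : Set R2) (u : ℝ → R2 → ℝ) : Prop :=
  Tendsto (fun p : ℝ => p * ∫ x in Ω, ‖gradient (u p) x‖ ^ 2) atTop
    (𝓝 (16 * π * Real.exp 1))

/-- Condition (B): p·(u_p(x_p⁺) + u_p(x_p⁻)) → K for some K ≥ 0. -/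
def CondB (u : ℝ → R2 → ℝ) (xp xm : ℝ → R2) : Prop :=
  ∃ K : ℝ, 0 ≤ K ∧ Tendsto (fun p : ℝ => p * (u p (xp p) + u p (xm p))) atTop (𝓝 K)

/-- ε_p := (p·u_p(x_p⁺)^{p−1})^{−1/2}. -/
def eps (u : ℝ → R2 → ℝ) (xp : ℝ → R2) (p : ℝ) : ℝ :=
  1 / Real.sqrt (p * u p (xp p) ^ (p - 1))

/-- The rescaling z_p of u_p around x_p⁺. -/
def zp (u : ℝ → R2 → ℝ) (xp : ℝ → R2) (p : ℝ) (x : R2) : ℝ :=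
  (p / u p (xp p)) * (u p (eps u xp p • x + xp p) - u p (xp p))

/-- The rescaling z_p⁻ of u_p around x_p⁻ (with the scale ε_p of the maximum). -/
def zm (u : ℝ → R2 → ℝ) (xp xm : ℝ → R2) (p : ℝ) (x : R2) : ℝ :=
  (p / u p (xp p)) * (-u p (eps u xp p • x + xm p) - u p (xp p))

/-- Convergence in C²_loc(ℝ²) of a family of functions f_i defined on sets D_i:
every compact set K is eventually contained in D_i, and on K all derivatives up to
order 2 converge uniformly. -/
def TendstoC2loc {ι : Type} (l : Filter ι) (D : ι → Set R2) (f : ι → R2 → ℝ)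
    (g : R2 → ℝ) : Prop :=
  ∀ K : Set R2, IsCompact K →
    (∀ᶠ i in l, K ⊆ D i) ∧
    ∀ n : ℕ, n ≤ 2 →
      TendstoUniformlyOn (fun i x => iteratedFDeriv ℝ n (f i) x)
        (fun x => iteratedFDeriv ℝ n g x) l K

/-- The standard bubble U(x) = −2 log(1 + |x|²/8). -/
def stdBubble (x : R2) : ℝ := -2 * Real.log (1 + ‖x‖ ^ 2 / 8)

/-- The bubble U_μ(x) = log(μ/(1 + μ|x|²/8)²). -/
def bubble (μ : ℝ) (x : R2) : ℝ := Real.log (μ / (1 + μ * ‖x‖ ^ 2 / 8) ^ 2)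

/-- A C^∞ function compactly supported in S. -/
def CcSmoothIn (S : Set R2) (v : R2 → ℝ) : Prop :=
  ContDiff ℝ (⊤ : ℕ∞) v ∧ HasCompactSupport v ∧ tsupport v ⊆ S

/-- The quadratic form of the linearized operator at u. -/
def Qform (p : ℝ) (u v : R2 → ℝ) : ℝ :=
  ∫ x, (‖gradient v x‖ ^ 2 - p * |u x| ^ (p - 1) * v x ^ 2)

/-- Morse index one hypothesis (M): for p large, the quadratic form of the linearized
operator is negative somewhere on C_c^∞ of the positive nodal domain, but is not
negative definite on any 2-dimensional subspace. -/
def MorseOne (Ω : Set R2) (u : ℝ → R2 → ℝ) : Prop :=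
  ∀ᶠ p : ℝ in atTop,
    (∃ v : R2 → ℝ, CcSmoothIn {x ∈ Ω | 0 < u p x} v ∧ Qform p (u p) v < 0) ∧
    ¬ ∃ v w : R2 → ℝ, CcSmoothIn {x ∈ Ω | 0 < u p x} v ∧
        CcSmoothIn {x ∈ Ω | 0 < u p x} w ∧
        LinearIndependent ℝ ![v, w] ∧
        ∀ a b : ℝ, ¬(a = 0 ∧ b = 0) →
          Qform p (u p) (fun x => a * v x + b * w x) < 0

/-- The partial derivative in the `i`-th coordinate direction. -/
def pd (i : Fin 2) (f : R2 → ℝ) (x : R2) : ℝ :=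
  fderiv ℝ f x (EuclideanSpace.single i 1)

theorem lap_eq (f : R2 → ℝ) (x : R2) : lap f x = pd 0 (pd 0 f) x + pd 1 (pd 1 f) x := by
  simp [lap, Fin.sum_univ_two, pd]
  rfl

theorem fderiv_eq_pd (f : R2 → ℝ) (x v : R2) : fderiv ℝ f x v = v 0 * pd 0 f x + v 1 * pd 1 f x := by
  have : v = v 0 • EuclideanSpace.single (0 : Fin 2) (1 : ℝ) +
      v 1 • EuclideanSpace.single (1 : Fin 2) (1 : ℝ) := by
    ext i; fin_cases i <;> simp
  conv_lhs => rw [this]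
  simp [pd]

theorem norm_sq_eq (v : R2) : ‖v‖ ^ 2 = v 0 ^ 2 + v 1 ^ 2 := by
  simp [EuclideanSpace.norm_sq_eq, Fin.sum_univ_two]

theorem abs_coord_le (v : R2) (i : Fin 2) : |v i| ≤ ‖v‖ := by
  simpa using EuclideanSpace.norm_eq v ▸ PiLp.norm_apply_le v i

theorem norm_fderiv_le (f : R2 → ℝ) (x : R2) : ‖fderiv ℝ f x‖ ≤ |pd 0 f x| + |pd 1 f x| := by
  refine ContinuousLinearMap.opNorm_le_bound _ (by positivity) fun v => ?_
  rw [fderiv_eq_pd, Real.norm_eq_abs]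
  calc |v 0 * pd 0 f x + v 1 * pd 1 f x| ≤ |v 0| * |pd 0 f x| + |v 1| * |pd 1 f x| := by
        rw [← abs_mul, ← abs_mul]; exact abs_add_le _ _
    _ ≤ ‖v‖ * |pd 0 f x| + ‖v‖ * |pd 1 f x| := by
        gcongr <;> exact abs_coord_le v _
    _ = _ := by ring

theorem ContDiff.pd {n m : WithTop ℕ∞} {f : R2 → ℝ} (hf : ContDiff ℝ n f) (h : m + 1 ≤ n) (i : Fin 2) :
    ContDiff ℝ m (pd i f) :=
  (hf.fderiv_right h).clm_apply contDiff_const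

theorem ContDiffOn.pd {n m : WithTop ℕ∞} {f : R2 → ℝ} {D : Set R2} (hf : ContDiffOn ℝ n f D)
    (hD : IsOpen D) (h : m + 1 ≤ n) (i : Fin 2) : ContDiffOn ℝ m (pd i f) D :=
  (hf.fderiv_of_isOpen hD h).clm_apply contDiffOn_const

theorem Filter.EventuallyEq.pd {f g : R2 → ℝ} {x : R2} (h : f =ᶠ[𝓝 x] g) (i : Fin 2) :
    pd i f =ᶠ[𝓝 x] pd i g := by
  filter_upwards [h.fderiv (𝕜 := ℝ)] with y hy
  simp [_root_.pd, hy]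

theorem pd_congr {f g : R2 → ℝ} {D : Set R2} (hD : IsOpen D) (h : EqOn f g D) (i : Fin 2) :
    EqOn (pd i f) (pd i g) D := fun _ hx =>
  ((h.eventuallyEq_of_mem (hD.mem_nhds hx)).pd i).self_of_nhds

theorem lap_congr {f g : R2 → ℝ} {D : Set R2} (hD : IsOpen D) (h : EqOn f g D) :
    EqOn (lap f) (lap g) D := fun x hx => by
  simp only [lap_eq]
  rw [pd_congr hD (pd_congr hD h 0) 0 hx, pd_congr hD (pd_congr hD h 1) 1 hx]

theorem pd_mul {f g : R2 → ℝ} {x : R2} (hf : DifferentiableAt ℝ f x) (hg : DifferentiableAt ℝ g x)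
    (i : Fin 2) : pd i (fun y => f y * g y) x = f x * pd i g x + pd i f x * g x := by
  simp [pd, fderiv_fun_mul hf hg]; ring

theorem pd_add {f g : R2 → ℝ} {x : R2} (hf : DifferentiableAt ℝ f x) (hg : DifferentiableAt ℝ g x)
    (i : Fin 2) : pd i (fun y => f y + g y) x = pd i f x + pd i g x := by
  simp [pd, fderiv_fun_add hf hg]

theorem pd_sub {f g : R2 → ℝ} {x : R2} (hf : DifferentiableAt ℝ f x) (hg : DifferentiableAt ℝ g x)
    (i : Fin 2) : pd i (fun y => f y - g y) x = pd i f x - pd i g x := by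
  simp [pd, fderiv_fun_sub hf hg]

theorem pd_const_mul (c : ℝ) (f : R2 → ℝ) (x : R2)
    (i : Fin 2) : pd i (fun y => c * f y) x = c * pd i f x := by
  have : (fun y => c * f y) = c • f := rfl
  simp only [pd, this, fderiv_const_smul_field]
  simp

theorem pd_neg (f : R2 → ℝ) (x : R2) (i : Fin 2) : pd i (fun y => - f y) x = - pd i f x := by
  simp [pd, fderiv_fun_neg]

theorem pd_const (c : ℝ) (x : R2) (i : Fin 2) : pd i (fun _ => c) x = 0 := by
  simp [pd]

theorem pd_comp {G : ℝ → ℝ} {f : R2 → ℝ} {x : R2} {G' : ℝ} (hG : HasDerivAt G G' (f x))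
    (hf : DifferentiableAt ℝ f x) (i : Fin 2) : pd i (fun y => G (f y)) x = G' * pd i f x := by
  have := (hG.hasFDerivAt.comp x hf.hasFDerivAt).fderiv
  simp only [pd]
  rw [show (fun y => G (f y)) = G ∘ f from rfl, this]
  simp [mul_comm]

theorem hasFDerivAt_affine (a : R2) (R : ℝ) (y : R2) :
    HasFDerivAt (fun y : R2 => a + R • y) (R • ContinuousLinearMap.id ℝ R2) y :=
  ((hasFDerivAt_id y).const_smul R).const_add a

theorem pd_affine {f : R2 → ℝ} (a : R2) (R : ℝ) {y : R2}
    (hf : DifferentiableAt ℝ f (a + R • y)) (i : Fin 2) :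
    pd i (fun y => f (a + R • y)) y = R * pd i f (a + R • y) := by
  have := (hf.hasFDerivAt.comp y (hasFDerivAt_affine a R y)).fderiv
  simp only [pd]
  rw [show (fun y => f (a + R • y)) = f ∘ (fun y => a + R • y) from rfl, this]
  simp

theorem pd_symm {f : R2 → ℝ} {D : Set R2} (hD : IsOpen D) (hf : ContDiffOn ℝ 2 f D) {x : R2}
    (hx : x ∈ D) (i j : Fin 2) :
    pd i (pd j f) x = pd j (pd i f) x := by
  have hc : ContDiffAt ℝ 2 f x := hf.contDiffAt (hD.mem_nhds hx)
  have hs := hc.isSymmSndFDerivAt (by simp)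
  have hd : DifferentiableAt ℝ (fderiv ℝ f) x :=
    (hc.fderiv_right (m := 1) (by norm_num)).differentiableAt (by norm_num)
  have key : ∀ i j : Fin 2, pd i (pd j f) x = fderiv ℝ (fderiv ℝ f) x (EuclideanSpace.single i 1)
      (EuclideanSpace.single j 1) := by
    intro i j
    rw [pd, show pd j f =
      fun x => (fderiv ℝ f x) ((fun _ => EuclideanSpace.single j 1) x) from rfl,
      fderiv_clm_apply hd (differentiableAt_const _)]
    simp
  rw [key, key]; exact hs _ _

theorem integrable_mul_of_tsupport {f k : R2 → ℝ} {D : Set R2} (hf : ContinuousOn f D)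
    (hk : Continuous k) (hc : HasCompactSupport k) (hs : tsupport k ⊆ D) :
    Integrable (fun x => f x * k x) := by
  have h1 : IntegrableOn (fun x => f x * k x) (tsupport k) :=
    ContinuousOn.integrableOn_compact hc ((hf.mono hs).mul hk.continuousOn)
  refine (integrableOn_iff_integrable_of_support_subset ?_).1 h1
  intro x hx
  exact subset_tsupport _ (fun h => hx (by simp [h]))

theorem HasCompactSupport.pd {g : R2 → ℝ} (hc : HasCompactSupport g) (i : Fin 2) :
    HasCompactSupport (pd i g) :=
  hc.fderiv_apply (𝕜 := ℝ) _

theorem tsupport_pd_subset (g : R2 → ℝ) (i : Fin 2) : tsupport (pd i g) ⊆ tsupport g :=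
  tsupport_fderiv_apply_subset ℝ _

/-- Integration by parts against a compactly supported function. -/
theorem integral_mul_pd {f g : R2 → ℝ} {D : Set R2} (hD : IsOpen D) (hf : ContDiffOn ℝ 1 f D)
    (hg : ContDiff ℝ 1 g) (hc : HasCompactSupport g) (hs : tsupport g ⊆ D) (i : Fin 2) :
    ∫ x, f x * pd i g x = - ∫ x, pd i f x * g x := by
  refine integral_mul_fderiv_eq_neg_fderiv_mul_of_integrable ?_ ?_ ?_ ?_ ?_
  · exact integrable_mul_of_tsupport (hf.pd hD (m := 0) (by norm_num) i).continuousOn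
      hg.continuous hc hs
  · exact integrable_mul_of_tsupport hf.continuousOn (hg.pd (m := 0) (by norm_num) i).continuous
      (hc.pd i) ((tsupport_pd_subset g i).trans hs)
  · exact integrable_mul_of_tsupport hf.continuousOn hg.continuous hc hs
  · exact fun x hx => ((hf.differentiableOn (by norm_num)) x (hs hx)).differentiableAt
      (hD.mem_nhds (hs hx))
  · exact fun x _ => hg.differentiable (by norm_num) x

theorem integral_pd_mul {f g : R2 → ℝ} (hf : ContDiff ℝ 1 f)
    (hg : ContDiff ℝ 1 g) (hc : HasCompactSupport g) (i : Fin 2) :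
    ∫ x, pd i f x * g x = - ∫ x, f x * pd i g x := by
  rw [integral_mul_pd isOpen_univ hf.contDiffOn hg hc (subset_univ _) i, neg_neg]

theorem integrable_mul_of_compact {f k : R2 → ℝ} (hf : Continuous f)
    (hk : Continuous k) (hc : HasCompactSupport k) : Integrable (fun x => f x * k x) :=
  integrable_mul_of_tsupport hf.continuousOn hk hc (subset_univ _)

/-- Differentiation under the integral sign for integrands vanishing outside a fixed ball. -/
theorem hasDerivAt_integral_of_ball {F F' : ℝ → R2 → ℝ} {R r ρ : ℝ} (hr : 0 < r)
    (hF : ∀ t ∈ closedBall R r, Continuous (F t))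
    (hF0 : ∀ t ∈ closedBall R r, ∀ y ∉ closedBall (0 : R2) ρ, F t y = 0)
    (hF'0 : ∀ t ∈ closedBall R r, ∀ y ∉ closedBall (0 : R2) ρ, F' t y = 0)
    (hF' : ContinuousOn (Function.uncurry F') (closedBall R r ×ˢ closedBall (0 : R2) ρ))
    (hd : ∀ t ∈ closedBall R r, ∀ y, HasDerivAt (fun t => F t y) (F' t y) t) :
    HasDerivAt (fun t => ∫ y, F t y) (∫ y, F' R y) R := by
  obtain ⟨C, hC⟩ := ((isCompact_closedBall R r).prod
    (isCompact_closedBall (0 : R2) ρ)).exists_bound_of_continuousOn hF'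
  have hR : R ∈ closedBall R r := mem_closedBall_self hr.le
  refine (hasDerivAt_integral_of_dominated_loc_of_deriv_le (s := closedBall R r)
    (bound := (closedBall (0 : R2) ρ).indicator fun _ => C) (closedBall_mem_nhds R hr)
    ?_ ?_ ?_ ?_ ?_ ?_).2
  · filter_upwards [closedBall_mem_nhds R hr] with t ht
    exact (hF t ht).aestronglyMeasurable
  · refine (hF R hR).integrable_of_hasCompactSupport ?_
    exact HasCompactSupport.intro (isCompact_closedBall 0 ρ) (hF0 R hR)
  · have h1 : ContinuousOn (F' R) (closedBall (0 : R2) ρ) :=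
      hF'.comp (f := fun y => (R, y)) (by fun_prop) (fun y hy => ⟨hR, hy⟩)
    have h2 : F' R = (closedBall (0 : R2) ρ).indicator (F' R) := by
      ext y; by_cases hy : y ∈ closedBall (0 : R2) ρ
      · simp [indicator_of_mem hy]
      · rw [indicator_of_notMem hy, hF'0 R hR y hy]
    rw [h2]
    exact (aestronglyMeasurable_indicator_iff measurableSet_closedBall).2
      (h1.aestronglyMeasurable measurableSet_closedBall)
  · refine Eventually.of_forall fun y t ht => ?_
    by_cases hy : y ∈ closedBall (0 : R2) ρ
    · rw [indicator_of_mem hy]; exact hC (t, y) ⟨ht, hy⟩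
    · rw [indicator_of_notMem hy, hF'0 t ht y hy]; simp
  · exact (integrable_indicator_iff measurableSet_closedBall).2
      (integrableOn_const (isCompact_closedBall _ _).measure_lt_top.ne)
  · exact Eventually.of_forall fun y t ht => hd t ht y

theorem hasDerivAt_max_pow (n : ℕ) (t : ℝ) :
    HasDerivAt (fun t : ℝ => max t 0 ^ (n + 2)) ((n + 2) * max t 0 ^ (n + 1)) t := by
  rcases lt_trichotomy t 0 with h | h | h
  · have : (fun t : ℝ => max t 0 ^ (n + 2)) =ᶠ[𝓝 t] fun _ => 0 := by
      filter_upwards [Iio_mem_nhds h] with s hs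
      rw [max_eq_right (le_of_lt hs)]; simp
    rw [max_eq_right h.le]
    simpa using (hasDerivAt_const t (0 : ℝ)).congr_of_eventuallyEq this
  · subst h
    simp only [max_self, ne_eq, Nat.add_eq_zero_iff, one_ne_zero, and_false, not_false_eq_true,
      zero_pow, mul_zero]
    rw [hasDerivAt_iff_isLittleO_nhds_zero]
    simp only [zero_add, max_self, ne_eq, Nat.add_eq_zero_iff, OfNat.ofNat_ne_zero, and_false,
      not_false_eq_true, zero_pow, sub_zero, smul_zero]
    have h1 : (fun h : ℝ => h ^ (n + 2)) =o[𝓝 0] fun h => h := by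
      simpa using Asymptotics.isLittleO_pow_pow (𝕜 := ℝ) (m := 1) (n := n + 2) (by omega)
    refine Asymptotics.IsBigO.trans_isLittleO ?_ h1
    refine Asymptotics.IsBigO.of_bound 1 (Eventually.of_forall fun s => ?_)
    rw [one_mul, norm_pow, norm_pow, Real.norm_eq_abs, Real.norm_eq_abs]
    refine pow_le_pow_left₀ (abs_nonneg _) ?_ _
    rw [abs_of_nonneg (le_max_right s 0)]
    exact max_le (le_abs_self _) (abs_nonneg _)
  · have : (fun t : ℝ => max t 0 ^ (n + 2)) =ᶠ[𝓝 t] fun t => t ^ (n + 2) := by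
      filter_upwards [Ioi_mem_nhds h] with s hs
      rw [max_eq_left (le_of_lt hs)]
    rw [max_eq_left h.le]
    simpa using (hasDerivAt_pow (n + 2) t).congr_of_eventuallyEq this

theorem contDiff_max_pow (n : ℕ) : ContDiff ℝ n (fun t : ℝ => max t 0 ^ (n + 1)) := by
  induction n with
  | zero => simp only [CharP.cast_eq_zero, contDiff_zero]; fun_prop
  | succ n ih =>
    rw [show ((n + 1 : ℕ) : WithTop ℕ∞) = (n : WithTop ℕ∞) + 1 by simp, contDiff_succ_iff_deriv]
    refine ⟨fun t => (hasDerivAt_max_pow n t).differentiableAt, by simp, ?_⟩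
    rw [show deriv (fun t : ℝ => max t 0 ^ (n + 1 + 1)) = fun t : ℝ => ((n : ℝ) + 2) * max t 0 ^ (n + 1) from
      funext fun t => (hasDerivAt_max_pow n t).deriv]
    exact contDiff_const.mul ih

/-- The truncated power `(1 - |y|²)₊ⁿ`. -/
def kp (n : ℕ) (y : R2) : ℝ := max (1 - ‖y‖ ^ 2) 0 ^ n

theorem contDiff_kp (n : ℕ) : ContDiff ℝ n (kp (n + 1)) :=
  (contDiff_max_pow n).comp (contDiff_const.sub (contDiff_norm_sq ℝ))

theorem kp_nonneg (n : ℕ) (y : R2) : 0 ≤ kp n y := pow_nonneg (le_max_right _ _) _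

theorem kp_le_one (n : ℕ) (y : R2) : kp n y ≤ 1 :=
  pow_le_one₀ (le_max_right _ _) (max_le (by nlinarith [sq_nonneg ‖y‖]) zero_le_one)

theorem kp_eq_zero {n : ℕ} (hn : n ≠ 0) {y : R2} (hy : 1 ≤ ‖y‖) : kp n y = 0 := by
  rw [kp, max_eq_right (by nlinarith), zero_pow hn]

theorem pd_norm_sq (y : R2) (i : Fin 2) : pd i (fun y : R2 => 1 - ‖y‖ ^ 2) y = - (2 * y i) := by
  have := ((hasStrictFDerivAt_norm_sq y).hasFDerivAt.const_sub 1).fderiv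
  simp only [pd, this]
  simp [EuclideanSpace.inner_single_right]

theorem pd_kp (n : ℕ) (y : R2) (i : Fin 2) :
    pd i (kp (n + 2)) y = - (2 * (n + 2) * (y i * kp (n + 1) y)) := by
  have h := pd_comp (f := fun y : R2 => 1 - ‖y‖ ^ 2) (x := y) (hasDerivAt_max_pow n _)
    ((contDiff_const.sub (contDiff_norm_sq ℝ)).differentiable (n := 1) (by norm_num) y) i
  rw [pd_norm_sq] at h
  unfold kp
  rw [h]; ring

theorem tsupport_kp {n : ℕ} (hn : n ≠ 0) : tsupport (kp n) ⊆ closedBall 0 1 := by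
  refine closure_minimal (fun y hy => ?_) isClosed_closedBall
  rw [mem_closedBall_zero_iff]
  by_contra h
  exact hy (kp_eq_zero hn (not_le.1 h).le)

theorem hasCompactSupport_kp {n : ℕ} (hn : n ≠ 0) : HasCompactSupport (kp n) :=
  (isCompact_closedBall (0 : R2) 1).of_isClosed_subset (isClosed_tsupport _) (tsupport_kp hn)

/-- The weight used for averaging. -/
def psi : R2 → ℝ := kp 3

/-- The radial potential with `∇ kK y = - psi y • y`. -/
def kK (y : R2) : ℝ := (1 / 8) * kp 4 y

theorem contDiff_psi : ContDiff ℝ 2 psi := contDiff_kp 2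

theorem contDiff_kK : ContDiff ℝ 3 kK := contDiff_const.mul (contDiff_kp 3)

theorem continuous_psi : Continuous psi := contDiff_psi.continuous

theorem continuous_kK : Continuous kK := contDiff_kK.continuous

theorem psi_nonneg (y : R2) : 0 ≤ psi y := kp_nonneg _ _

theorem kK_nonneg (y : R2) : 0 ≤ kK y := mul_nonneg (by norm_num) (kp_nonneg _ _)

theorem kK_le_one (y : R2) : kK y ≤ 1 := by
  have := kp_le_one 4 y; unfold kK; linarith

theorem psi_eq_zero {y : R2} (hy : y ∉ closedBall (0 : R2) 1) : psi y = 0 :=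
  kp_eq_zero (by norm_num) (le_of_lt (by simpa using hy))

theorem kK_eq_zero {y : R2} (hy : y ∉ closedBall (0 : R2) 1) : kK y = 0 := by
  rw [kK, kp_eq_zero (by norm_num) (le_of_lt (by simpa using hy)), mul_zero]

theorem hasCompactSupport_psi : HasCompactSupport psi := hasCompactSupport_kp (by norm_num)

theorem hasCompactSupport_kK : HasCompactSupport kK :=
  (hasCompactSupport_kp (n := 4) (by norm_num)).mul_left

theorem pd_kK (y : R2) (i : Fin 2) : pd i kK y = - (y i * psi y) := by
  have := pd_const_mul (1 / 8) (kp 4) y i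
  have h2 := pd_kp 2 y i
  unfold kK psi
  rw [this, h2]; push_cast; ring

theorem pd_psi (y : R2) (i : Fin 2) : pd i psi y = - (6 * (y i * kp 2 y)) := by
  have h2 := pd_kp 1 y i
  unfold psi
  rw [h2]; push_cast; ring

theorem pd_kK_eq_zero {y : R2} (hy : y ∉ closedBall (0 : R2) 1) (i : Fin 2) : pd i kK y = 0 := by
  rw [pd_kK, psi_eq_zero hy]; simp

theorem pd_psi_eq_zero {y : R2} (hy : y ∉ closedBall (0 : R2) 1) (i : Fin 2) : pd i psi y = 0 := by
  rw [pd_psi, kp_eq_zero (by norm_num) (le_of_lt (by simpa using hy))]; simp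

theorem integrable_kK : Integrable kK :=
  continuous_kK.integrable_of_hasCompactSupport hasCompactSupport_kK

/-- The mass of `psi`. -/
def I0 : ℝ := ∫ y, psi y

theorem I0_pos : 0 < I0 := by
  refine (continuous_psi).integral_pos_of_hasCompactSupport_nonneg_nonzero hasCompactSupport_psi
    psi_nonneg (x := 0) ?_
  simp [psi, kp]

/-- The weighted (unnormalized) average of `h` at scale `R` around `x`. -/
def mv (h : R2 → ℝ) (x : R2) (R : ℝ) : ℝ := ∫ y, psi y * h (x + R • y)

theorem mv_zero (h : R2 → ℝ) (x : R2) : mv h x 0 = I0 * h x := by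
  simp [mv, I0, integral_mul_const]

theorem continuous_affine (x : R2) (R : ℝ) : Continuous fun y : R2 => x + R • y := by fun_prop

theorem Continuous.affine {h : R2 → ℝ} (hh : Continuous h) (x : R2) (R : ℝ) :
    Continuous fun y : R2 => h (x + R • y) := hh.comp (continuous_affine x R)

theorem contDiff_affine {n : WithTop ℕ∞} (x : R2) (R : ℝ) :
    ContDiff ℝ n fun y : R2 => x + R • y := by fun_prop

theorem integrable_psi_mul {h : R2 → ℝ} (hh : Continuous h) : Integrable fun y => psi y * h y := by
  simpa [mul_comm] using integrable_mul_of_compact hh continuous_psi hasCompactSupport_psi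

theorem integrable_kK_mul {h : R2 → ℝ} (hh : Continuous h) : Integrable fun y => kK y * h y := by
  simpa [mul_comm] using integrable_mul_of_compact hh continuous_kK hasCompactSupport_kK

theorem continuous_pd_kK (i : Fin 2) : Continuous (pd i kK) :=
  (contDiff_kK.pd (m := 2) (by norm_num) i).continuous

theorem integrable_pd_kK_mul {h : R2 → ℝ} (hh : Continuous h) (i : Fin 2) :
    Integrable fun y => pd i kK y * h y := by
  simpa [mul_comm] using integrable_mul_of_compact hh (continuous_pd_kK i)
    (hasCompactSupport_kK.pd i)

theorem hasDerivAt_mv {h : R2 → ℝ} (hh : ContDiff ℝ 1 h) (x : R2) (R : ℝ) :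
    HasDerivAt (mv h x) (- ((∫ y, pd 0 kK y * pd 0 h (x + R • y)) +
      ∫ y, pd 1 kK y * pd 1 h (x + R • y))) R := by
  have hc : ∀ i, Continuous (pd i h) := fun i => (hh.pd (m := 0) (by norm_num) i).continuous
  have hcd := hh.continuous_fderiv (by norm_num)
  have key := hasDerivAt_integral_of_ball (F := fun t y => psi y * h (x + t • y))
    (F' := fun t y => psi y * fderiv ℝ h (x + t • y) y) (R := R) (r := 1) (ρ := 1) one_pos
    (fun t _ => continuous_psi.mul (hh.continuous.comp (continuous_affine x t)))
    (fun t _ y hy => by simp [psi_eq_zero hy]) (fun t _ y hy => by simp [psi_eq_zero hy])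
    (by
      apply Continuous.continuousOn
      have := continuous_psi
      unfold Function.uncurry
      fun_prop)
    (fun t _ y => by
      refine HasDerivAt.const_mul _ ?_
      have h1 : HasDerivAt (fun t : ℝ => x + t • y) y t := by
        simpa using ((hasDerivAt_id t).smul_const y).const_add x
      exact ((hh.differentiable (by norm_num)) _).hasFDerivAt.comp_hasDerivAt t h1)
  refine key.congr_deriv ?_ |>.congr_of_eventuallyEq (Eventually.of_forall fun t => rfl)
  symm
  rw [← integral_add (integrable_pd_kK_mul ((hc 0).affine x R) 0)
    (integrable_pd_kK_mul ((hc 1).affine x R) 1), ← integral_neg]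
  congr 1; ext y
  rw [fderiv_eq_pd, pd_kK, pd_kK]; ring

theorem hasDerivAt_mv_lap {w : R2 → ℝ} (hw : ContDiff ℝ 2 w) (x : R2) (R : ℝ) :
    HasDerivAt (mv w x) (R * ∫ y, kK y * lap w (x + R • y)) R := by
  convert hasDerivAt_mv (hw.of_le (by norm_num)) x R using 1
  have hp : ∀ i, ContDiff ℝ 1 (pd i w) := fun i => hw.pd (by norm_num) i
  have h1 : ∀ i, ∫ y, pd i kK y * pd i w (x + R • y) =
      - (R * ∫ y, kK y * pd i (pd i w) (x + R • y)) := by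
    intro i
    have := integral_pd_mul (f := fun y => pd i w (x + R • y)) (g := kK)
      ((hp i).comp (contDiff_affine x R)) (contDiff_kK.of_le (by norm_num)) hasCompactSupport_kK i
    have e : (fun y => pd i w (x + R • y) * pd i kK y) = fun y => pd i kK y * pd i w (x + R • y) :=
      funext fun y => mul_comm _ _
    rw [e] at this
    rw [← integral_const_mul, ← neg_eq_iff_eq_neg.2 this]
    congr 2; ext y
    rw [pd_affine x R ((hp i).differentiable (by norm_num) _)]; ring
  rw [h1, h1]
  have hcc : ∀ i, Continuous (pd i (pd i w)) := fun i =>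
    ((hp i).pd (m := 0) (by norm_num) i).continuous
  rw [← neg_add, neg_neg, ← mul_add, ← integral_add
    (integrable_kK_mul ((hcc 0).affine x R))
    (integrable_kK_mul ((hcc 1).affine x R))]
  congr 2; ext y; rw [lap_eq]; ring

theorem integral_pd_pd_swap {W : R2 → ℝ} (hW : ContDiff ℝ 2 W) {H : R2 → ℝ} (hH : ContDiff ℝ 2 H)
    (hc : HasCompactSupport H) (i j : Fin 2) :
    ∫ y, pd j H y * pd j (pd i W) y = ∫ y, pd i H y * pd j (pd j W) y := by
  have hp : ∀ i, ContDiff ℝ 1 (pd i W) := fun i => hW.pd (by norm_num) i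
  have hq : ∀ i, ContDiff ℝ 1 (pd i H) := fun i => hH.pd (by norm_num) i
  have h1 := integral_pd_mul (hp j) (hq j) (hc.pd j) i
  have h2 := integral_pd_mul (hp j) (hq i) (hc.pd i) j
  have e1 : ∀ y, pd j (pd i W) y = pd i (pd j W) y := fun y =>
    pd_symm isOpen_univ hW.contDiffOn (mem_univ y) j i
  have e2 : ∀ y, pd j (pd i H) y = pd i (pd j H) y := fun y =>
    pd_symm isOpen_univ hH.contDiffOn (mem_univ y) j i
  simp only [e1, e2, mul_comm (pd _ H _)] at *
  rw [h1, h2]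

theorem hasDerivAt_mv_pd {w : R2 → ℝ} (hw : ContDiff ℝ 2 w) (x : R2) (R : ℝ) (i : Fin 2) :
    HasDerivAt (mv (pd i w) x) (- ∫ y, pd i kK y * lap w (x + R • y)) R := by
  have hp : ∀ i, ContDiff ℝ 1 (pd i w) := fun i => hw.pd (by norm_num) i
  convert hasDerivAt_mv (hp i) x R using 2
  have hcc : ∀ i j, Continuous (pd j (pd i w)) := fun i j =>
    ((hp i).pd (m := 0) (by norm_num) j).continuous
  have key : ∀ j, ∫ y, pd j kK y * pd j (pd i w) (x + R • y) =
      ∫ y, pd i kK y * pd j (pd j w) (x + R • y) := by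
    intro j
    by_cases hR : R = 0
    · subst hR
      have hz : ∀ i, ∫ y, pd i kK y = 0 := by
        intro i
        have := integral_mul_pd (f := fun _ => 1) isOpen_univ contDiffOn_const
          (contDiff_kK.of_le (by norm_num)) hasCompactSupport_kK (subset_univ _) i
        simpa [pd_const] using this
      simp [integral_mul_const, hz]
    · have := integral_pd_pd_swap (W := fun y => w (x + R • y)) (hw.comp (contDiff_affine x R))
        (contDiff_kK.of_le (by norm_num)) hasCompactSupport_kK i j
      have e1 : ∀ k l y, pd l (pd k fun y => w (x + R • y)) y =
          R ^ 2 * pd l (pd k w) (x + R • y) := by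
        intro k l y
        have : pd k (fun y => w (x + R • y)) = fun y => R * pd k w (x + R • y) :=
          funext fun y => pd_affine x R (hw.differentiable (by norm_num) _) k
        rw [this, pd_const_mul, pd_affine x R ((hp k).differentiable (by norm_num) _)]; ring
      simp only [e1, mul_left_comm _ (R ^ 2)] at this
      rw [integral_const_mul, integral_const_mul] at this
      exact mul_left_cancel₀ (pow_ne_zero 2 hR) this
  rw [key, key, ← integral_add
    (integrable_pd_kK_mul ((hcc 0 0).affine x R) i)
    (integrable_pd_kK_mul ((hcc 1 1).affine x R) i)]
  congr 1; ext y; rw [lap_eq]; ring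

theorem exists_contDiff_ext {f : R2 → ℝ} {x : R2} {r R : ℝ} (hr : 0 < r) (hrR : r < R)
    (hf : ContDiffOn ℝ 2 f (ball x R)) : ∃ F : R2 → ℝ, ContDiff ℝ 2 F ∧ EqOn F f (ball x r) := by
  let b : ContDiffBump x := ⟨r, (r + R) / 2, hr, by linarith⟩
  refine ⟨fun y => b y * f y, contDiff_iff_contDiffAt.2 fun y => ?_, fun y hy => ?_⟩
  · by_cases hy : y ∈ ball x R
    · exact b.contDiff.contDiffAt.mul (hf.contDiffAt (isOpen_ball.mem_nhds hy))
    · have h1 : y ∈ (closedBall x ((r + R) / 2))ᶜ := by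
        simp only [mem_ball, not_lt, mem_compl_iff, mem_closedBall, not_le] at hy ⊢; linarith
      refine (contDiffAt_const (c := (0 : ℝ))).congr_of_eventuallyEq ?_
      filter_upwards [isClosed_closedBall.isOpen_compl.mem_nhds h1] with z hz
      have : b z = 0 := b.zero_of_le_dist (le_of_lt (by simpa using hz))
      simp [this]
  · have : b y = 1 := b.one_of_mem_closedBall (ball_subset_closedBall hy)
    simp [this]

theorem affine_mem_closedBall {x y : R2} {R : ℝ} (hR : 0 ≤ R) (hy : y ∈ closedBall (0 : R2) 1) :
    x + R • y ∈ closedBall x R := by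
  rw [mem_closedBall_zero_iff] at hy
  simp only [mem_closedBall, dist_self_add_left, norm_smul, Real.norm_eq_abs, abs_of_nonneg hR]
  nlinarith

/-- The mass of `kK`. -/
def k0 : ℝ := ∫ y, kK y

theorem k0_nonneg : 0 ≤ k0 := integral_nonneg kK_nonneg

theorem continuous_lap {w : R2 → ℝ} (hw : ContDiff ℝ 2 w) : Continuous (lap w) := by
  have h : ∀ i, Continuous (pd i (pd i w)) := fun i =>
    ((hw.pd (m := 1) (by norm_num) i).pd (m := 0) (by norm_num) i).continuous
  have : lap w = fun x => pd 0 (pd 0 w) x + pd 1 (pd 1 w) x := funext (lap_eq w)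
  rw [this]; exact (h 0).add (h 1)

theorem integral_kK_mul_le {g : R2 → ℝ} (hg : Continuous g) {x : R2} {R B : ℝ} (hR : 0 ≤ R)
    (h : ∀ y ∈ closedBall x R, g y ≤ B) : ∫ y, kK y * g (x + R • y) ≤ k0 * B := by
  rw [k0, ← integral_mul_const]
  refine integral_mono (integrable_kK_mul (hg.affine x R)) (integrable_kK.mul_const B) fun y => ?_
  by_cases hy : y ∈ closedBall (0 : R2) 1
  · exact mul_le_mul_of_nonneg_left (h _ (affine_mem_closedBall hR hy)) (kK_nonneg y)
  · simp [kK_eq_zero hy]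

theorem mv_le {w : R2 → ℝ} (hw : ContDiff ℝ 2 w) {x : R2} {R B : ℝ} (hR : 0 ≤ R) (hB : 0 ≤ B)
    (h : ∀ y ∈ closedBall x R, lap w y ≤ B) : mv w x R ≤ I0 * w x + k0 * B * R ^ 2 := by
  have hd := fun t => hasDerivAt_mv_lap hw x t
  have := (convex_Icc 0 R).image_sub_le_mul_sub_of_deriv_le (f := mv w x)
    (fun t _ => (hd t).continuousAt.continuousWithinAt)
    (fun t _ => (hd t).differentiableAt.differentiableWithinAt) (C := R * (k0 * B)) (by
      intro t ht
      rw [interior_Icc] at ht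
      rw [(hd t).deriv]
      have := integral_kK_mul_le (continuous_lap hw) (x := x) ht.1.le
        (fun y hy => h y (closedBall_subset_closedBall ht.2.le hy))
      have h0 : 0 ≤ k0 * B := mul_nonneg k0_nonneg hB
      calc t * _ ≤ t * (k0 * B) := mul_le_mul_of_nonneg_left this ht.1.le
        _ ≤ _ := mul_le_mul_of_nonneg_right ht.2.le h0)
    0 (left_mem_Icc.2 hR) R (right_mem_Icc.2 hR) hR
  rw [mv_zero] at this
  nlinarith

theorem mv_neg (w : R2 → ℝ) (x : R2) (R : ℝ) : mv (fun y => - w y) x R = - mv w x R := by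
  simp [mv, integral_neg]

theorem lap_neg (w : R2 → ℝ) (x : R2) : lap (fun y => - w y) x = - lap w x := by
  have : ∀ i, pd i (fun y => - w y) = fun y => - pd i w y := fun i => funext fun y => pd_neg w y i
  rw [lap_eq, lap_eq, this, this, pd_neg, pd_neg]; ring

theorem le_mv {w : R2 → ℝ} (hw : ContDiff ℝ 2 w) {x : R2} {R B : ℝ} (hR : 0 ≤ R) (hB : 0 ≤ B)
    (h : ∀ y ∈ closedBall x R, - B ≤ lap w y) : I0 * w x ≤ mv w x R + k0 * B * R ^ 2 := by
  have := mv_le hw.neg (x := x) hR hB (fun y hy => by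
    rw [lap_neg]; linarith [h y hy])
  rw [mv_neg] at this
  linarith

theorem psi_le_psi {s t : R2} (hs : ‖s‖ ≤ 1 / 2) : psi t ≤ 64 / 27 * psi s := by
  have h1 : psi t ≤ 1 := kp_le_one _ _
  have h2 : (3 / 4 : ℝ) ≤ max (1 - ‖s‖ ^ 2) 0 := le_max_of_le_left (by nlinarith [norm_nonneg s])
  have h3 : (3 / 4 : ℝ) ^ 3 ≤ psi s := pow_le_pow_left₀ (by norm_num) h2 3
  linarith

theorem integral_comp_affine (G : R2 → ℝ) (c : R2) {r : ℝ} :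
    ∫ t : R2, G (c + r • t) = (r ^ 2)⁻¹ * ∫ s, G s := by
  rw [MeasureTheory.Measure.integral_comp_smul volume (fun s => G (c + s)) r,
    integral_add_left_eq_self]
  simp

theorem mv_le_mv {w : R2 → ℝ} (hw : Continuous w) {R : ℝ} (hR : 0 < R)
    (h0 : ∀ y ∈ closedBall (0 : R2) (4 * R), 0 ≤ w y) {y : R2} (hy : ‖y‖ ≤ R) :
    mv w y R ≤ 1024 / 27 * mv w 0 (4 * R) := by
  have hG : Continuous fun s => psi s * w (0 + (4 * R) • s) := continuous_psi.mul (hw.affine 0 _)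
  have key := integral_comp_affine (fun s => psi s * w (0 + (4 * R) • s)) ((1 / (4 * R)) • y)
    (r := 1 / 4)
  have e : ∀ t : R2, (0 : R2) + (4 * R) • ((1 / (4 * R)) • y + (1 / 4 : ℝ) • t) = y + R • t := by
    intro t
    rw [zero_add, smul_add, smul_smul, smul_smul]
    congr 2
    · rw [show 4 * R * (1 / (4 * R)) = 1 by field_simp, one_smul]
    · ring
  simp only [e] at key
  have : mv w 0 (4 * R) = 1 / 16 *
      ∫ t : R2, psi ((1 / (4 * R)) • y + (1 / 4 : ℝ) • t) * w (y + R • t) := by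
    rw [key, mv]; ring
  rw [this, ← mul_assoc, ← integral_const_mul, mv]
  refine integral_mono (integrable_psi_mul (hw.affine y R)) ?_ fun t => ?_
  · refine Integrable.const_mul ?_ _
    have h1 : HasCompactSupport fun s => psi s * w (0 + (4 * R) • s) :=
      hasCompactSupport_psi.mul_right
    have h2 := (hG.integrable_of_hasCompactSupport h1 (μ := volume)).comp_add_left ((1 / (4 * R)) • y)
    have h3 := h2.comp_smul (R := (1 / 4 : ℝ)) (by norm_num)
    simpa only [e] using h3
  · simp only
    set s : R2 := (1 / (4 * R)) • y + (1 / 4 : ℝ) • t with hs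
    by_cases ht : ‖t‖ ≤ 1
    · have hs2 : ‖s‖ ≤ 1 / 2 := by
        refine (norm_add_le _ _).trans ?_
        rw [norm_smul, norm_smul, Real.norm_of_nonneg (by positivity),
          Real.norm_of_nonneg (by norm_num)]
        have : 1 / (4 * R) * ‖y‖ ≤ 1 / 4 := by
          rw [div_mul_eq_mul_div, one_mul, div_le_iff₀ (by positivity)]; linarith
        linarith
      have hw0 : 0 ≤ w (y + R • t) := by
        refine h0 _ ?_
        rw [mem_closedBall_zero_iff]
        refine (norm_add_le _ _).trans ?_
        rw [norm_smul, Real.norm_of_nonneg hR.le]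
        nlinarith
      have := mul_le_mul_of_nonneg_right (psi_le_psi (t := t) hs2) hw0
      linarith
    · rw [psi_eq_zero (by simpa using ht), zero_mul]
      by_cases hs1 : s ∈ closedBall (0 : R2) 1
      · have : 0 ≤ w (y + R • t) := by
          rw [← e t]
          exact h0 _ (affine_mem_closedBall (x := 0) (R := 4 * R) (by positivity) hs1)
        have h5 := psi_nonneg s
        positivity
      · rw [psi_eq_zero hs1]; simp

/-- A Harnack-type inequality for nonnegative functions with bounded Laplacian. -/
theorem exists_harnack : ∃ C : ℝ, 0 < C ∧ ∀ (w : R2 → ℝ) (R B : ℝ), 0 < R → 0 ≤ B →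
    ContDiffOn ℝ 2 w (ball 0 (5 * R)) → (∀ y ∈ ball (0 : R2) (5 * R), 0 ≤ w y) →
    (∀ y ∈ ball (0 : R2) (5 * R), |lap w y| ≤ B) →
    ∀ y : R2, ‖y‖ ≤ R → w y ≤ C * (w 0 + B * R ^ 2) := by
  have hI := I0_pos
  have hk := k0_nonneg
  refine ⟨1024 / 27 + 1024 / 27 * 16 * (k0 / I0) + k0 / I0, by positivity, ?_⟩
  intro w R B hR hB hw hw0 hwB y hy
  obtain ⟨F, hF, hFw⟩ := exists_contDiff_ext (r := 9 / 2 * R) (by positivity) (by linarith) hw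
  have hlap := lap_congr isOpen_ball hFw
  have hsub : ∀ z : R2, ‖z‖ ≤ 4 * R → z ∈ ball (0 : R2) (9 / 2 * R) := by
    intro z hz; rw [mem_ball_zero_iff]; linarith
  have hsub' : ball (0 : R2) (9 / 2 * R) ⊆ ball 0 (5 * R) := ball_subset_ball (by linarith)
  have hF0 : ∀ z : R2, ‖z‖ ≤ 4 * R → 0 ≤ F z := fun z hz => by
    rw [hFw (hsub z hz)]; exact hw0 _ (hsub' (hsub z hz))
  have hFB : ∀ z : R2, ‖z‖ ≤ 4 * R → |lap F z| ≤ B := fun z hz => by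
    rw [hlap (hsub z hz)]; exact hwB _ (hsub' (hsub z hz))
  have h1 := le_mv hF (x := y) hR.le hB (fun z hz => by
    rw [mem_closedBall_iff_norm] at hz
    have : ‖z‖ ≤ 4 * R := by
      have := norm_add_le (z - y) y
      rw [sub_add_cancel] at this; linarith
    exact (abs_le.1 (hFB z this)).1)
  have h2 := mv_le hF (x := 0) (R := 4 * R) (by positivity) hB (fun z hz =>
    (abs_le.1 (hFB z (by simpa using hz))).2)
  have h3 := mv_le_mv hF.continuous hR (fun z hz => hF0 z (by simpa using hz)) hy
  rw [← hFw (hsub y (by linarith)), ← hFw (hsub 0 (by simp; positivity))]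
  have h4 : I0 * F y ≤ 1024 / 27 * (I0 * F 0 + k0 * B * (4 * R) ^ 2) + k0 * B * R ^ 2 := by linarith
  have h5 : I0 * ((1024 / 27 + 1024 / 27 * 16 * (k0 / I0) + k0 / I0) * (F 0 + B * R ^ 2)) =
      1024 / 27 * (I0 * F 0 + k0 * B * (4 * R) ^ 2) + k0 * B * R ^ 2 +
      (1024 / 27 * I0 * B * R ^ 2 + 1024 / 27 * 16 * k0 * F 0 + k0 * F 0) := by
    field_simp; ring
  have h6 : 0 ≤ F 0 := hF0 0 (by simp; positivity)
  have h7 : 0 ≤ 1024 / 27 * I0 * B * R ^ 2 + 1024 / 27 * 16 * k0 * F 0 + k0 * F 0 := by positivity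
  exact le_of_mul_le_mul_left (by linarith) hI

theorem abs_integral_pd_kK_mul_le {g : R2 → ℝ} (hg : Continuous g) {x : R2} {R B : ℝ} (hR : 0 ≤ R)
    (h : ∀ y ∈ closedBall x R, |g y| ≤ B) (i : Fin 2) :
    |∫ y, pd i kK y * g (x + R • y)| ≤ (∫ y, |pd i kK y|) * B := by
  have hi : Integrable (fun y => |pd i kK y|) := ((continuous_pd_kK i).integrable_of_hasCompactSupport
    (hasCompactSupport_kK.pd i)).abs
  rw [← integral_mul_const]
  refine (abs_integral_le_integral_abs).trans (integral_mono
    (integrable_pd_kK_mul (hg.affine x R) i).abs (hi.mul_const B) fun y => ?_)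
  simp only [abs_mul]
  by_cases hy : y ∈ closedBall (0 : R2) 1
  · exact mul_le_mul_of_nonneg_left (h _ (affine_mem_closedBall hR hy)) (abs_nonneg _)
  · simp [pd_kK_eq_zero hy]

theorem continuous_pd_psi (i : Fin 2) : Continuous (pd i psi) :=
  (contDiff_psi.pd (m := 1) (by norm_num) i).continuous

/-- Interior gradient estimate for the Poisson equation. -/
theorem exists_gradient_estimate : ∃ C : ℝ, 0 < C ∧ ∀ (f : R2 → ℝ) (x : R2) (A B : ℝ),
    ContDiffOn ℝ 2 f (ball x 2) → (∀ y ∈ ball x 2, |f y| ≤ A) → (∀ y ∈ ball x 2, |lap f y| ≤ B) →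
    ∀ i, |pd i f x| ≤ C * (A + B) := by
  have hI := I0_pos
  set P : ℝ := (∫ y, |pd 0 psi y|) + ∫ y, |pd 1 psi y| with hP
  set Q : ℝ := (∫ y, |pd 0 kK y|) + ∫ y, |pd 1 kK y| with hQ
  have hP0 : ∀ i, 0 ≤ ∫ y, |pd i psi y| := fun i => integral_nonneg fun y => abs_nonneg _
  have hQ0 : ∀ i, 0 ≤ ∫ y, |pd i kK y| := fun i => integral_nonneg fun y => abs_nonneg _
  have hPi : ∀ i, ∫ y, |pd i psi y| ≤ P := by
    intro i; fin_cases i <;> simp [hP, hP0]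
  have hQi : ∀ i, ∫ y, |pd i kK y| ≤ Q := by
    intro i; fin_cases i <;> simp [hQ, hQ0]
  have hPp := (hP0 0).trans (hPi 0)
  have hQp := (hQ0 0).trans (hQi 0)
  refine ⟨(P + Q + 1) / I0, by positivity, fun f x A B hf hA hB i => ?_⟩
  have hxx : x ∈ ball x 2 := mem_ball_self two_pos
  have hA0 : 0 ≤ A := (abs_nonneg _).trans (hA x hxx)
  have hB0 : 0 ≤ B := (abs_nonneg _).trans (hB x hxx)
  obtain ⟨F, hF, hFf⟩ := exists_contDiff_ext (r := 3 / 2) (by norm_num) (by norm_num) hf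
  have hlap := lap_congr isOpen_ball hFf
  have hsub : closedBall x 1 ⊆ ball x (3 / 2) := closedBall_subset_ball (by norm_num)
  have hsub' : ball x (3 / 2) ⊆ ball x 2 := ball_subset_ball (by norm_num)
  have hFA : ∀ y ∈ closedBall x 1, |F y| ≤ A := fun y hy => by
    rw [hFf (hsub hy)]; exact hA _ (hsub' (hsub hy))
  have hFB : ∀ y ∈ closedBall x 1, |lap F y| ≤ B := fun y hy => by
    rw [hlap (hsub hy)]; exact hB _ (hsub' (hsub hy))
  rw [← pd_congr isOpen_ball hFf i (mem_ball_self (by norm_num))]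
  have hd := fun t => hasDerivAt_mv_pd hF x t i
  have h1 : |mv (pd i F) x 1 - mv (pd i F) x 0| ≤ Q * B := by
    have hbd : ∀ t ∈ interior (Icc (0 : ℝ) 1), |deriv (mv (pd i F) x) t| ≤ Q * B := by
      intro t ht
      rw [interior_Icc] at ht
      rw [(hd t).deriv, abs_neg]
      refine (abs_integral_pd_kK_mul_le (continuous_lap hF) ht.1.le
        (fun y hy => hFB y (closedBall_subset_closedBall ht.2.le hy)) i).trans ?_
      exact mul_le_mul_of_nonneg_right (hQi i) hB0
    have hc : ContinuousOn (mv (pd i F) x) (Icc 0 1) :=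
      fun t _ => (hd t).continuousAt.continuousWithinAt
    have hdf : DifferentiableOn ℝ (mv (pd i F) x) (interior (Icc 0 1)) :=
      fun t _ => (hd t).differentiableAt.differentiableWithinAt
    have u1 := (convex_Icc (0 : ℝ) 1).image_sub_le_mul_sub_of_deriv_le hc hdf
      (fun t ht => (abs_le.1 (hbd t ht)).2) 0 (by simp) 1 (by simp) zero_le_one
    have u2 := (convex_Icc (0 : ℝ) 1).mul_sub_le_image_sub_of_le_deriv hc hdf
      (fun t ht => (abs_le.1 (hbd t ht)).1) 0 (by simp) 1 (by simp) zero_le_one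
    rw [abs_le]; constructor <;> linarith
  have h2 : |mv (pd i F) x 1| ≤ P * A := by
    have hi : Integrable (fun y => |pd i psi y|) :=
      ((continuous_pd_psi i).integrable_of_hasCompactSupport (hasCompactSupport_psi.pd i)).abs
    have e : mv (pd i F) x 1 = - ∫ y, F (x + (1 : ℝ) • y) * pd i psi y := by
      have := integral_mul_pd (f := fun y => F (x + (1 : ℝ) • y)) isOpen_univ
        ((hF.of_le (by norm_num)).comp (contDiff_affine x 1)).contDiffOn
        (contDiff_psi.of_le (by norm_num)) hasCompactSupport_psi (subset_univ _) i
      rw [this, neg_neg, mv]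
      congr 1; ext y
      rw [pd_affine x 1 (hF.differentiable (by norm_num) _)]; ring
    rw [e, abs_neg]
    refine (abs_integral_le_integral_abs).trans (le_trans ?_
      (mul_le_mul_of_nonneg_right (hPi i) hA0))
    rw [← integral_mul_const]
    refine integral_mono (integrable_mul_of_compact (hF.continuous.affine x 1) (continuous_pd_psi i)
      (hasCompactSupport_psi.pd i)).abs (hi.mul_const A) fun y => ?_
    simp only [abs_mul]
    by_cases hy : y ∈ closedBall (0 : R2) 1
    · rw [mul_comm]
      exact mul_le_mul_of_nonneg_left (hFA _ (affine_mem_closedBall zero_le_one hy)) (abs_nonneg _)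
    · simp [pd_psi_eq_zero hy]
  rw [mv_zero] at h1
  have h3 : |I0 * pd i F x| ≤ P * A + Q * B := by
    have := abs_sub_abs_le_abs_sub (I0 * pd i F x) (mv (pd i F) x 1)
    rw [abs_sub_comm] at this
    linarith
  rw [abs_mul, abs_of_pos hI] at h3
  rw [div_mul_eq_mul_div, le_div_iff₀ hI]
  nlinarith

theorem hasDerivAt_line {f : R2 → ℝ} {y : R2} {t : ℝ} {i : Fin 2}
    (hf : DifferentiableAt ℝ f (y + t • EuclideanSpace.single i 1)) :
    HasDerivAt (fun t : ℝ => f (y + t • EuclideanSpace.single i 1))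
      (pd i f (y + t • EuclideanSpace.single i 1)) t := by
  have h1 : HasDerivAt (fun t : ℝ => y + t • (EuclideanSpace.single i 1 : R2))
      (EuclideanSpace.single i 1) t := by
    simpa using ((hasDerivAt_id t).smul_const (EuclideanSpace.single i 1 : R2)).const_add y
  exact hf.hasFDerivAt.comp_hasDerivAt t h1

theorem abs_line_sub_le {f : R2 → ℝ} {y : R2} {h A : ℝ} {i : Fin 2} (hh : 0 ≤ h)
    (hf : ∀ t ∈ Icc 0 h, DifferentiableAt ℝ f (y + t • EuclideanSpace.single i 1))
    (hA : ∀ t ∈ Icc 0 h, |pd i f (y + t • EuclideanSpace.single i 1)| ≤ A) :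
    |f (y + h • EuclideanSpace.single i 1) - f y| ≤ A * h := by
  have := norm_image_sub_le_of_norm_deriv_le_segment' (f := fun t : ℝ =>
    f (y + t • EuclideanSpace.single i 1)) (C := A)
    (fun t ht => (hasDerivAt_line (hf t ht)).hasDerivWithinAt)
    (fun t ht => hA t ⟨ht.1, ht.2.le⟩) h (right_mem_Icc.2 hh)
  simpa using this

theorem lap_const_mul (c : ℝ) (w : R2 → ℝ) (x : R2) : lap (fun y => c * w y) x = c * lap w x := by
  have : ∀ i, pd i (fun y => c * w y) = fun y => c * pd i w y := fun i =>
    funext fun y => pd_const_mul c w y i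
  rw [lap_eq, lap_eq, this, this, pd_const_mul, pd_const_mul]; ring

theorem lap_sub {f g : R2 → ℝ} {D : Set R2} (hD : IsOpen D) (hf : ContDiffOn ℝ 2 f D)
    (hg : ContDiffOn ℝ 2 g D) {x : R2} (hx : x ∈ D) :
    lap (fun y => f y - g y) x = lap f x - lap g x := by
  have hdf : ∀ {f : R2 → ℝ} (_ : ContDiffOn ℝ 1 f D), ∀ z ∈ D, DifferentiableAt ℝ f z :=
    fun hf z hz => (hf.differentiableOn (by norm_num) z hz).differentiableAt (hD.mem_nhds hz)
  have h1 : ∀ i, EqOn (pd i fun y => f y - g y) (fun y => pd i f y - pd i g y) D := fun i z hz =>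
    pd_sub (hdf (hf.of_le (by norm_num)) z hz) (hdf (hg.of_le (by norm_num)) z hz) i
  have h2 : ∀ i, pd i (pd i fun y => f y - g y) x = pd i (pd i f) x - pd i (pd i g) x := fun i => by
    rw [pd_congr hD (h1 i) i hx, pd_sub (hdf (hf.pd hD (by norm_num) i) x hx)
      (hdf (hg.pd hD (by norm_num) i) x hx)]
  rw [lap_eq, lap_eq, lap_eq, h2, h2]; ring

theorem pd_comp_add (f : R2 → ℝ) (c x : R2) (i : Fin 2) :
    pd i (fun y => f (y + c)) x = pd i f (x + c) := by
  simp [pd, fderiv_comp_add_right]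

theorem lap_comp_add (f : R2 → ℝ) (c x : R2) : lap (fun y => f (y + c)) x = lap f (x + c) := by
  have : ∀ i, pd i (fun y => f (y + c)) = fun y => pd i f (y + c) := fun i =>
    funext fun y => pd_comp_add f c y i
  rw [lap_eq, lap_eq, this, this, pd_comp_add, pd_comp_add]

/-- Interior second derivative estimate for the Poisson equation. -/
theorem exists_hessian_estimate : ∃ C : ℝ, 0 < C ∧ ∀ (f : R2 → ℝ) (x : R2) (A B : ℝ),
    ContDiffOn ℝ 2 f (ball x 4) → ContDiffOn ℝ 1 (lap f) (ball x 4) → ∀ i,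
    (∀ y ∈ ball x 4, |pd i f y| ≤ A) → (∀ y ∈ ball x 4, |pd i (lap f) y| ≤ B) →
    ∀ j, |pd i (pd j f) x| ≤ C * (A + B) := by
  obtain ⟨C, hC, hCe⟩ := exists_gradient_estimate
  refine ⟨C, hC, fun f x A B hf hl i hA hB j => ?_⟩
  set e : R2 := EuclideanSpace.single i 1 with he
  have hne : ‖e‖ = 1 := by simp [he]
  have hshift : ∀ h ∈ Ioo (0 : ℝ) 1, ∀ y ∈ ball x 2, ∀ t ∈ Icc 0 h, y + t • e ∈ ball x 4 := by
    intro h hh y hy t ht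
    rw [mem_ball_iff_norm] at hy ⊢
    have : y + t • e - x = (y - x) + t • e := by abel
    rw [this]
    refine (norm_add_le _ _).trans_lt ?_
    rw [norm_smul, hne, Real.norm_of_nonneg ht.1]
    linarith [ht.2, hh.2]
  have hdf : ∀ {f : R2 → ℝ} (_ : ContDiffOn ℝ 1 f (ball x 4)), ∀ z ∈ ball x 4,
      DifferentiableAt ℝ f z := fun hf z hz =>
    (hf.differentiableOn (by norm_num) z hz).differentiableAt (isOpen_ball.mem_nhds hz)
  have hx4 : x ∈ ball x 4 := mem_ball_self (by norm_num)
  have hx2 : x ∈ ball x 2 := mem_ball_self (by norm_num)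
  have hsub : ball x 2 ⊆ ball x 4 := ball_subset_ball (by norm_num)
  have main : ∀ h ∈ Ioo (0 : ℝ) 1, |h⁻¹ * (pd j f (x + h • e) - pd j f x)| ≤ C * (A + B) := by
    intro h hh
    have hm : ∀ y ∈ ball x 2, y + h • e ∈ ball x 4 := fun y hy =>
      hshift h hh y hy h ⟨hh.1.le, le_rfl⟩
    have hs1 : ContDiffOn ℝ 2 (fun y => f (y + h • e)) (ball x 2) :=
      hf.comp (by fun_prop) hm
    have hs2 : ContDiffOn ℝ 2 (fun y => f (y + h • e) - f y) (ball x 2) := hs1.sub (hf.mono hsub)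
    have hab : ∀ a b : ℝ, |a| ≤ b * h → |h⁻¹ * a| ≤ b := by
      intro a b hab
      rw [abs_mul, abs_of_pos (inv_pos.2 hh.1), inv_mul_le_iff₀ hh.1]; linarith
    have := hCe (fun y => h⁻¹ * (f (y + h • e) - f y)) x A B (contDiffOn_const.mul hs2) ?_ ?_ j
    · rw [pd_const_mul, pd_sub (((hs1.of_le (by norm_num)).differentiableOn one_ne_zero x
        hx2).differentiableAt (isOpen_ball.mem_nhds hx2)) (hdf (hf.of_le (by norm_num)) x hx4),
        pd_comp_add] at this
      exact this
    · intro y hy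
      exact hab _ _ (abs_line_sub_le hh.1.le
        (fun t ht => hdf (hf.of_le (by norm_num)) _ (hshift h hh y hy t ht))
        (fun t ht => hA _ (hshift h hh y hy t ht)))
    · intro y hy
      rw [lap_const_mul, lap_sub isOpen_ball hs1 (hf.mono hsub) hy, lap_comp_add]
      exact hab _ _ (abs_line_sub_le hh.1.le
        (fun t ht => hdf hl _ (hshift h hh y hy t ht))
        (fun t ht => hB _ (hshift h hh y hy t ht)))
  have hd : HasDerivAt (fun t : ℝ => pd j f (x + t • e)) (pd i (pd j f) x) 0 := by
    have := hasDerivAt_line (f := pd j f) (y := x) (t := 0) (i := i)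
      (by simpa using hdf (hf.pd isOpen_ball (by norm_num) j) x hx4)
    simpa using this
  have ht := hd.tendsto_slope_zero_right
  simp only [zero_add, zero_smul, add_zero, smul_eq_mul] at ht
  refine le_of_tendsto ht.abs ?_
  filter_upwards [Ioo_mem_nhdsGT (one_pos (α := ℝ))] with h hh
  exact main h hh

theorem pd_coord (x : R2) (i : Fin 2) : pd i (fun y : R2 => y i) x = 1 := by
  have h : HasFDerivAt (fun y : R2 => y i) (EuclideanSpace.proj i : R2 →L[ℝ] ℝ) x :=
    (EuclideanSpace.proj i : R2 →L[ℝ] ℝ).hasFDerivAt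
  simp [pd, h.fderiv]

theorem pd_coord_ne (x : R2) {i j : Fin 2} (hij : i ≠ j) : pd i (fun y : R2 => y j) x = 0 := by
  have h : HasFDerivAt (fun y : R2 => y j) (EuclideanSpace.proj j : R2 →L[ℝ] ℝ) x :=
    (EuclideanSpace.proj j : R2 →L[ℝ] ℝ).hasFDerivAt
  simp [pd, h.fderiv, hij.symm]

theorem contDiff_coord {n : WithTop ℕ∞} (i : Fin 2) : ContDiff ℝ n (fun y : R2 => y i) :=
  (EuclideanSpace.proj i : R2 →L[ℝ] ℝ).contDiff

theorem lap_kK (y : R2) : lap kK y = - 2 * psi y + 6 * (‖y‖ ^ 2 * kp 2 y) := by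
  have h1 : ∀ i, pd i kK = fun y => - (y i * psi y) := fun i => funext fun y => pd_kK y i
  have h2 : ∀ i, pd i (pd i kK) y = - (y i * pd i psi y + psi y) := by
    intro i
    rw [h1, pd_neg, pd_mul ((contDiff_coord (n := 1) i).differentiable (by norm_num) y)
      (contDiff_psi.differentiable (by norm_num) y), pd_coord, one_mul]
  rw [lap_eq, h2, h2, pd_psi, pd_psi, norm_sq_eq]
  ring

theorem pd_pd_affine {w : R2 → ℝ} (hw : ContDiff ℝ 2 w) (a : R2) (R : ℝ) (y : R2) (i j : Fin 2) :
    pd i (pd j fun y => w (a + R • y)) y = R ^ 2 * pd i (pd j w) (a + R • y) := by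
  have h1 : pd j (fun y => w (a + R • y)) = fun y => R * pd j w (a + R • y) :=
    funext fun y => pd_affine a R (hw.differentiable (by norm_num) _) j
  rw [h1, pd_const_mul, pd_affine a R ((hw.pd (m := 1) (by norm_num) j).differentiable
    (by norm_num) _)]
  ring

theorem lap_affine {w : R2 → ℝ} (hw : ContDiff ℝ 2 w) (a : R2) (R : ℝ) (y : R2) :
    lap (fun y => w (a + R • y)) y = R ^ 2 * lap w (a + R • y) := by
  rw [lap_eq, lap_eq, pd_pd_affine hw, pd_pd_affine hw]; ring

theorem continuous_mv {h : R2 → ℝ} (hh : Continuous h) (x : R2) : Continuous (mv h x) := by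
  have h1 : mv h x = fun R => ∫ y in closedBall (0 : R2) 1, psi y * h (x + R • y) := by
    ext R
    exact (setIntegral_eq_integral_of_forall_compl_eq_zero fun y hy => by
      simp [psi_eq_zero hy]).symm
  rw [h1]
  have hp := continuous_psi
  exact continuous_parametric_integral_of_continuous (by fun_prop) (isCompact_closedBall _ _)

theorem mv_eq_integral (h : R2 → ℝ) (x : R2) {t : ℝ} (ht : t ≠ 0) :
    mv h x t = ∫ y, (t ^ 2)⁻¹ * (psi (t⁻¹ • y) * h (x + y)) := by
  have := integral_comp_affine (fun s => psi (t⁻¹ • s) * h (x + s)) 0 (r := t)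
  rw [integral_const_mul, ← this, mv]
  simp [smul_smul, ht]

theorem hasDerivAt_mv_weak {h : R2 → ℝ} (hh : Continuous h) (x : R2) {R : ℝ} (hR : 0 < R) :
    HasDerivAt (mv h x) (∫ y, (R ^ 3)⁻¹ * (lap kK (R⁻¹ • y) * h (x + y))) R := by
  have hp := continuous_psi
  have hl : Continuous (lap kK) := continuous_lap (contDiff_kK.of_le (by norm_num))
  have hmem : ∀ t ∈ closedBall R (R / 2), R / 2 ≤ t ∧ t ≤ 2 * R := by
    intro t ht
    rw [mem_closedBall, Real.dist_eq, abs_le] at ht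
    constructor <;> linarith
  have hout : ∀ t ∈ closedBall R (R / 2), ∀ y ∉ closedBall (0 : R2) (2 * R),
      t⁻¹ • y ∉ closedBall (0 : R2) 1 := by
    intro t ht y hy
    have h1 := hmem t ht
    have h2 : 0 < t := by linarith
    rw [mem_closedBall_zero_iff, not_le] at hy ⊢
    rw [norm_smul, Real.norm_of_nonneg (by positivity), inv_mul_eq_div, lt_div_iff₀ h2]
    linarith
  have hlz : ∀ y ∉ closedBall (0 : R2) 1, lap kK y = 0 := by
    intro y hy
    rw [lap_kK, psi_eq_zero hy, kp_eq_zero (by norm_num) (le_of_lt (by simpa using hy))]; simp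
  refine (hasDerivAt_integral_of_ball (F := fun t y => (t ^ 2)⁻¹ * (psi (t⁻¹ • y) * h (x + y)))
    (F' := fun t y => (t ^ 3)⁻¹ * (lap kK (t⁻¹ • y) * h (x + y))) (r := R / 2) (ρ := 2 * R)
    (by positivity) ?_ ?_ ?_ ?_ ?_).congr_of_eventuallyEq ?_
  · intro t _; fun_prop
  · intro t ht y hy; simp [psi_eq_zero (hout t ht y hy)]
  · intro t ht y hy; simp [hlz _ (hout t ht y hy)]
  · have h1 : ∀ q ∈ closedBall R (R / 2) ×ˢ closedBall (0 : R2) (2 * R), q.1 ≠ 0 := by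
      rintro ⟨t, y⟩ ⟨ht, -⟩
      have := hmem t ht
      simp only; linarith
    have h2 : ContinuousOn (fun q : ℝ × R2 => q.1⁻¹ • q.2)
      (closedBall R (R / 2) ×ˢ closedBall (0 : R2) (2 * R)) :=
      (continuousOn_fst.inv₀ h1).smul continuousOn_snd
    have h3 : ContinuousOn (fun q : ℝ × R2 => (q.1 ^ 3)⁻¹)
      (closedBall R (R / 2) ×ˢ closedBall (0 : R2) (2 * R)) :=
      (continuousOn_fst.pow 3).inv₀ fun q hq => pow_ne_zero _ (h1 q hq)
    exact h3.mul ((hl.comp_continuousOn h2).mul (by fun_prop))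
  · intro t ht y
    have h0 := (hmem t ht).1
    have h1 : t ≠ 0 := by linarith
    have h2 : HasDerivAt (fun t : ℝ => 1 - (t⁻¹) ^ 2 * ‖y‖ ^ 2) (2 * (t ^ 3)⁻¹ * ‖y‖ ^ 2) t := by
      have := (((hasDerivAt_inv h1).pow 2).mul_const (‖y‖ ^ 2)).const_sub 1
      refine this.congr_deriv ?_
      rw [show (2 - 1 : ℕ) = 1 from rfl, pow_one]; push_cast; field_simp
    have h3 := (hasDerivAt_max_pow 1 _).comp t h2
    have h4 : HasDerivAt (fun t : ℝ => (t ^ 2)⁻¹) (- 2 * (t ^ 3)⁻¹) t := by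
      have := (hasDerivAt_pow 2 t).inv (pow_ne_zero 2 h1)
      refine this.congr_deriv ?_
      norm_num; field_simp
    have e : ∀ t : ℝ, psi (t⁻¹ • y) = max (1 - (t⁻¹) ^ 2 * ‖y‖ ^ 2) 0 ^ 3 := by
      intro t; rw [psi, kp, norm_smul, mul_pow, Real.norm_eq_abs, sq_abs]
    have h5 := (h4.mul h3).mul_const (h (x + y))
    have e2 : (fun t : ℝ => (t ^ 2)⁻¹ * (psi (t⁻¹ • y) * h (x + y))) =
      fun t => ((t ^ 2)⁻¹ * max (1 - (t⁻¹) ^ 2 * ‖y‖ ^ 2) 0 ^ 3) * h (x + y) := by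
      ext t; rw [e]; ring
    rw [e2]
    refine h5.congr_deriv ?_
    rw [lap_kK, e, kp, norm_smul, mul_pow, Real.norm_eq_abs, sq_abs]
    simp only [Function.comp]
    push_cast
    field_simp
    norm_num
    ring
  · filter_upwards [lt_mem_nhds hR] with t ht
    exact mv_eq_integral h x ht.ne'

/-- The mean value property for weakly harmonic continuous functions. -/
theorem mv_eq_of_weakly_harmonic {h : R2 → ℝ} (hh : Continuous h)
    (hw : ∀ H : R2 → ℝ, ContDiff ℝ 3 H → HasCompactSupport H → ∫ y, h y * lap H y = 0)
    (x : R2) {R : ℝ} (hR : 0 < R) : mv h x R = I0 * h x := by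
  have hd : ∀ t : ℝ, 0 < t → HasDerivAt (mv h x) 0 t := by
    intro t ht
    convert hasDerivAt_mv_weak hh x ht using 1
    have h1 : ContDiff ℝ 3 fun s => kK (- (t⁻¹ • x) + t⁻¹ • s) :=
      contDiff_kK.comp (contDiff_affine _ _)
    have h2 : HasCompactSupport fun s => kK (- (t⁻¹ • x) + t⁻¹ • s) := by
      refine HasCompactSupport.intro (isCompact_closedBall x t) fun y hy => kK_eq_zero ?_
      rw [mem_closedBall, not_le, dist_eq_norm] at hy
      rw [mem_closedBall_zero_iff, not_le, ← smul_neg, ← smul_add, norm_smul,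
        Real.norm_of_nonneg (by positivity), inv_mul_eq_div, lt_div_iff₀ ht, neg_add_eq_sub]
      linarith
    have h3 := hw _ h1 h2
    simp only [lap_affine (contDiff_kK.of_le (by norm_num))] at h3
    rw [← integral_add_left_eq_self _ x] at h3
    rw [integral_const_mul]
    have : ∫ y, lap kK (t⁻¹ • y) * h (x + y) =
        t ^ 2 * ∫ y, h (x + y) * (t⁻¹ ^ 2 * lap kK (-(t⁻¹ • x) + t⁻¹ • (x + y))) := by
      rw [← integral_const_mul]
      congr 1; ext y
      rw [smul_add, neg_add_cancel_left]
      field_simp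
    rw [this, h3]; simp
  have hconst : ∀ t ∈ Ioi (0 : ℝ), mv h x t = mv h x R := fun t ht =>
    isOpen_Ioi.is_const_of_deriv_eq_zero isPreconnected_Ioi
      (fun s hs => (hd s hs).differentiableAt.differentiableWithinAt)
      (fun s hs => (hd s hs).deriv) ht hR
  have hlim : Tendsto (mv h x) (𝓝[>] 0) (𝓝 (mv h x R)) :=
    tendsto_const_nhds.congr' (by
      filter_upwards [self_mem_nhdsWithin] with t ht using (hconst t ht).symm)
  have hlim2 : Tendsto (mv h x) (𝓝[>] 0) (𝓝 (I0 * h x)) := by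
    rw [← mv_zero]
    exact ((continuous_mv hh x).tendsto 0).mono_left nhdsWithin_le_nhds
  exact tendsto_nhds_unique hlim hlim2

theorem integral_add_mul {f g k : R2 → ℝ} (hf : Continuous f) (hg : Continuous g)
    (hk : Continuous k) (hc : HasCompactSupport k) :
    ∫ y, (f y + g y) * k y = (∫ y, f y * k y) + ∫ y, g y * k y := by
  simp only [add_mul]
  exact integral_add (integrable_mul_of_compact hf hk hc) (integrable_mul_of_compact hg hk hc)

theorem integral_sub_mul {f g k : R2 → ℝ} (hf : Continuous f) (hg : Continuous g)
    (hk : Continuous k) (hc : HasCompactSupport k) :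
    ∫ y, (f y - g y) * k y = (∫ y, f y * k y) - ∫ y, g y * k y := by
  simp only [sub_mul]
  exact integral_sub (integrable_mul_of_compact hf hk hc) (integrable_mul_of_compact hg hk hc)

theorem integral_const_mul_mul (c : ℝ) (f k : R2 → ℝ) :
    ∫ y, (c * f y) * k y = c * ∫ y, f y * k y := by
  simp only [mul_assoc, integral_const_mul]

theorem integral_mul_lap {h H : R2 → ℝ} (hh : Continuous h) (hH : ContDiff ℝ 2 H)
    (hc : HasCompactSupport H) :
    ∫ y, h y * lap H y = (∫ y, h y * pd 0 (pd 0 H) y) + ∫ y, h y * pd 1 (pd 1 H) y := by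
  have h1 : ∀ i j, Continuous (pd i (pd j H)) := fun i j =>
    ((hH.pd (m := 1) (by norm_num) j).pd (m := 0) (by norm_num) i).continuous
  simp only [lap_eq, mul_add]
  exact integral_add (integrable_mul_of_compact hh (h1 _ _) ((hc.pd _).pd _))
    (integrable_mul_of_compact hh (h1 _ _) ((hc.pd _).pd _))

theorem integral_hessian_swap {V H : R2 → ℝ} (hV : ContDiff ℝ 2 V) (hH : ContDiff ℝ 3 H)
    (hc : HasCompactSupport H) (i j k l : Fin 2) :
    ∫ y, pd i (pd j V) y * pd k (pd l H) y = ∫ y, pd k (pd j V) y * pd i (pd l H) y := by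
  have hV1 : ContDiff ℝ 1 (pd j V) := hV.pd (by norm_num) j
  have hH2 : ContDiff ℝ 2 (pd l H) := hH.pd (by norm_num) l
  rw [integral_pd_mul hV1 (hH2.pd (by norm_num) k) ((hc.pd l).pd k),
    integral_pd_mul hV1 (hH2.pd (by norm_num) i) ((hc.pd l).pd i)]
  congr 2; ext y
  rw [pd_symm isOpen_univ hH2.contDiffOn (mem_univ y)]

section Liouville

variable {V : R2 → ℝ}

theorem stress_identities (hV : ContDiff ℝ 2 V) (he : ∀ x, lap V x = - exp (V x)) (y : R2) :
    1 / 2 * pd 0 (fun y => pd 0 V y * pd 0 V y - pd 1 V y * pd 1 V y) y +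
      pd 1 (fun y => pd 0 V y * pd 1 V y) y = - pd 0 (fun y => exp (V y)) y ∧
    pd 0 (fun y => pd 0 V y * pd 1 V y) y -
      1 / 2 * pd 1 (fun y => pd 0 V y * pd 0 V y - pd 1 V y * pd 1 V y) y =
      - pd 1 (fun y => exp (V y)) y := by
  have hd : ∀ i y, DifferentiableAt ℝ (pd i V) y := fun i y =>
    (hV.pd (m := 1) (by norm_num) i).differentiable (by norm_num) y
  have hE : ∀ i, pd i (fun y => exp (V y)) y = exp (V y) * pd i V y := fun i =>
    pd_comp (Real.hasDerivAt_exp _) (hV.differentiable (by norm_num) y) i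
  have h01 : pd 1 (pd 0 V) y = pd 0 (pd 1 V) y :=
    pd_symm isOpen_univ hV.contDiffOn (mem_univ y) 1 0
  have hl := he y
  rw [lap_eq] at hl
  have hE2 : exp (V y) = - (pd 0 (pd 0 V) y + pd 1 (pd 1 V) y) := by linarith
  have hA : ∀ i, pd i (fun y => pd 0 V y * pd 0 V y - pd 1 V y * pd 1 V y) y =
      2 * (pd 0 V y * pd i (pd 0 V) y) - 2 * (pd 1 V y * pd i (pd 1 V) y) := fun i => by
    rw [pd_sub ((hd 0 y).fun_mul (hd 0 y)) ((hd 1 y).fun_mul (hd 1 y)), pd_mul (hd 0 y) (hd 0 y),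
      pd_mul (hd 1 y) (hd 1 y)]
    ring
  rw [hA, hA, pd_mul (hd 0 y) (hd 1 y), pd_mul (hd 0 y) (hd 1 y), hE, hE, hE2, h01]
  constructor <;> ring

theorem weak_identities (hV : ContDiff ℝ 2 V) (he : ∀ x, lap V x = - exp (V x))
    {H : R2 → ℝ} (hH : ContDiff ℝ 3 H) (hc : HasCompactSupport H) :
    ∫ y, (pd 0 (pd 0 V) y - pd 1 (pd 1 V) y -
      1 / 2 * (pd 0 V y * pd 0 V y - pd 1 V y * pd 1 V y)) * lap H y = 0 ∧
    ∫ y, (pd 0 (pd 1 V) y - 1 / 2 * (pd 0 V y * pd 1 V y)) * lap H y = 0 := by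
  have hV1 : ∀ i, ContDiff ℝ 1 (pd i V) := fun i => hV.pd (by norm_num) i
  have hV2 : ∀ i j, Continuous (pd i (pd j V)) := fun i j =>
    ((hV1 j).pd (m := 0) (by norm_num) i).continuous
  have hH1 : ∀ i, ContDiff ℝ 2 (pd i H) := fun i => hH.pd (by norm_num) i
  have hH2 : ∀ i j, Continuous (pd i (pd j H)) := fun i j =>
    ((hH1 j).pd (m := 1) (by norm_num) i).continuous
  have hHs : ∀ y, pd 1 (pd 0 H) y = pd 0 (pd 1 H) y := fun y =>
    pd_symm isOpen_univ (hH.of_le (by norm_num)).contDiffOn (mem_univ y) 1 0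
  have hVs : ∀ y, pd 1 (pd 0 V) y = pd 0 (pd 1 V) y := fun y =>
    pd_symm isOpen_univ hV.contDiffOn (mem_univ y) 1 0
  set A : R2 → ℝ := fun y => pd 0 V y * pd 0 V y - pd 1 V y * pd 1 V y with hA
  set B : R2 → ℝ := fun y => pd 0 V y * pd 1 V y with hB
  set E : R2 → ℝ := fun y => exp (V y) with hE
  have hA1 : ContDiff ℝ 1 A := ((hV1 0).mul (hV1 0)).sub ((hV1 1).mul (hV1 1))
  have hB1 : ContDiff ℝ 1 B := (hV1 0).mul (hV1 1)
  have hE1 : ContDiff ℝ 1 E := Real.contDiff_exp.comp (hV.of_le (by norm_num))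
  have hp : ∀ {f : R2 → ℝ}, ContDiff ℝ 1 f → ∀ i, Continuous (pd i f) := fun hf i =>
    (hf.pd (m := 0) (by norm_num) i).continuous
  have hst := stress_identities hV he
  rw [← hA, ← hB, ← hE] at hst
  have ibp : ∀ {f : R2 → ℝ}, ContDiff ℝ 1 f → ∀ i j,
      ∫ y, f y * pd i (pd j H) y = - ∫ y, pd i f y * pd j H y := fun hf i j => by
    rw [integral_pd_mul hf ((hH1 j).of_le (by norm_num)) (hc.pd j), neg_neg]
  have rel0 : ∀ j, 1 / 2 * (∫ y, pd 0 A y * pd j H y) + ∫ y, pd 1 B y * pd j H y =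
      - ∫ y, pd 0 E y * pd j H y := fun j => by
    rw [← integral_const_mul_mul, ← integral_add_mul ((hp hA1 0).const_mul _) (hp hB1 1)
      (hH1 j).continuous (hc.pd j), ← integral_neg]
    congr 1; ext y
    rw [(hst y).1, neg_mul]
  have rel1 : ∀ j, (∫ y, pd 0 B y * pd j H y) - 1 / 2 * (∫ y, pd 1 A y * pd j H y) =
      - ∫ y, pd 1 E y * pd j H y := fun j => by
    rw [← integral_const_mul_mul, ← integral_sub_mul (hp hB1 0) ((hp hA1 1).const_mul _)
      (hH1 j).continuous (hc.pd j), ← integral_neg]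
    congr 1; ext y
    rw [(hst y).2, neg_mul]
  have eqn : ∀ i j, (∫ y, pd 0 (pd 0 V) y * pd i (pd j H) y) +
      ∫ y, pd 1 (pd 1 V) y * pd i (pd j H) y = - ∫ y, E y * pd i (pd j H) y := fun i j => by
    rw [← integral_add_mul (hV2 0 0) (hV2 1 1) (hH2 i j) ((hc.pd j).pd i), ← integral_neg]
    congr 1; ext y
    rw [← lap_eq, he, neg_mul]
  have cross : ∀ {f : R2 → ℝ}, ContDiff ℝ 1 f →
      ∫ y, pd 1 f y * pd 0 H y = ∫ y, pd 0 f y * pd 1 H y := fun hf => by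
    have h1 := ibp hf 1 0
    have h2 := ibp hf 0 1
    simp only [hHs] at h1
    linarith
  have sw := integral_hessian_swap hV hH hc
  have expand : ∀ (f g : R2 → ℝ), Continuous f → Continuous g → ∀ i,
      ∫ y, (f y - 1 / 2 * g y) * pd i (pd i H) y =
      (∫ y, f y * pd i (pd i H) y) - 1 / 2 * ∫ y, g y * pd i (pd i H) y := fun f g hf hg i => by
    rw [integral_sub_mul hf (hg.const_mul _) (hH2 i i) ((hc.pd i).pd i),
      integral_const_mul_mul]
  have hlap : ∀ (f g : R2 → ℝ), Continuous f → Continuous g →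
      ∫ y, (f y - 1 / 2 * g y) * lap H y =
      (∫ y, f y * pd 0 (pd 0 H) y) - 1 / 2 * (∫ y, g y * pd 0 (pd 0 H) y) +
      ((∫ y, f y * pd 1 (pd 1 H) y) - 1 / 2 * ∫ y, g y * pd 1 (pd 1 H) y) := fun f g hf hg => by
    rw [integral_mul_lap (h := fun y => f y - 1 / 2 * g y) (hf.sub (hg.const_mul _)) (hH.of_le (by norm_num)) hc,
      expand f g hf hg, expand f g hf hg]
  constructor
  · rw [hlap (fun y => pd 0 (pd 0 V) y - pd 1 (pd 1 V) y) A ((hV2 0 0).sub (hV2 1 1))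
      hA1.continuous, ibp hA1, ibp hA1,
      integral_sub_mul (hV2 0 0) (hV2 1 1) (hH2 0 0) ((hc.pd 0).pd 0),
      integral_sub_mul (hV2 0 0) (hV2 1 1) (hH2 1 1) ((hc.pd 1).pd 1)]
    have s1 := sw 0 0 1 1
    have s2 := sw 1 1 0 0
    simp only [hHs, hVs] at s1 s2
    have e0 := eqn 0 0
    have e1 := eqn 1 1
    rw [ibp hE1] at e0 e1
    have r0 := rel0 0
    have r1 := rel1 1
    have c1 := cross hB1
    linarith
  · rw [hlap (fun y => pd 0 (pd 1 V) y) B (hV2 0 1) hB1.continuous, ibp hB1, ibp hB1]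
    have s1 := sw 1 0 0 0
    have s2 := sw 0 1 1 1
    simp only [hHs, hVs] at s1 s2
    have e0 := eqn 0 1
    rw [ibp hE1] at e0
    have r0 := rel0 1
    have r1 := rel1 0
    have c1 := cross hA1
    have c2 := cross hE1
    linarith

end Liouville

theorem continuous_kp (n : ℕ) : Continuous (kp n) := by
  unfold kp; fun_prop

/-- A Caccioppoli inequality for nonpositive superharmonic functions. -/
theorem caccioppoli {W : R2 → ℝ} (hW : ContDiff ℝ 2 W) (h0 : ∀ y, W y ≤ 0)
    (hl : ∀ y, lap W y ≤ 0) {S : ℝ} (hS : ∀ y ∈ closedBall (0 : R2) 1, |W y| ≤ S) :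
    ∫ y, psi y * (pd 0 W y ^ 2 + pd 1 W y ^ 2) ≤ 36 * (∫ y, kp 1 y) * S ^ 2 := by
  have hW1 : ∀ i, ContDiff ℝ 1 (pd i W) := fun i => hW.pd (by norm_num) i
  have hp1 : ContDiff ℝ 1 psi := contDiff_psi.of_le (by norm_num)
  have hd : ∀ i y, DifferentiableAt ℝ (pd i W) y := fun i y =>
    (hW1 i).differentiable (by norm_num) y
  have hcp : ∀ i, Continuous (pd i psi) := fun i => (hp1.pd (m := 0) (by norm_num) i).continuous
  have hc1 : ∀ i, Continuous (pd i W) := fun i => (hW1 i).continuous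
  have hc2 : ∀ i, Continuous (pd i (pd i W)) := fun i =>
    ((hW1 i).pd (m := 0) (by norm_num) i).continuous
  have hcW := hW.continuous
  have hcpsi := continuous_psi
  have hQ : ∀ i y, pd i (fun y => psi y * pd i W y) y =
      psi y * pd i (pd i W) y + pd i psi y * pd i W y := fun i y =>
    pd_mul (hp1.differentiable (by norm_num) y) (hd i y) i
  have hI : ∀ i, Integrable fun y => psi y * pd i W y ^ 2 := fun i =>
    integrable_psi_mul ((hc1 i).pow 2)
  have hJ : ∀ i, Integrable fun y => W y * (psi y * pd i (pd i W) y + pd i psi y * pd i W y) := by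
    intro i
    refine Continuous.integrable_of_hasCompactSupport (by have := hcp i; have := hc1 i; have := hc2 i; fun_prop)
      (HasCompactSupport.intro (isCompact_closedBall (0 : R2) 1) fun y hy => ?_)
    rw [psi_eq_zero hy, pd_psi_eq_zero hy]; simp
  have ibp : ∀ i, ∫ y, psi y * pd i W y ^ 2 =
      - ∫ y, W y * (psi y * pd i (pd i W) y + pd i psi y * pd i W y) := by
    intro i
    have := integral_pd_mul (hW.of_le (by norm_num)) (hp1.mul (hW1 i))
      (hasCompactSupport_psi.mul_right) i
    simp only [hQ] at this
    rw [← this]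
    congr 1; ext y; ring
  have e1 : ∫ y, psi y * (pd 0 W y ^ 2 + pd 1 W y ^ 2) =
      (∫ y, psi y * pd 0 W y ^ 2) + ∫ y, psi y * pd 1 W y ^ 2 := by
    rw [← integral_add (hI 0) (hI 1)]; congr 1; ext y; ring
  have hk : Integrable (kp 1) :=
    (continuous_kp 1).integrable_of_hasCompactSupport (hasCompactSupport_kp (by norm_num))
  have key : (∫ y, psi y * pd 0 W y ^ 2) + ∫ y, psi y * pd 1 W y ^ 2 ≤
      1 / 2 * ((∫ y, psi y * pd 0 W y ^ 2) + ∫ y, psi y * pd 1 W y ^ 2) +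
        18 * S ^ 2 * ∫ y, kp 1 y := by
    have hI01 : Integrable fun y => psi y * pd 0 W y ^ 2 + psi y * pd 1 W y ^ 2 := (hI 0).add (hI 1)
    conv_lhs => rw [ibp, ibp, ← neg_add, ← integral_add (hJ 0) (hJ 1), ← integral_neg]
    rw [← integral_add (hI 0) (hI 1), ← integral_const_mul, ← integral_const_mul,
      ← integral_add (hI01.const_mul _) (hk.const_mul _)]
    refine integral_mono ((hJ 0).add (hJ 1)).neg
      ((hI01.const_mul _).add (hk.const_mul _)) fun y => ?_
    simp only
    by_cases hy : y ∈ closedBall (0 : R2) 1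
    · have hl' := hl y
      rw [lap_eq] at hl'
      have h3 := abs_le.1 (hS y hy)
      have hn := norm_sq_eq y
      rw [mem_closedBall_zero_iff] at hy
      have hn1 : y 0 ^ 2 + y 1 ^ 2 ≤ 1 := by rw [← hn]; nlinarith [norm_nonneg y]
      have hm := kp_nonneg 1 y
      have em : ∀ n, kp n y = kp 1 y ^ n := fun n => by simp [kp]
      rw [pd_psi, pd_psi, psi, em 3, em 2]
      set m := kp 1 y
      set a := pd 0 W y
      set b := pd 1 W y
      set L := pd 0 (pd 0 W) y
      set L' := pd 1 (pd 1 W) y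
      have t1 : 0 ≤ m ^ 3 * (W y * (L + L')) :=
        mul_nonneg (pow_nonneg hm 3) (mul_nonneg_of_nonpos_of_nonpos (h0 y) hl')
      have t2 : 0 ≤ m * (m * (y 0 * a + y 1 * b) - 6 * W y) ^ 2 := by positivity
      have t3 : (y 0 * a + y 1 * b) ^ 2 ≤ a ^ 2 + b ^ 2 := by
        nlinarith [sq_nonneg (y 0 * b - y 1 * a), mul_nonneg (sub_nonneg.2 hn1) (add_nonneg (sq_nonneg a) (sq_nonneg b))]
      have t4 : W y ^ 2 ≤ S ^ 2 := by nlinarith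
      have t5 := mul_le_mul_of_nonneg_left t3 (pow_nonneg hm 3)
      have t6 := mul_le_mul_of_nonneg_left t4 hm
      nlinarith
    · have : kp 1 y = 0 := kp_eq_zero (by norm_num) (le_of_lt (by simpa using hy))
      rw [psi_eq_zero hy, pd_psi_eq_zero hy, pd_psi_eq_zero hy, this]; simp
  rw [e1]
  linarith

theorem exists_abs_integral_hessian_le : ∃ K : ℝ, 0 < K ∧ ∀ (W : R2 → ℝ) (S : ℝ), ContDiff ℝ 2 W →
    (∀ y ∈ closedBall (0 : R2) 1, |W y| ≤ S) → ∀ i j,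
    |∫ y, psi y * pd i (pd j W) y| ≤ K * S := by
  have hp : ∀ i j, Continuous (pd i (pd j psi)) := fun i j =>
    ((contDiff_psi.pd (m := 1) (by norm_num) j).pd (m := 0) (by norm_num) i).continuous
  have hin : ∀ i j, Integrable fun y => |pd i (pd j psi) y| := fun i j =>
    ((hp i j).integrable_of_hasCompactSupport ((hasCompactSupport_psi.pd _).pd _)).abs
  have hnn : ∀ i j, 0 ≤ ∫ y, |pd i (pd j psi) y| := fun i j =>
    integral_nonneg fun y => abs_nonneg _
  refine ⟨1 + ∑ i, ∑ j, ∫ y, |pd j (pd i psi) y|, ?_, fun W S hW hS i j => ?_⟩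
  · have := Finset.sum_nonneg fun i (_ : i ∈ Finset.univ) =>
      Finset.sum_nonneg fun j (_ : j ∈ Finset.univ) => hnn j i
    linarith
  have hS0 : 0 ≤ S := (abs_nonneg _).trans (hS 0 (by simp))
  have h1 := integral_pd_mul (hW.pd (m := 1) (by norm_num) j)
    (contDiff_psi.of_le (by norm_num)) hasCompactSupport_psi i
  have h2 := integral_pd_mul (hW.of_le (by norm_num))
    (contDiff_psi.pd (m := 1) (by norm_num) i) (hasCompactSupport_psi.pd i) j
  have h3 : ∫ y, psi y * pd i (pd j W) y = ∫ y, W y * pd j (pd i psi) y := by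
    simp only [mul_comm (psi _)]
    rw [h1, h2, neg_neg]
  have h4 : |∫ y, W y * pd j (pd i psi) y| ≤ S * ∫ y, |pd j (pd i psi) y| := by
    rw [← integral_const_mul]
    refine (abs_integral_le_integral_abs).trans (integral_mono ?_ ((hin j i).const_mul S) fun y => ?_)
    · exact (integrable_mul_of_compact hW.continuous (hp j i)
        ((hasCompactSupport_psi.pd _).pd _)).abs
    · simp only [abs_mul]
      by_cases hy : y ∈ closedBall (0 : R2) 1
      · exact mul_le_mul_of_nonneg_right (hS y hy) (abs_nonneg _)
      · have : pd j (pd i psi) y = 0 := by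
          by_contra h
          have h5 := subset_tsupport _ (Function.mem_support.2 h)
          exact hy (tsupport_kp (by norm_num) (tsupport_pd_subset _ _ (tsupport_pd_subset _ _ h5)))
        simp [this]
  rw [h3]
  refine h4.trans ?_
  rw [mul_comm S]
  refine mul_le_mul_of_nonneg_right ?_ hS0
  have := Finset.single_le_sum (f := fun j => ∫ y, |pd j (pd i psi) y|)
    (fun j _ => hnn j i) (Finset.mem_univ j)
  have h6 := Finset.single_le_sum (f := fun i => ∑ j, ∫ y, |pd j (pd i psi) y|)
    (fun i _ => Finset.sum_nonneg fun j _ => hnn j i) (Finset.mem_univ i)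
  linarith

section Liouville

variable {V : R2 → ℝ}

theorem exists_log_growth (hV : ContDiff ℝ 2 V) (he : ∀ x, lap V x = - exp (V x))
    (h0 : ∀ x, V x ≤ 0) {C : ℝ} (hC : ∀ R : ℝ, ∫ y in ball (0 : R2) R, exp (V y) ≤ C) :
    ∃ C₁ C₂ : ℝ, ∀ R : ℝ, 1 ≤ R → ∀ y : R2, ‖y‖ ≤ R → |V y| ≤ C₁ + C₂ * log R := by
  have hw : ContDiff ℝ 2 fun y => - V y := hV.neg
  have hlw : ∀ y, lap (fun y => - V y) y = exp (V y) := fun y => by rw [lap_neg, he, neg_neg]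
  have hcE : Continuous fun y => exp (V y) := Real.continuous_exp.comp hV.continuous
  have hd := fun t => hasDerivAt_mv_lap hw 0 t
  have hder : ∀ t : ℝ, 0 < t → t * ∫ y, kK y * lap (fun y => - V y) (0 + t • y) ≤ C / t := by
    intro t ht
    have h1 : ∫ y, kK y * lap (fun y => - V y) (0 + t • y) ≤
        ∫ y, (ball (0 : R2) t).indicator (fun y => exp (V y)) (0 + t • y) := by
      have hi : Integrable ((ball (0 : R2) t).indicator (fun y => exp (V y))) :=
        (integrable_indicator_iff measurableSet_ball).2
          ((hcE.locallyIntegrable.integrableOn_isCompact (isCompact_closedBall 0 t)).mono_set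
            ball_subset_closedBall)
      refine integral_mono (integrable_kK_mul ((continuous_lap hw).affine 0 t)) ?_ fun y => ?_
      · simpa using hi.comp_smul ht.ne'
      · simp only [hlw, zero_add]
        by_cases hy : y ∈ ball (0 : R2) 1
        · rw [indicator_of_mem]
          · nlinarith [kK_le_one y, exp_pos (V (t • y))]
          · rw [mem_ball_zero_iff] at hy ⊢
            rw [norm_smul, Real.norm_of_nonneg ht.le]; nlinarith
        · rw [kK, kp_eq_zero (by norm_num) (by simpa using hy)]
          simp only [mul_zero, zero_mul]
          exact indicator_nonneg (fun _ _ => (exp_pos _).le) _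
    rw [integral_comp_affine, integral_indicator measurableSet_ball] at h1
    calc _ ≤ t * ((t ^ 2)⁻¹ * C) := by
          refine mul_le_mul_of_nonneg_left (h1.trans ?_) ht.le
          exact mul_le_mul_of_nonneg_left (hC t) (by positivity)
      _ = C / t := by field_simp
  have hmv : ∀ R : ℝ, 1 ≤ R → mv (fun y => - V y) 0 R ≤ mv (fun y => - V y) 0 1 + C * log R := by
    intro R hR
    have hd2 : ∀ t : ℝ, 0 < t → HasDerivAt (fun t => mv (fun y => - V y) 0 t - C * log t)
        ((t * ∫ y, kK y * lap (fun y => - V y) (0 + t • y)) - C * t⁻¹) t := fun t ht =>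
      (hd t).sub ((Real.hasDerivAt_log ht.ne').const_mul C)
    have := antitoneOn_of_deriv_nonpos (convex_Icc 1 R)
      (f := fun t => mv (fun y => - V y) 0 t - C * log t)
      (fun t ht => (hd2 t (by linarith [ht.1])).continuousAt.continuousWithinAt)
      (fun t ht => by
        rw [interior_Icc] at ht
        exact (hd2 t (by linarith [ht.1])).differentiableAt.differentiableWithinAt)
      (fun t ht => by
        rw [interior_Icc] at ht
        have ht0 : 0 < t := by linarith [ht.1]
        rw [(hd2 t ht0).deriv]
        have := hder t ht0
        rw [div_eq_mul_inv] at this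
        linarith) (left_mem_Icc.2 hR) (right_mem_Icc.2 hR) hR
    simp only [log_one, mul_zero] at this
    linarith
  have hI := I0_pos
  refine ⟨1024 / 27 / I0 * (mv (fun y => - V y) 0 1 + C * log 4), 1024 / 27 / I0 * C,
    fun R hR y hy => ?_⟩
  have hR0 : 0 < R := by linarith
  have h1 := le_mv hw (x := y) hR0.le le_rfl (fun z _ => by rw [hlw]; simpa using (exp_pos _).le)
  have h2 := mv_le_mv hw.continuous hR0 (fun z _ => by linarith [h0 z]) hy
  have h3 := hmv (4 * R) (by linarith)
  rw [log_mul (by norm_num) hR0.ne'] at h3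
  simp only [mul_zero, zero_mul, add_zero] at h1
  have h4 : - V y ≤ 1024 / 27 * (mv (fun y => - V y) 0 1 + C * (log 4 + log R)) / I0 := by
    rw [le_div_iff₀ hI]; linarith
  rw [abs_of_nonpos (h0 y)]
  refine h4.trans_eq ?_
  ring

end Liouville

theorem abs_integral_psi_mul_le {W f : R2 → ℝ} (hW : ContDiff ℝ 2 W) (h0 : ∀ y, W y ≤ 0)
    (hl : ∀ y, lap W y ≤ 0) {S : ℝ} (hS : ∀ y ∈ closedBall (0 : R2) 1, |W y| ≤ S)
    (hf : Continuous f) (hfW : ∀ y, |f y| ≤ pd 0 W y ^ 2 + pd 1 W y ^ 2) :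
    |∫ y, psi y * f y| ≤ 36 * (∫ y, kp 1 y) * S ^ 2 := by
  have hc1 : ∀ i, Continuous (pd i W) := fun i => (hW.pd (m := 1) (by norm_num) i).continuous
  refine (abs_integral_le_integral_abs.trans ?_).trans (caccioppoli hW h0 hl hS)
  refine integral_mono (integrable_psi_mul hf).abs
    (integrable_psi_mul (((hc1 0).pow 2).add ((hc1 1).pow 2))) fun y => ?_
  simp only [abs_mul, abs_of_nonneg (psi_nonneg y)]
  exact mul_le_mul_of_nonneg_left (hfW y) (psi_nonneg y)

section Liouville

variable {V : R2 → ℝ}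

theorem traceless_eq_zero (hV : ContDiff ℝ 2 V) (he : ∀ x, lap V x = - exp (V x))
    (h0 : ∀ x, V x ≤ 0) {C : ℝ} (hC : ∀ R : ℝ, ∫ y in ball (0 : R2) R, exp (V y) ≤ C) (x : R2) :
    pd 0 (pd 0 V) x - pd 1 (pd 1 V) x -
      1 / 2 * (pd 0 V x * pd 0 V x - pd 1 V x * pd 1 V x) = 0 ∧
    pd 0 (pd 1 V) x - 1 / 2 * (pd 0 V x * pd 1 V x) = 0 := by
  obtain ⟨C₁, C₂, hlog⟩ := exists_log_growth hV he h0 hC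
  obtain ⟨K, hK, hess⟩ := exists_abs_integral_hessian_le
  have hV1 : ∀ i, ContDiff ℝ 1 (pd i V) := fun i => hV.pd (by norm_num) i
  have hc1 : ∀ i, Continuous (pd i V) := fun i => (hV1 i).continuous
  have hc2 : ∀ i j, Continuous (pd i (pd j V)) := fun i j =>
    ((hV1 j).pd (m := 0) (by norm_num) i).continuous
  set J : ℝ := 36 * ∫ y, kp 1 y with hJ
  have hJ0 : 0 ≤ J := mul_nonneg (by norm_num) (integral_nonneg (kp_nonneg 1))
  set S : ℝ → ℝ := fun R => C₁ + C₂ * log (2 * R) with hS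
  have hlim : Tendsto (fun R => 2 * K * (S R / R * R⁻¹) + J * (S R / R) ^ 2) atTop (𝓝 0) := by
    have h1 : Tendsto (fun R : ℝ => log (2 * R) / (2 * R)) atTop (𝓝 0) :=
      (Real.isLittleO_log_id_atTop.tendsto_div_nhds_zero).comp
        (tendsto_id.const_mul_atTop (by norm_num : (0 : ℝ) < 2))
    have h2 : Tendsto (fun R : ℝ => S R / R) atTop (𝓝 0) := by
      have := (tendsto_inv_atTop_zero.const_mul C₁).add (h1.const_mul (2 * C₂))
      simp only [mul_zero, add_zero] at this
      refine this.congr fun R => ?_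
      simp only [hS]
      rcases eq_or_ne R 0 with rfl | hR
      · simp
      · field_simp
    have := ((h2.mul tendsto_inv_atTop_zero).const_mul (2 * K)).add ((h2.pow 2).const_mul J)
    simpa using this
  have main : ∀ (a : R2 → ℝ), Continuous a →
      (∀ H : R2 → ℝ, ContDiff ℝ 3 H → HasCompactSupport H → ∫ y, a y * lap H y = 0) →
      (∀ R : ℝ, 1 ≤ R → ‖x‖ ≤ R → R ^ 2 * |mv a x R| ≤ 2 * K * S R + J * S R ^ 2) → a x = 0 := by
    intro a ha hweak hbound
    have h1 : |I0 * a x| ≤ 0 := by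
      refine ge_of_tendsto hlim ?_
      filter_upwards [eventually_ge_atTop 1, eventually_ge_atTop ‖x‖] with R hR hxR
      have h2 := hbound R hR hxR
      have hR0 : 0 < R := by linarith
      rw [mv_eq_of_weakly_harmonic ha hweak x hR0] at h2
      have : 2 * K * (S R / R * R⁻¹) + J * (S R / R) ^ 2 =
          (2 * K * S R + J * S R ^ 2) / R ^ 2 := by field_simp
      rw [this, le_div_iff₀ (by positivity)]
      linarith
    have h3 := abs_nonpos_iff.1 h1
    exact (mul_eq_zero.1 h3).resolve_left I0_pos.ne'
  have weak := fun H hH hc => weak_identities hV he (H := H) hH hc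
  have setup : ∀ R : ℝ, 1 ≤ R → ‖x‖ ≤ R →
      ContDiff ℝ 2 (fun y => V (x + R • y)) ∧ (∀ y, V (x + R • y) ≤ 0) ∧
      (∀ y, lap (fun y => V (x + R • y)) y ≤ 0) ∧
      (∀ y ∈ closedBall (0 : R2) 1, |V (x + R • y)| ≤ S R) ∧
      ∀ i y, pd i (fun y => V (x + R • y)) y = R * pd i V (x + R • y) := by
    intro R hR hxR
    refine ⟨hV.comp (contDiff_affine x R), fun y => h0 _, fun y => ?_, fun y hy => ?_, fun i y => ?_⟩
    · rw [lap_affine hV, he]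
      have := mul_nonneg (sq_nonneg R) (exp_pos (V (x + R • y))).le
      linarith
    · refine hlog (2 * R) (by linarith) _ ?_
      rw [mem_closedBall_zero_iff] at hy
      refine (norm_add_le _ _).trans ?_
      rw [norm_smul, Real.norm_of_nonneg (by linarith)]
      nlinarith
    · exact pd_affine x R (hV.differentiable (by norm_num) _) i
  refine ⟨main (fun y => pd 0 (pd 0 V) y - pd 1 (pd 1 V) y -
      1 / 2 * (pd 0 V y * pd 0 V y - pd 1 V y * pd 1 V y)) ?_ (fun H hH hc => (weak H hH hc).1) ?_,
    main (fun y => pd 0 (pd 1 V) y - 1 / 2 * (pd 0 V y * pd 1 V y)) ?_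
      (fun H hH hc => (weak H hH hc).2) ?_⟩
  · exact ((hc2 0 0).sub (hc2 1 1)).sub
      ((((hc1 0).mul (hc1 0)).sub ((hc1 1).mul (hc1 1))).const_mul _)
  · intro R hR hxR
    obtain ⟨hW, hW0, hWl, hWS, hWd⟩ := setup R hR hxR
    set W : R2 → ℝ := fun y => V (x + R • y) with hWdef
    have hWc1 : ∀ i, Continuous (pd i W) := fun i => (hW.pd (m := 1) (by norm_num) i).continuous
    have hWc2 : ∀ i j, Continuous (pd i (pd j W)) := fun i j =>
      ((hW.pd (m := 1) (by norm_num) j).pd (m := 0) (by norm_num) i).continuous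
    have hq : Continuous fun y => pd 0 W y * pd 0 W y - pd 1 W y * pd 1 W y :=
      ((hWc1 0).mul (hWc1 0)).sub ((hWc1 1).mul (hWc1 1))
    have b1 := hess W (S R) hW hWS 0 0
    have b2 := hess W (S R) hW hWS 1 1
    have b3 := abs_integral_psi_mul_le hW hW0 hWl hWS hq (fun y => by
      rw [abs_le]; constructor <;> nlinarith [sq_nonneg (pd 0 W y), sq_nonneg (pd 1 W y)])
    have e : R ^ 2 * mv (fun y => pd 0 (pd 0 V) y - pd 1 (pd 1 V) y -
        1 / 2 * (pd 0 V y * pd 0 V y - pd 1 V y * pd 1 V y)) x R =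
        (∫ y, psi y * pd 0 (pd 0 W) y) - (∫ y, psi y * pd 1 (pd 1 W) y) -
        1 / 2 * ∫ y, psi y * (pd 0 W y * pd 0 W y - pd 1 W y * pd 1 W y) := by
      have hI01 : Integrable fun y => psi y * pd 0 (pd 0 W) y - psi y * pd 1 (pd 1 W) y :=
        (integrable_psi_mul (hWc2 0 0)).sub (integrable_psi_mul (hWc2 1 1))
      rw [← integral_sub (integrable_psi_mul (hWc2 0 0)) (integrable_psi_mul (hWc2 1 1)),
        ← integral_const_mul, ← integral_sub hI01 ((integrable_psi_mul hq).const_mul _), mv,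
        ← integral_const_mul]
      congr 1; ext y
      rw [hWd, hWd, pd_pd_affine hV, pd_pd_affine hV]
      ring
    rw [← abs_of_nonneg (sq_nonneg R), ← abs_mul, e]
    rw [abs_le] at *
    have := sq_nonneg (S R)
    have := mul_nonneg hJ0 this
    constructor <;> linarith [b1.1, b1.2, b2.1, b2.2, b3.1, b3.2]
  · exact (hc2 0 1).sub (((hc1 0).mul (hc1 1)).const_mul _)
  · intro R hR hxR
    obtain ⟨hW, hW0, hWl, hWS, hWd⟩ := setup R hR hxR
    set W : R2 → ℝ := fun y => V (x + R • y) with hWdef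
    have hWc1 : ∀ i, Continuous (pd i W) := fun i => (hW.pd (m := 1) (by norm_num) i).continuous
    have hWc2 : ∀ i j, Continuous (pd i (pd j W)) := fun i j =>
      ((hW.pd (m := 1) (by norm_num) j).pd (m := 0) (by norm_num) i).continuous
    have hq : Continuous fun y => pd 0 W y * pd 1 W y := (hWc1 0).mul (hWc1 1)
    have b1 := hess W (S R) hW hWS 0 1
    have b3 := abs_integral_psi_mul_le hW hW0 hWl hWS hq (fun y => by
      rw [abs_le]; constructor <;> nlinarith [sq_nonneg (pd 0 W y + pd 1 W y),
        sq_nonneg (pd 0 W y - pd 1 W y)])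
    have e : R ^ 2 * mv (fun y => pd 0 (pd 1 V) y - 1 / 2 * (pd 0 V y * pd 1 V y)) x R =
        (∫ y, psi y * pd 0 (pd 1 W) y) - 1 / 2 * ∫ y, psi y * (pd 0 W y * pd 1 W y) := by
      rw [← integral_const_mul, ← integral_sub (integrable_psi_mul (hWc2 0 1))
        ((integrable_psi_mul hq).const_mul _), mv, ← integral_const_mul]
      congr 1; ext y
      rw [hWd, hWd, pd_pd_affine hV]
      ring
    have hS0 : 0 ≤ S R := (abs_nonneg _).trans (hWS 0 (by simp))
    have hKS : 0 ≤ K * S R := mul_nonneg hK.le hS0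
    rw [← abs_of_nonneg (sq_nonneg R), ← abs_mul, e]
    rw [abs_le] at *
    have := sq_nonneg (S R)
    have := mul_nonneg hJ0 this
    constructor <;> linarith [b1.1, b1.2, b3.1, b3.2]

theorem pd_eq_const {f : R2 → ℝ} (hf : Differentiable ℝ f) (h : ∀ i x, pd i f x = 0) (x y : R2) :
    f x = f y := by
  refine is_const_of_fderiv_eq_zero hf (fun z => ?_) x y
  ext v
  rw [fderiv_eq_pd, h, h]; simp

theorem eq_add_single_of_pd_eq_zero {f : R2 → ℝ} (hf : Differentiable ℝ f) {i : Fin 2}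
    (h : ∀ x, pd i f x = 0) (x : R2) (t : ℝ) : f (x + t • EuclideanSpace.single i 1) = f x := by
  have hd : ∀ s, HasDerivAt (fun t : ℝ => f (x + t • EuclideanSpace.single i 1)) 0 s := fun s => by
    have := hasDerivAt_line (f := f) (y := x) (t := s) (i := i) (hf _)
    rwa [h] at this
  have := is_const_of_deriv_eq_zero (fun s => (hd s).differentiableAt) (fun s => (hd s).deriv) t 0
  simpa using this

theorem quadratic_of_hessian {φ : R2 → ℝ} (hφ : ContDiff ℝ 2 φ) (h01 : ∀ x, pd 0 (pd 1 φ) x = 0)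
    (hd : ∀ x, pd 0 (pd 0 φ) x = pd 1 (pd 1 φ) x) (hg : ∀ i, pd i φ 0 = 0) (x : R2) :
    φ x = φ 0 + pd 0 (pd 0 φ) 0 / 2 * ‖x‖ ^ 2 := by
  have h10 : ∀ x, pd 1 (pd 0 φ) x = 0 := fun x => by
    rw [pd_symm isOpen_univ hφ.contDiffOn (mem_univ x), h01]
  have hφ1 : ∀ i, Differentiable ℝ (pd i φ) := fun i =>
    (hφ.pd (m := 1) (by norm_num) i).differentiable (by norm_num)
  set l := pd 0 (pd 0 φ) 0 with hl
  have s1 : ∀ x (t : ℝ), pd 0 (pd 0 φ) (x + t • EuclideanSpace.single 1 1) = pd 0 (pd 0 φ) x := by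
    intro x t
    rw [← pd_comp_add]
    congr 1; ext y
    exact eq_add_single_of_pd_eq_zero (hφ1 0) h10 y t
  have s0 : ∀ x (t : ℝ), pd 0 (pd 0 φ) (x + t • EuclideanSpace.single 0 1) = pd 0 (pd 0 φ) x := by
    intro x t
    rw [hd, hd, ← pd_comp_add]
    congr 1; ext y
    exact eq_add_single_of_pd_eq_zero (hφ1 1) h01 y t
  have hconst : ∀ x, pd 0 (pd 0 φ) x = l := by
    intro x
    have e : x = (0 + x 0 • EuclideanSpace.single 0 1) + x 1 • EuclideanSpace.single 1 1 := by
      ext i; fin_cases i <;> simp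
    rw [e, s1, s0]
  have hdc : ∀ i : Fin 2, Differentiable ℝ fun y : R2 => y i := fun i =>
    (contDiff_coord (n := 1) i).differentiable (by norm_num)
  have hgrad : ∀ i x, pd i φ x = l * x i := by
    intro i x
    have hdiag : ∀ x, pd i (pd i φ) x = l := by
      intro x; fin_cases i
      · exact hconst x
      · exact (hd x).symm.trans (hconst x)
    have hoff : ∀ j, j ≠ i → ∀ x, pd j (pd i φ) x = 0 := by
      intro j hj x
      fin_cases i <;> fin_cases j
      · exact absurd rfl hj
      · exact h10 x
      · exact h01 x
      · exact absurd rfl hj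
    have := pd_eq_const (f := fun y => pd i φ y - l * y i)
      ((hφ1 i).sub ((hdc i).const_mul l)) (fun j z => by
        rw [pd_sub (hφ1 i z) ((hdc i).const_mul l z), pd_const_mul]
        rcases eq_or_ne j i with rfl | hj
        · rw [hdiag, pd_coord]; ring
        · rw [hoff j hj, pd_coord_ne _ hj]; ring) x 0
    simp only [hg] at this
    simp at this
    linarith
  have hq : Differentiable ℝ fun y : R2 => 1 - ‖y‖ ^ 2 :=
    (contDiff_const.sub (contDiff_norm_sq ℝ)).differentiable (n := 1) (by norm_num)
  have := pd_eq_const (f := fun y => φ y + l / 2 * (1 - ‖y‖ ^ 2))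
    ((hφ.differentiable (by norm_num)).add (hq.const_mul _)) (fun j z => by
      rw [pd_add (hφ.differentiable (by norm_num) z) (hq.const_mul _ z), pd_const_mul, hgrad,
        pd_norm_sq]
      ring) x 0
  simp only [norm_zero] at this
  linarith

/-- Classification of bounded-mass solutions of the Liouville equation on the plane. -/
theorem eq_stdBubble (hV : ContDiff ℝ 2 V) (he : ∀ x, lap V x = - exp (V x))
    (h0 : ∀ x, V x ≤ 0) (hV0 : V 0 = 0)
    {C : ℝ} (hC : ∀ R : ℝ, ∫ y in ball (0 : R2) R, exp (V y) ≤ C) : V = stdBubble := by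
  have htr := traceless_eq_zero hV he h0 hC
  have hVd : Differentiable ℝ V := hV.differentiable (by norm_num)
  have hV1 : ∀ i, Differentiable ℝ (pd i V) := fun i =>
    (hV.pd (m := 1) (by norm_num) i).differentiable (by norm_num)
  have hg0 : ∀ i, pd i V 0 = 0 := fun i => by
    have : IsLocalMax V 0 := Eventually.of_forall fun x => by rw [hV0]; exact h0 x
    rw [pd, this.fderiv_eq_zero]; rfl
  set φ : R2 → ℝ := fun y => exp (-1 / 2 * V y) with hφ
  have hφ2 : ContDiff ℝ 2 φ := Real.contDiff_exp.comp (contDiff_const.mul hV)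
  have hφd : Differentiable ℝ φ := hφ2.differentiable (by norm_num)
  have p1 : ∀ i, pd i φ = fun y => φ y * (-1 / 2 * pd i V y) := fun i => funext fun y => by
    have := pd_comp (f := fun y => -1 / 2 * V y) (x := y) (Real.hasDerivAt_exp _)
      ((hVd.const_mul _) y) i
    rw [pd_const_mul] at this
    exact this
  have p2 : ∀ i j y, pd i (pd j φ) y =
      φ y * (-1 / 2 * pd i (pd j V) y + 1 / 4 * (pd i V y * pd j V y)) := fun i j y => by
    rw [p1, pd_mul (hφd y) ((hV1 j).const_mul _ y), p1, pd_const_mul]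
    ring
  have hφ0 : φ 0 = 1 := by simp [hφ, hV0]
  have hquad := quadratic_of_hessian hφ2
    (fun x => by
      rw [p2]
      refine mul_eq_zero_of_right _ ?_
      linarith [(htr x).2])
    (fun x => by
      rw [p2, p2]
      congr 1
      linarith [(htr x).1])
    (fun i => by rw [p1]; simp [hg0])
  have h2 : pd 0 (pd 0 φ) 0 = 1 / 4 := by
    have h3 := (htr 0).1
    have h4 := he 0
    rw [lap_eq, hV0, exp_zero] at h4
    rw [p2, hφ0]
    simp only [hg0] at h3 ⊢
    linarith
  ext x
  have h5 := hquad x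
  rw [hφ0, h2] at h5
  rw [stdBubble, show 1 + ‖x‖ ^ 2 / 8 = φ x by rw [h5]; ring]
  simp only [hφ, log_exp]
  ring

end Liouville

/-- `z` takes values in `[-C, 0]` and solves `-Δz = F(z)` on the ball of radius `R`, where `F` is
`κ`-close to `exp` in `C¹([-C, 0])`. -/
def ApproxLiouville (R C κ : ℝ) (z : R2 → ℝ) : Prop :=
  ContDiffOn ℝ 2 z (ball 0 R) ∧ (∀ x ∈ ball (0 : R2) R, z x ∈ Icc (-C) 0) ∧
    ∃ F : ℝ → ℝ, (∀ t ∈ Icc (-C) 0, ContDiffAt ℝ 1 F t ∧ |F t - exp t| ≤ κ ∧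
      |deriv F t - exp t| ≤ κ) ∧ ∀ x ∈ ball (0 : R2) R, lap z x = -F (z x)

theorem abs_exp_sub_exp_le {s t : ℝ} (hs : s ≤ 0) (ht : t ≤ 0) : |exp s - exp t| ≤ |s - t| := by
  have key : ∀ a b : ℝ, b ≤ 0 → a ≤ b → exp b - exp a ≤ b - a := by
    intro a b hb hab
    have h1 := add_one_le_exp (a - b)
    have h2 : exp a = exp b * exp (a - b) := by rw [← exp_add]; congr 1; ring
    have h3 : exp b ≤ 1 := exp_le_one_iff.2 hb
    have h4 := mul_le_mul_of_nonneg_left h1 (exp_pos b).le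
    nlinarith [exp_pos b]
  rcases le_total s t with h | h
  · rw [abs_sub_comm, abs_sub_comm s, abs_of_nonneg (sub_nonneg.2 (exp_le_exp.2 h)),
      abs_of_nonneg (sub_nonneg.2 h)]
    exact key s t ht h
  · rw [abs_of_nonneg (sub_nonneg.2 (exp_le_exp.2 h)), abs_of_nonneg (sub_nonneg.2 h)]
    exact key t s hs h

theorem ball_add_subset {x : R2} {R d : ℝ} (hx : x ∈ ball (0 : R2) R) :
    ball x d ⊆ ball (0 : R2) (R + d) := fun y hy => by
  rw [mem_ball_zero_iff] at *
  rw [mem_ball_iff_norm] at hy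
  calc ‖y‖ = ‖(y - x) + x‖ := by simp
    _ ≤ ‖y - x‖ + ‖x‖ := norm_add_le _ _
    _ < R + d := by linarith

namespace ApproxLiouville

variable {R C κ : ℝ} {z : R2 → ℝ}

theorem abs_lap_sub_exp_le (h : ApproxLiouville R C κ z) {x : R2} (hx : x ∈ ball (0 : R2) R) :
    |lap z x + exp (z x)| ≤ κ := by
  obtain ⟨-, h2, F, hF, h3⟩ := h
  rw [h3 x hx, neg_add_eq_sub, abs_sub_comm]
  exact (hF _ (h2 x hx)).2.1

theorem abs_lap_le (h : ApproxLiouville R C κ z) (hκ : κ ≤ 1) {x : R2}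
    (hx : x ∈ ball (0 : R2) R) : |lap z x| ≤ 2 := by
  have h1 := abs_le.1 (h.abs_lap_sub_exp_le hx)
  have h2 := exp_pos (z x)
  have h3 : exp (z x) ≤ 1 := exp_le_one_iff.2 (h.2.1 x hx).2
  rw [abs_le]; constructor <;> linarith

theorem abs_le (h : ApproxLiouville R C κ z) {x : R2} (hx : x ∈ ball (0 : R2) R) :
    |z x| ≤ C := by
  have := h.2.1 x hx
  rw [abs_of_nonpos this.2]; linarith [this.1]

theorem contDiffOn_lap (h : ApproxLiouville R C κ z) :
    ContDiffOn ℝ 1 (lap z) (ball 0 R) := by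
  obtain ⟨h1, h2, F, hF, h3⟩ := h
  refine ContDiffOn.congr (f := fun x => -F (z x)) (fun x hx => ?_) h3
  exact (((hF _ (h2 x hx)).1.comp_contDiffWithinAt x ((h1 x hx).of_le (by norm_num)))).neg

/-- `Δz` has derivative `-e^z ∂ᵢz` up to an error `κ |∂ᵢz|`. -/
theorem abs_pd_lap_le (h : ApproxLiouville R C κ z) {x : R2} (hx : x ∈ ball (0 : R2) R)
    (i : Fin 2) : |pd i (lap z) x + exp (z x) * pd i z x| ≤ κ * |pd i z x| := by
  obtain ⟨h1, h2, F, hF, h3⟩ := h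
  have hz : DifferentiableAt ℝ z x :=
    (h1.contDiffAt (isOpen_ball.mem_nhds hx)).differentiableAt (by norm_num)
  have hFd : HasDerivAt F (deriv F (z x)) (z x) :=
    ((hF _ (h2 x hx)).1.differentiableAt (by norm_num)).hasDerivAt
  rw [pd_congr isOpen_ball (g := fun x => -F (z x)) h3 i hx, pd_neg, pd_comp hFd hz,
    show -(deriv F (z x) * pd i z x) + exp (z x) * pd i z x =
      -((deriv F (z x) - exp (z x)) * pd i z x) by ring, abs_neg, abs_mul]
  exact mul_le_mul_of_nonneg_right (hF _ (h2 x hx)).2.2 (abs_nonneg _)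

end ApproxLiouville

/-- Two approximate solutions which are uniformly close are close in `C²` on a smaller ball. -/
theorem exists_pd_sub_le (C : ℝ) (hC : 0 ≤ C) : ∃ K, 0 < K ∧ ∀ (R κ δ : ℝ) (z w : R2 → ℝ),
    ApproxLiouville (R + 6) C κ z → ApproxLiouville (R + 6) C κ w → κ ≤ 1 →
    (∀ x ∈ ball (0 : R2) (R + 6), |z x - w x| ≤ δ) → ∀ x ∈ ball (0 : R2) R, ∀ i,
      |pd i z x| ≤ K ∧ |pd i z x - pd i w x| ≤ K * (δ + κ) ∧
      ∀ j, |pd i (pd j z) x - pd i (pd j w) x| ≤ K * (δ + κ) := by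
  obtain ⟨G, hG, grad⟩ := exists_gradient_estimate
  obtain ⟨H, hH, hess⟩ := exists_hessian_estimate
  set L := G * (C + 2) with hL
  have hL0 : 0 ≤ L := by positivity
  set K₁ := 2 * G with hK₁
  set K₂ := H * (2 * G + (4 * L + 4 * G)) with hK₂
  refine ⟨L + K₁ + K₂, by positivity, fun R κ δ z w hz hw hκ hδ x hx => ?_⟩
  have hK₁0 : 0 ≤ K₁ := by positivity
  have hK₂0 : 0 ≤ K₂ := by positivity
  have hsub : ball (0 : R2) (R + 4) ⊆ ball 0 (R + 6) := ball_subset_ball (by linarith)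
  have hx6 : x ∈ ball (0 : R2) (R + 6) := ball_subset_ball (by linarith) hx
  have hδ0 : 0 ≤ δ := (abs_nonneg _).trans (hδ x hx6)
  have hκ0 : 0 ≤ κ := (abs_nonneg _).trans (hz.abs_lap_sub_exp_le hx6)
  have hs2 : ∀ y ∈ ball (0 : R2) (R + 4), ball y 2 ⊆ ball (0 : R2) (R + 6) := fun y hy => by
    have := ball_add_subset (d := 2) hy
    rwa [show R + 4 + 2 = R + 6 by ring] at this
  have gz : ∀ f, ApproxLiouville (R + 6) C κ f → ∀ y ∈ ball (0 : R2) (R + 4), ∀ i,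
      |pd i f y| ≤ L := fun f hf y hy i =>
    grad f y C 2 (hf.1.mono (hs2 y hy)) (fun t ht => hf.abs_le (hs2 y hy ht))
      (fun t ht => hf.abs_lap_le hκ (hs2 y hy ht)) i
  have hdz : ∀ f, ApproxLiouville (R + 6) C κ f → ∀ y ∈ ball (0 : R2) (R + 6),
      DifferentiableAt ℝ f y := fun f hf y hy =>
    (hf.1.contDiffAt (isOpen_ball.mem_nhds hy)).differentiableAt (by norm_num)
  have hlap : ∀ y ∈ ball (0 : R2) (R + 6), |lap (fun t => z t - w t) y| ≤ 2 * κ + δ := by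
    intro y hy
    rw [lap_sub isOpen_ball hz.1 hw.1 hy]
    have h1 := _root_.abs_le.1 (hz.abs_lap_sub_exp_le hy)
    have h2 := _root_.abs_le.1 (hw.abs_lap_sub_exp_le hy)
    have h3 := _root_.abs_le.1 ((abs_exp_sub_exp_le (hz.2.1 y hy).2 (hw.2.1 y hy).2).trans (hδ y hy))
    rw [_root_.abs_le]; constructor <;> linarith [h1.1, h1.2, h2.1, h2.2, h3.1, h3.2]
  have hg : ∀ y ∈ ball (0 : R2) (R + 4), ∀ i, |pd i z y - pd i w y| ≤ K₁ * (δ + κ) := by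
    intro y hy i
    rw [← pd_sub (hdz z hz y (hsub hy)) (hdz w hw y (hsub hy))]
    refine (grad _ y δ (2 * κ + δ) ((hz.1.sub hw.1).mono (hs2 y hy)) (fun t ht => hδ t (hs2 y hy ht))
      (fun t ht => hlap t (hs2 y hy ht)) i).trans (le_of_eq ?_)
    rw [hK₁]; ring
  have hx4 : x ∈ ball (0 : R2) (R + 4) := ball_subset_ball (by linarith) hx
  have hs4 : ball x 4 ⊆ ball (0 : R2) (R + 4) := ball_add_subset hx
  intro i
  refine ⟨(gz z hz x hx4 i).trans (by linarith), (hg x hx4 i).trans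
    (mul_le_mul_of_nonneg_right (by linarith) (by positivity)), fun j => ?_⟩
  have hpl : ∀ y ∈ ball x 4, |pd i (lap fun t => z t - w t) y| ≤ (4 * L + 4 * G) * (δ + κ) := by
    intro y hy
    have hy4 := hs4 hy
    have hy6 := hsub hy4
    have hd : ∀ f, ApproxLiouville (R + 6) C κ f → DifferentiableAt ℝ (lap f) y := fun f hf =>
      (hf.contDiffOn_lap.contDiffAt (isOpen_ball.mem_nhds hy6)).differentiableAt (by norm_num)
    rw [pd_congr isOpen_ball (fun t ht => lap_sub isOpen_ball hz.1 hw.1 ht) i hy6,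
      pd_sub (hd z hz) (hd w hw)]
    have h1 := (hz.abs_pd_lap_le hy6 i).trans
      (mul_le_mul_of_nonneg_left (gz z hz y hy4 i) hκ0)
    have h2 := (hw.abs_pd_lap_le hy6 i).trans
      (mul_le_mul_of_nonneg_left (gz w hw y hy4 i) hκ0)
    have h3 : |(exp (z y) - exp (w y)) * pd i z y| ≤ δ * L := by
      rw [abs_mul]
      exact mul_le_mul ((abs_exp_sub_exp_le (hz.2.1 y hy6).2 (hw.2.1 y hy6).2).trans (hδ y hy6))
        (gz z hz y hy4 i) (abs_nonneg _) hδ0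
    have h4 : |exp (w y) * (pd i z y - pd i w y)| ≤ 1 * (K₁ * (δ + κ)) := by
      rw [abs_mul, abs_of_pos (exp_pos _)]
      exact mul_le_mul (exp_le_one_iff.2 (hw.2.1 y hy6).2) (hg y hy4 i) (abs_nonneg _) zero_le_one
    have h5 := mul_nonneg hδ0 hL0
    have h6 := mul_nonneg hκ0 hL0
    have h7 := mul_nonneg hδ0 hG.le
    have h8 := mul_nonneg hκ0 hG.le
    rw [_root_.abs_le] at *
    rw [hK₁] at h4
    constructor <;> nlinarith [h1.1, h1.2, h2.1, h2.2, h3.1, h3.2, h4.1, h4.2]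
  have h6 : ball x 4 ⊆ ball (0 : R2) (R + 6) := hs4.trans hsub
  have h1 := hess (fun t => z t - w t) x (K₁ * (δ + κ)) ((4 * L + 4 * G) * (δ + κ))
    ((hz.1.sub hw.1).mono h6)
    (((hz.contDiffOn_lap.sub hw.contDiffOn_lap).congr
      (fun t ht => lap_sub isOpen_ball hz.1 hw.1 ht)).mono h6) i
    (fun y hy => by
      rw [pd_sub (hdz z hz y (h6 hy)) (hdz w hw y (h6 hy))]
      exact hg y (hs4 hy) i) hpl j
  have hd1 : ∀ f, ApproxLiouville (R + 6) C κ f → DifferentiableAt ℝ (pd j f) x := fun f hf =>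
    ((hf.1.pd isOpen_ball (m := 1) (by norm_num) j).contDiffAt
      (isOpen_ball.mem_nhds hx6)).differentiableAt (by norm_num)
  rw [pd_congr isOpen_ball (fun t ht => pd_sub (hdz z hz t ht) (hdz w hw t ht) j) i hx6,
    pd_sub (hd1 z hz) (hd1 w hw)] at h1
  refine h1.trans ?_
  rw [show H * (K₁ * (δ + κ) + (4 * L + 4 * G) * (δ + κ)) = K₂ * (δ + κ) by rw [hK₂, hK₁]; ring]
  exact mul_le_mul_of_nonneg_right (by linarith) (by positivity)

theorem fderiv_eq_smul_proj (f : R2 → ℝ) (x : R2) :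
    fderiv ℝ f x = pd 0 f x • (EuclideanSpace.proj 0 : R2 →L[ℝ] ℝ) +
      pd 1 f x • (EuclideanSpace.proj 1 : R2 →L[ℝ] ℝ) := by
  ext v
  rw [fderiv_eq_pd]
  simp [mul_comm]

theorem contDiffOn_of_pd {n m : WithTop ℕ∞} {g : R2 → ℝ} {D : Set R2} (hD : IsOpen D)
    (hg : DifferentiableOn ℝ g D) (hn : n ≠ ⊤) (hm : m = n + 1)
    (h : ∀ k, ContDiffOn ℝ n (pd k g) D) : ContDiffOn ℝ m g D := by
  rw [hm, contDiffOn_succ_iff_fderiv_of_isOpen hD]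
  refine ⟨hg, fun h => absurd h (by rintro rfl; simp at hn), ?_⟩
  rw [show fderiv ℝ g = fun x => pd 0 g x • (EuclideanSpace.proj 0 : R2 →L[ℝ] ℝ) +
      pd 1 g x • (EuclideanSpace.proj 1 : R2 →L[ℝ] ℝ) from funext (fderiv_eq_smul_proj g)]
  exact ((h 0).smul contDiffOn_const).add ((h 1).smul contDiffOn_const)

section Limits

variable {ι : Type*} {l : Filter ι} [NeBot l]

theorem exists_pd_limit {f : ι → R2 → ℝ} {g : R2 → ℝ} {R : ℝ}
    (hf : ∀ᶠ n in l, ContDiffOn ℝ 1 (f n) (ball 0 R))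
    (hc : ∀ k, UniformCauchySeqOn (fun n => pd k (f n)) l (ball 0 R))
    (hg : ∀ x ∈ ball (0 : R2) R, Tendsto (fun n => f n x) l (𝓝 (g x))) :
    ContDiffOn ℝ 1 g (ball 0 R) ∧
      ∀ k, TendstoUniformlyOn (fun n => pd k (f n)) (pd k g) l (ball 0 R) := by
  have hex : ∀ k x, ∃ y, x ∈ ball (0 : R2) R → Tendsto (fun n => pd k (f n) x) l (𝓝 y) := by
    intro k x
    by_cases hx : x ∈ ball (0 : R2) R
    · obtain ⟨y, hy⟩ := cauchy_map_iff_exists_tendsto.1 ((hc k).cauchy_map hx)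
      exact ⟨y, fun _ => hy⟩
    · exact ⟨0, fun h => absurd h hx⟩
  choose G hG using hex
  have hu : ∀ k, TendstoUniformlyOn (fun n => pd k (f n)) (G k) l (ball 0 R) := fun k =>
    (hc k).tendstoUniformlyOn_of_tendsto (hG k)
  let φ : ℝ × ℝ →L[ℝ] (R2 →L[ℝ] ℝ) :=
    (ContinuousLinearMap.fst ℝ ℝ ℝ).smulRight (EuclideanSpace.proj 0 : R2 →L[ℝ] ℝ) +
    (ContinuousLinearMap.snd ℝ ℝ ℝ).smulRight (EuclideanSpace.proj 1 : R2 →L[ℝ] ℝ)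
  have hφ : TendstoUniformlyOn (fun n => fderiv ℝ (f n)) (fun x => φ (G 0 x, G 1 x)) l
      (ball 0 R) := by
    rw [Metric.tendstoUniformlyOn_iff]
    intro ε hε
    obtain ⟨δ, hδ, h⟩ := Metric.uniformContinuous_iff.1 φ.uniformContinuous ε hε
    filter_upwards [Metric.tendstoUniformlyOn_iff.1 (hu 0) δ hδ,
      Metric.tendstoUniformlyOn_iff.1 (hu 1) δ hδ] with n h0 h1 x hx
    rw [fderiv_eq_smul_proj]
    exact h (a := (G 0 x, G 1 x)) (b := (pd 0 (f n) x, pd 1 (f n) x))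
      (max_lt (h0 x hx) (h1 x hx))
  have hder : ∀ x ∈ ball (0 : R2) R, HasFDerivAt g (φ (G 0 x, G 1 x)) x := by
    intro x hx
    have hnhds := isOpen_ball.mem_nhds hx
    refine hasFDerivAt_of_tendstoUniformlyOnFilter (l := l) (f := f)
      (f' := fun n => fderiv ℝ (f n)) (g' := fun x => φ (G 0 x, G 1 x)) ?_ ?_ ?_
    · exact hφ.tendstoUniformlyOnFilter.mono_right (le_principal_iff.2 hnhds)
    · filter_upwards [hf.prod_mk hnhds] with n hn
      exact ((hn.1.contDiffAt (isOpen_ball.mem_nhds hn.2)).differentiableAt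
        (by norm_num)).hasFDerivAt
    · filter_upwards [hnhds] with y hy using hg y hy
  have hpd : ∀ k, EqOn (G k) (pd k g) (ball 0 R) := by
    intro k x hx
    rw [pd, (hder x hx).fderiv]
    fin_cases k <;> simp [φ]
  have hu' : ∀ k, TendstoUniformlyOn (fun n => pd k (f n)) (pd k g) l (ball 0 R) := fun k =>
    (hu k).congr_right (hpd k)
  refine ⟨contDiffOn_of_pd (n := 0) isOpen_ball
    (fun x hx => (hder x hx).differentiableAt.differentiableWithinAt) (by simp) (by simp)
    fun k => ?_, hu'⟩
  rw [contDiffOn_zero]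
  refine (hu' k).continuousOn (Eventually.frequently ?_)
  filter_upwards [hf] with n hn
  exact (hn.pd isOpen_ball (m := 0) (by norm_num) k).continuousOn

end Limits

theorem tendstoUniformlyOn_of_lipschitz {ι : Type*} {l : Filter ι} [NeBot l] {z : ι → R2 → ℝ}
    {V : R2 → ℝ} {R L : ℝ}
    (hz : ∀ᶠ n in l, ∀ x ∈ ball (0 : R2) R, ∀ y ∈ ball (0 : R2) R, |z n x - z n y| ≤ L * ‖x - y‖)
    (hV : ∀ x, Tendsto (fun n => z n x) l (𝓝 (V x))) :
    TendstoUniformlyOn z V l (ball 0 R) := by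
  rw [Metric.tendstoUniformlyOn_iff]
  intro ε hε
  have hVL : ∀ x ∈ ball (0 : R2) R, ∀ y ∈ ball (0 : R2) R, |V x - V y| ≤ L * ‖x - y‖ :=
    fun x hx y hy => le_of_tendsto ((hV x).sub (hV y)).abs
      (by filter_upwards [hz] with n hn using hn x hx y hy)
  set δ := ε / (4 * (|L| + 1)) with hδ
  have hδ0 : 0 < δ := by positivity
  have hLδ : |L| * δ ≤ ε / 4 := by
    rw [hδ, mul_div_assoc', div_le_div_iff₀ (by positivity) (by norm_num)]
    nlinarith [abs_nonneg L]
  have htb : TotallyBounded (ball (0 : R2) R) :=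
    (isCompact_closedBall (0 : R2) R).totallyBounded.subset ball_subset_closedBall
  obtain ⟨t, hts, htf, ht⟩ := finite_approx_of_totallyBounded htb δ hδ0
  have h1 : ∀ᶠ n in l, ∀ a ∈ t, dist (V a) (z n a) < ε / 4 :=
    (eventually_all_finite htf).2 fun a _ => by
      have := Metric.tendsto_nhds.1 (hV a) (ε / 4) (by positivity)
      simpa only [dist_comm] using this
  filter_upwards [h1, hz] with n hn1 hn2 x hx
  obtain ⟨a, ha, hxa⟩ := mem_iUnion₂.1 (ht hx)
  rw [mem_ball, dist_eq_norm] at hxa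
  have h3 := hVL x hx a (hts ha)
  have h4 := hn2 x hx a (hts ha)
  have h5 : L * ‖x - a‖ ≤ ε / 4 := le_trans (mul_le_mul (le_abs_self L) hxa.le (norm_nonneg _)
    (abs_nonneg _)) hLδ
  have h6 := hn1 a ha
  rw [Real.dist_eq] at *
  rw [abs_lt] at *
  rw [abs_le] at *
  constructor <;> linarith [h3.1, h3.2, h4.1, h4.2, h6.1, h6.2]

theorem uniformCauchySeqOn_iff_abs_lt {ι X : Type*} {F : ι → X → ℝ} {l : Filter ι} {s : Set X} :
    UniformCauchySeqOn F l s ↔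
      ∀ ε > 0, ∀ᶠ m : ι × ι in l ×ˢ l, ∀ x ∈ s, |F m.1 x - F m.2 x| < ε := by
  refine ⟨fun h ε hε => h _ (Metric.dist_mem_uniformity hε), fun h u hu => ?_⟩
  obtain ⟨ε, hε, hu⟩ := Metric.mem_uniformity_dist.1 hu
  filter_upwards [h ε hε] with m hm x hx using hu (hm x hx)

/-- Convergence along ultrafilters of approximate solutions of the Liouville equation. -/
theorem tendsto_stdBubble_of_ultrafilter {ι : Type*} (l : Ultrafilter ι) {z : ι → R2 → ℝ} {M : ℝ}
    (hA : ∀ R, ∃ C, 0 ≤ C ∧ ∀ κ > 0, ∀ᶠ n in (l : Filter ι), ApproxLiouville R C κ (z n))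
    (h0 : ∀ᶠ n in (l : Filter ι), z n 0 = 0)
    (hM : ∀ R : ℝ, ∀ᶠ n in (l : Filter ι), ∫ y in ball (0 : R2) R, exp (z n y) ≤ M) :
    ContDiff ℝ 2 stdBubble ∧ ∀ R, TendstoUniformlyOn z stdBubble l (ball 0 R) ∧
      ∀ j, TendstoUniformlyOn (fun n => pd j (z n)) (pd j stdBubble) l (ball 0 R) ∧
      ∀ k, TendstoUniformlyOn (fun n => pd k (pd j (z n))) (pd k (pd j stdBubble)) l
        (ball 0 R) := by
  have hex : ∀ x, ∃ v, Tendsto (fun n => z n x) l (𝓝 v) := by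
    intro x
    obtain ⟨C, -, hC⟩ := hA (‖x‖ + 1)
    have h1 : ((l.map fun n => z n x : Ultrafilter ℝ) : Filter ℝ) ≤ 𝓟 (Icc (-C) 0) := by
      rw [le_principal_iff]
      change ∀ᶠ n in (l : Filter ι), z n x ∈ Icc (-C) 0
      filter_upwards [hC 1 one_pos] with n hn
      exact hn.2.1 x (by simp)
    obtain ⟨v, -, hv⟩ := isCompact_Icc.ultrafilter_le_nhds _ h1
    exact ⟨v, hv⟩
  choose V hV using hex
  have hVu : ∀ R, TendstoUniformlyOn z V l (ball 0 R) := by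
    intro R
    obtain ⟨C, hC0, hC⟩ := hA (R + 6)
    obtain ⟨K, hK, hest⟩ := exists_pd_sub_le C hC0
    refine tendstoUniformlyOn_of_lipschitz (L := 2 * K) ?_ hV
    filter_upwards [hC 1 one_pos] with n hn x hx y hy
    have h1 := hest R 1 0 (z n) (z n) hn hn le_rfl (by simp)
    rw [← Real.norm_eq_abs]
    refine Convex.norm_image_sub_le_of_norm_fderiv_le (𝕜 := ℝ) (s := ball (0 : R2) R)
      (fun t ht => ?_) (fun t ht => ?_) (convex_ball _ _) hy hx
    · exact (hn.1.contDiffAt (isOpen_ball.mem_nhds (ball_subset_ball (by linarith) ht))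
        ).differentiableAt (by norm_num)
    · refine (norm_fderiv_le _ _).trans ?_
      linarith [(h1 t ht 0).1, (h1 t ht 1).1]
  have hcau : ∀ R j, UniformCauchySeqOn (fun n => pd j (z n)) l (ball 0 R) ∧
      ∀ k, UniformCauchySeqOn (fun n => pd k (pd j (z n))) l (ball 0 R) := by
    intro R
    obtain ⟨C, hC0, hC⟩ := hA (R + 6)
    obtain ⟨K, hK, hest⟩ := exists_pd_sub_le C hC0
    have key : ∀ ε > 0, ∀ᶠ m : ι × ι in (l : Filter ι) ×ˢ (l : Filter ι),
        ∀ x ∈ ball (0 : R2) R, ∀ i,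
          |pd i (z m.1) x - pd i (z m.2) x| < ε ∧
          ∀ j, |pd i (pd j (z m.1)) x - pd i (pd j (z m.2)) x| < ε := by
      intro ε hε
      set δ := min 1 (ε / (4 * K)) with hδ
      have hδ0 : 0 < δ := lt_min one_pos (by positivity)
      have hKδ : K * (δ + δ) < ε := by
        have : δ * (4 * K) ≤ ε := (le_div_iff₀ (by positivity)).1 (min_le_right _ _)
        nlinarith
      have h1 := uniformCauchySeqOn_iff_abs_lt.1 (hVu (R + 6)).uniformCauchySeqOn δ hδ0
      filter_upwards [h1, (hC δ hδ0).prod_mk (hC δ hδ0)] with m hm hm2 x hx i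
      obtain ⟨-, h3, h4⟩ := hest R δ δ (z m.1) (z m.2) hm2.1 hm2.2 (min_le_left _ _)
        (fun t ht => (hm t ht).le) x hx i
      exact ⟨h3.trans_lt hKδ, fun j => (h4 j).trans_lt hKδ⟩
    refine fun j => ⟨?_, fun k => ?_⟩
    · refine uniformCauchySeqOn_iff_abs_lt.2 fun ε hε => ?_
      filter_upwards [key ε hε] with m hm x hx using (hm x hx j).1
    · refine uniformCauchySeqOn_iff_abs_lt.2 fun ε hε => ?_
      filter_upwards [key ε hε] with m hm x hx using (hm x hx k).2 j
  have hreg : ∀ R, ∀ᶠ n in (l : Filter ι), ContDiffOn ℝ 2 (z n) (ball 0 R) := fun R => by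
    obtain ⟨C, -, hC⟩ := hA R
    filter_upwards [hC 1 one_pos] with n hn using hn.1
  have hL1 := fun R => exists_pd_limit (l := (l : Filter ι)) (f := z) (g := V) (R := R)
    (by filter_upwards [hreg R] with n hn using hn.of_le (by norm_num))
    (fun k => (hcau R k).1) (fun x _ => hV x)
  have hL2 := fun R j => exists_pd_limit (l := (l : Filter ι)) (f := fun n => pd j (z n))
    (g := pd j V) (R := R)
    (by filter_upwards [hreg R] with n hn using hn.pd isOpen_ball (by norm_num) j)
    (fun k => (hcau R j).2 k) (fun x hx => ((hL1 R).2 j).tendsto_at hx)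
  have hV2 : ContDiff ℝ 2 V := by
    rw [contDiff_iff_contDiffAt]
    intro x
    have : ContDiffOn ℝ 2 V (ball 0 (‖x‖ + 1)) :=
      contDiffOn_of_pd (n := 1) isOpen_ball ((hL1 _).1.differentiableOn (by norm_num)) (by simp)
        (by norm_num) fun k => (hL2 _ k).1
    exact this.contDiffAt (isOpen_ball.mem_nhds (by simp))
  have hlap : ∀ x, lap V x = -exp (V x) := by
    intro x
    have hx : x ∈ ball (0 : R2) (‖x‖ + 1) := by simp
    have h1 : Tendsto (fun n => lap (z n) x) l (𝓝 (lap V x)) := by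
      simp only [lap_eq]
      exact (((hL2 _ 0).2 0).tendsto_at hx).add (((hL2 _ 1).2 1).tendsto_at hx)
    have h2 : Tendsto (fun n => lap (z n) x + exp (z n x)) l (𝓝 0) := by
      rw [Metric.tendsto_nhds]
      intro ε hε
      obtain ⟨C, -, hC⟩ := hA (‖x‖ + 1)
      filter_upwards [hC (ε / 2) (by positivity)] with n hn
      rw [Real.dist_eq, sub_zero]
      exact (hn.abs_lap_sub_exp_le hx).trans_lt (by linarith)
    have h3 := tendsto_nhds_unique h2
      (h1.add ((Real.continuous_exp.tendsto _).comp (hV x)))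
    linarith
  have hV0 : V 0 = 0 := tendsto_nhds_unique (hV 0)
    (tendsto_const_nhds.congr' (by filter_upwards [h0] with n hn using hn.symm))
  have hVn : ∀ x, V x ≤ 0 := by
    intro x
    obtain ⟨C, -, hC⟩ := hA (‖x‖ + 1)
    refine le_of_tendsto (hV x) ?_
    filter_upwards [hC 1 one_pos] with n hn using (hn.2.1 x (by simp)).2
  have hmass : ∀ R : ℝ, ∫ y in ball (0 : R2) R, exp (V y) ≤ M := by
    intro R
    obtain ⟨C, -, hC⟩ := hA R
    refine ge_of_tendsto' (f := fun k : ℕ => M + volume.real (ball (0 : R2) R) * (1 / ((k : ℝ) + 1)))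
      (x := atTop) ?_ fun k => ?_
    · simpa using (tendsto_one_div_add_atTop_nhds_zero_nat.const_mul
        (volume.real (ball (0 : R2) R))).const_add M
    · have hk : (0 : ℝ) < 1 / ((k : ℝ) + 1) := by positivity
      obtain ⟨n, hn1, hn2, hn3⟩ := ((Metric.tendstoUniformlyOn_iff.1 (hVu R) _ hk).and
        ((hM R).and (hC 1 one_pos))).exists
      have hfin : IsFiniteMeasure (volume.restrict (ball (0 : R2) R)) :=
        ⟨by rw [Measure.restrict_apply_univ]; exact measure_ball_lt_top⟩
      have hi : ∀ f : R2 → ℝ, ContinuousOn f (ball 0 R) → (∀ x ∈ ball (0 : R2) R, f x ≤ 0) →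
          IntegrableOn (fun y => exp (f y)) (ball (0 : R2) R) := by
        intro f hf hf0
        refine Integrable.mono' (integrable_const (1 : ℝ))
          ((Real.continuous_exp.comp_continuousOn hf).aestronglyMeasurable measurableSet_ball) ?_
        refine (ae_restrict_iff' measurableSet_ball).2 (Eventually.of_forall fun y hy => ?_)
        rw [Real.norm_of_nonneg (exp_pos _).le]
        exact exp_le_one_iff.2 (hf0 y hy)
      have hiz := hi (z n) hn3.1.continuousOn (fun x hx => (hn3.2.1 x hx).2)
      calc ∫ y in ball (0 : R2) R, exp (V y)
          ≤ ∫ y in ball (0 : R2) R, (exp (z n y) + 1 / ((k : ℝ) + 1)) := by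
            refine setIntegral_mono_on (hi V hV2.continuous.continuousOn fun x _ => hVn x)
              (hiz.add (integrable_const _)) measurableSet_ball fun y hy => ?_
            have h1 := abs_exp_sub_exp_le (hVn y) (hn3.2.1 y hy).2
            have h2 := hn1 y hy
            rw [Real.dist_eq] at h2
            linarith [le_abs_self (exp (V y) - exp (z n y))]
        _ = (∫ y in ball (0 : R2) R, exp (z n y)) +
              volume.real (ball (0 : R2) R) * (1 / ((k : ℝ) + 1)) := by
            rw [integral_add hiz (integrable_const _), setIntegral_const, smul_eq_mul]
        _ ≤ _ := by linarith
  obtain rfl := eq_stdBubble hV2 hlap hVn hV0 hmass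
  exact ⟨hV2, fun R => ⟨hVu R, fun j => ⟨(hL1 R).2 j, (hL2 R j).2⟩⟩⟩

theorem abs_fderiv_fderiv_sub_le {f g : R2 → ℝ} {x : R2} (hf : ContDiffAt ℝ 2 f x)
    (hg : ContDiffAt ℝ 2 g x) {A : ℝ}
    (h : ∀ i j, |pd i (pd j f) x - pd i (pd j g) x| ≤ A) (v w : R2) :
    |fderiv ℝ (fderiv ℝ f) x v w - fderiv ℝ (fderiv ℝ g) x v w| ≤ 4 * A * ‖v‖ * ‖w‖ := by
  have key : ∀ f : R2 → ℝ, ContDiffAt ℝ 2 f x → fderiv ℝ (fderiv ℝ f) x v w =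
      (v 0 * pd 0 (pd 0 f) x + v 1 * pd 1 (pd 0 f) x) * w 0 +
      (v 0 * pd 0 (pd 1 f) x + v 1 * pd 1 (pd 1 f) x) * w 1 := by
    intro f hf
    have hd : DifferentiableAt ℝ (fderiv ℝ f) x :=
      (hf.fderiv_right (m := 1) (by norm_num)).differentiableAt (by norm_num)
    have hpd : ∀ i u, fderiv ℝ (pd i f) x u =
        fderiv ℝ (fderiv ℝ f) x u (EuclideanSpace.single i 1) := fun i u => by
      have := hd.hasFDerivAt.clm_apply (hasFDerivAt_const (EuclideanSpace.single i (1 : ℝ)) x)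
      change fderiv ℝ (fun y => fderiv ℝ f y (EuclideanSpace.single i 1)) x u = _
      rw [this.fderiv]
      simp
    rw [← fderiv_eq_pd, ← fderiv_eq_pd, hpd, hpd]
    have hw : w = w 0 • EuclideanSpace.single 0 1 + w 1 • EuclideanSpace.single 1 1 := by
      ext i; fin_cases i <;> simp
    conv_lhs => rw [hw]
    simp [mul_comm]
  rw [key f hf, key g hg]
  have hA : 0 ≤ A := (abs_nonneg _).trans (h 0 0)
  have hv := abs_coord_le v
  have hw := abs_coord_le w
  have term : ∀ i j, |v i * w j * (pd i (pd j f) x - pd i (pd j g) x)| ≤ ‖v‖ * ‖w‖ * A := by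
    intro i j
    rw [abs_mul, abs_mul]
    exact mul_le_mul (mul_le_mul (hv i) (hw j) (abs_nonneg _) (norm_nonneg _)) (h i j)
      (abs_nonneg _) (by positivity)
  have t00 := abs_le.1 (term 0 0)
  have t01 := abs_le.1 (term 0 1)
  have t10 := abs_le.1 (term 1 0)
  have t11 := abs_le.1 (term 1 1)
  rw [abs_le]
  constructor <;> linarith [t00.1, t00.2, t01.1, t01.2, t10.1, t10.2, t11.1, t11.2]

theorem dist_iteratedFDeriv_le {f g : R2 → ℝ} {x : R2} (hf : ContDiffAt ℝ 2 f x)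
    (hg : ContDiffAt ℝ 2 g x) {A : ℝ} (h0 : |f x - g x| ≤ A)
    (h1 : ∀ i, |pd i f x - pd i g x| ≤ A)
    (h2 : ∀ i j, |pd i (pd j f) x - pd i (pd j g) x| ≤ A) {n : ℕ} (hn : n ≤ 2) :
    dist (iteratedFDeriv ℝ n g x) (iteratedFDeriv ℝ n f x) ≤ 4 * A := by
  have hA : 0 ≤ A := (abs_nonneg _).trans h0
  rw [dist_comm, dist_eq_norm]
  refine ContinuousMultilinearMap.opNorm_le_bound (by positivity) fun m => ?_
  rw [sub_apply, Real.norm_eq_abs]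
  interval_cases n
  · simp only [iteratedFDeriv_zero_apply, Finset.univ_eq_empty, Finset.prod_empty, mul_one]
    linarith
  · simp only [iteratedFDeriv_one_apply, Finset.univ_unique, Finset.prod_singleton,
      fderiv_eq_pd]
    have t : ∀ i, |(m 0) i * (pd i f x - pd i g x)| ≤ ‖m 0‖ * A := fun i => by
      rw [abs_mul]
      exact mul_le_mul (abs_coord_le _ i) (h1 i) (abs_nonneg _) (norm_nonneg _)
    have t0 := abs_le.1 (t 0)
    have t1 := abs_le.1 (t 1)
    have hp : 0 ≤ A * ‖m 0‖ := by positivity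
    change |_| ≤ 4 * A * ‖m 0‖
    rw [abs_le]
    constructor <;> linarith [t0.1, t0.2, t1.1, t1.2]
  · rw [iteratedFDeriv_two_apply, iteratedFDeriv_two_apply, Fin.prod_univ_two, ← mul_assoc]
    exact abs_fderiv_fderiv_sub_le hf hg h2 _ _

theorem tendstoUniformlyOn_stdBubble {ι : Type*} {l : Filter ι} {z : ι → R2 → ℝ} {M : ℝ}
    (hA : ∀ R, ∃ C, 0 ≤ C ∧ ∀ κ > 0, ∀ᶠ n in l, ApproxLiouville R C κ (z n))
    (h0 : ∀ᶠ n in l, z n 0 = 0)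
    (hM : ∀ R : ℝ, ∀ᶠ n in l, ∫ y in ball (0 : R2) R, exp (z n y) ≤ M) (R : ℝ) {n : ℕ}
    (hn : n ≤ 2) :
    TendstoUniformlyOn (fun i x => iteratedFDeriv ℝ n (z i) x)
      (fun x => iteratedFDeriv ℝ n stdBubble x) l (ball 0 R) := by
  rw [Metric.tendstoUniformlyOn_iff]
  intro ε hε
  refine Filter.mem_iff_ultrafilter.2 fun 𝒰 h𝒰 => ?_
  obtain ⟨hU, h⟩ := tendsto_stdBubble_of_ultrafilter 𝒰 (z := z) (M := M)
    (fun R => by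
      obtain ⟨C, hC, h⟩ := hA R
      exact ⟨C, hC, fun κ hκ => (h κ hκ).filter_mono h𝒰⟩)
    (h0.filter_mono h𝒰) (fun R => (hM R).filter_mono h𝒰)
  obtain ⟨C, -, hC⟩ := hA R
  obtain ⟨hz, hp⟩ := h R
  have hε' : 0 < ε / 5 := by positivity
  have e1 := fun j => Metric.tendstoUniformlyOn_iff.1 (hp j).1 _ hε'
  have e2 := fun j k => Metric.tendstoUniformlyOn_iff.1 ((hp j).2 k) _ hε'
  filter_upwards [Metric.tendstoUniformlyOn_iff.1 hz _ hε', eventually_all.2 e1,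
    eventually_all.2 fun j => eventually_all.2 (e2 j), (hC 1 one_pos).filter_mono h𝒰]
    with i i0 i1 i2 i3 x hx
  simp only [Real.dist_eq] at i0 i1 i2
  refine (dist_iteratedFDeriv_le (i3.1.contDiffAt (isOpen_ball.mem_nhds hx)) hU.contDiffAt
    (A := ε / 5) ?_ (fun j => ?_) (fun k j => ?_) hn).trans_lt (by linarith)
  · rw [abs_sub_comm]; exact (i0 x hx).le
  · rw [abs_sub_comm]; exact (i1 j x hx).le
  · rw [abs_sub_comm]; exact (i2 j k x hx).le

theorem pd_comp_smul_add (f : R2 → ℝ) (r : ℝ) (a x : R2) (i : Fin 2) :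
    pd i (fun y => f (r • y + a)) x = r * pd i f (r • x + a) := by
  have := fderiv_comp_smul (𝕜 := ℝ) (f := fun y => f (y + a)) (x := x) r
  simp only [pd, this, fderiv_comp_add_right]
  simp

theorem lap_comp_smul_add (f : R2 → ℝ) (r : ℝ) (a x : R2) :
    lap (fun y => f (r • y + a)) x = r ^ 2 * lap f (r • x + a) := by
  have : ∀ i, pd i (fun y => f (r • y + a)) = fun y => r * pd i f (r • y + a) := fun i =>
    funext fun y => pd_comp_smul_add f r a y i
  rw [lap_eq, lap_eq, this, this, pd_const_mul, pd_const_mul, pd_comp_smul_add,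
    pd_comp_smul_add]
  ring

theorem pd_sub_const (f : R2 → ℝ) (c : ℝ) (x : R2) (i : Fin 2) :
    pd i (fun y => f y - c) x = pd i f x := by
  simp [pd, fderiv_sub_const]

theorem lap_sub_const (f : R2 → ℝ) (c : ℝ) (x : R2) : lap (fun y => f y - c) x = lap f x := by
  have : ∀ i, pd i (fun y => f y - c) = pd i f := fun i => funext fun y => pd_sub_const f c y i
  rw [lap_eq, lap_eq, this, this]

theorem lap_nonpos_of_isLocalMax {w : R2 → ℝ} {D : Set R2} (hD : IsOpen D)
    (hw : ContDiffOn ℝ 2 w D) {x : R2} (hx : x ∈ D) (hmax : IsLocalMax w x) : lap w x ≤ 0 := by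
  suffices h : ∀ i, pd i (pd i w) x ≤ 0 by rw [lap_eq]; linarith [h 0, h 1]
  intro i
  by_contra! hpos
  set e : R2 := EuclideanSpace.single i 1
  have hcont : Continuous fun t : ℝ => x + t • e := by fun_prop
  have hx0 : x + (0 : ℝ) • e = x := by simp
  have hnear : ∀ᶠ t in 𝓝 (0 : ℝ), x + t • e ∈ D :=
    hcont.continuousAt (by rw [hx0]; exact hD.mem_nhds hx)
  have hd : ∀ᶠ t in 𝓝 (0 : ℝ), HasDerivAt (fun t : ℝ => w (x + t • e)) (pd i w (x + t • e)) t := by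
    filter_upwards [hnear] with t ht
    exact hasDerivAt_line ((hw.contDiffAt (hD.mem_nhds ht)).differentiableAt (by norm_num))
  have hdd : HasDerivAt (fun t : ℝ => pd i w (x + t • e)) (pd i (pd i w) (x + (0 : ℝ) • e)) 0 :=
    hasDerivAt_line ((((hw.pd hD (m := 1) (by norm_num) i).contDiffAt
      (hD.mem_nhds (by rwa [hx0])))).differentiableAt (by norm_num))
  have hderiv : deriv (fun t : ℝ => w (x + t • e)) =ᶠ[𝓝 0] fun t => pd i w (x + t • e) := by
    filter_upwards [hd] with t ht using ht.deriv
  have hmax' : IsLocalMax (fun t : ℝ => w (x + t • e)) 0 := by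
    have := hcont.continuousAt (x := 0)
    rw [ContinuousAt, hx0] at this
    filter_upwards [this.eventually hmax] with t ht
    simpa using ht
  have h2 : deriv (deriv fun t : ℝ => w (x + t • e)) 0 = pd i (pd i w) x := by
    rw [hderiv.deriv_eq, hdd.deriv, hx0]
  have hmin : IsLocalMin (fun t : ℝ => w (x + t • e)) 0 :=
    isLocalMin_of_deriv_deriv_pos (by rw [h2]; exact hpos) hmax'.deriv_eq_zero
      hd.self_of_nhds.continuousAt
  have hconst : (fun t : ℝ => w (x + t • e)) =ᶠ[𝓝 0] fun _ => w (x + (0 : ℝ) • e) := by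
    filter_upwards [hmin, hmax'] with t h1 h2 using le_antisymm h2 h1
  have h3 := hconst.deriv.deriv_eq
  rw [h2] at h3
  simp at h3
  exact hpos.ne' h3

theorem lap_one_sub_norm_sq (c x : R2) : lap (fun y => 1 - ‖y + c‖ ^ 2) x = -4 := by
  rw [lap_comp_add fun y : R2 => 1 - ‖y‖ ^ 2]
  have : ∀ i, pd i (fun y : R2 => 1 - ‖y‖ ^ 2) = fun y => -2 * y i := fun i => funext fun y => by
    rw [pd_norm_sq]; ring
  rw [lap_eq, this, this, pd_const_mul, pd_const_mul, pd_coord, pd_coord]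
  norm_num

theorem abs_rpow_mul_le {p s M : ℝ} (hp : 1 < p) (hM : 0 < M) (hs : |s| ≤ M) :
    |(|s| ^ (p - 1) * s)| ≤ M ^ p := by
  rw [abs_mul, abs_of_nonneg (rpow_nonneg (abs_nonneg s) _)]
  calc |s| ^ (p - 1) * |s| ≤ M ^ (p - 1) * M :=
        mul_le_mul (rpow_le_rpow (abs_nonneg _) hs (by linarith)) hs (abs_nonneg _)
          (rpow_nonneg hM.le _)
    _ = M ^ p := by rw [← rpow_add_one hM.ne']; congr 1; ring

theorem exists_le_rpow_max {Ω : Set R2} (hop : IsOpen Ω) (hbdd : Bornology.IsBounded Ω) :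
    ∃ c > 0, ∀ (p : ℝ) (u : R2 → ℝ) (x₀ : R2), 1 < p → IsSolution Ω p u → x₀ ∈ Ω → 0 < u x₀ →
      (∀ x ∈ Ω, |u x| ≤ u x₀) → c ≤ u x₀ ^ (p - 1) := by
  obtain ⟨D, hD0, hD⟩ : ∃ D > 0, ∀ x ∈ closure Ω, ∀ y ∈ closure Ω, ‖x - y‖ ≤ D := by
    obtain ⟨D, hD⟩ := (Metric.isBounded_iff.1 hbdd.closure)
    exact ⟨max D 1, by positivity, fun x hx y hy => by
      rw [← dist_eq_norm]; exact (hD hx hy).trans (le_max_left _ _)⟩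
  refine ⟨2 / D ^ 2, by positivity, fun p u x₀ hp hu hx₀ hM hmax => ?_⟩
  set M := u x₀ with hMdef
  set A := M ^ p / 2 with hA
  have hA0 : 0 < A := by positivity
  obtain ⟨hu2, hu1, heq, hbd⟩ := hu
  set g : R2 → ℝ := fun y => A * (1 - ‖y + -x₀‖ ^ 2) with hg
  have hgc : ContDiff ℝ 2 g := contDiff_const.mul
    (contDiff_const.sub ((contDiff_norm_sq ℝ).comp (contDiff_id.add contDiff_const)))
  have hcpt : IsCompact (closure Ω) := hbdd.isCompact_closure
  obtain ⟨y, hy, hymax⟩ := hcpt.exists_isMaxOn ⟨x₀, subset_closure hx₀⟩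
    (hu1.continuousOn.sub hgc.continuous.continuousOn)
  have hfr : y ∉ Ω := by
    intro hyΩ
    have h1 := lap_nonpos_of_isLocalMax hop (hu2.sub hgc.contDiffOn) hyΩ
      (hymax.isLocalMax (mem_of_superset (hop.mem_nhds hyΩ) subset_closure))
    change lap (fun y => u y - g y) y ≤ 0 at h1
    rw [lap_sub hop hu2 hgc.contDiffOn hyΩ, hg, lap_const_mul, lap_one_sub_norm_sq] at h1
    have h2 := abs_le.1 (abs_rpow_mul_le hp hM (hmax y hyΩ))
    rw [← heq y hyΩ] at h2
    have : 0 < M ^ p := by positivity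
    linarith [h2.2]
  have h0 : u y = 0 := hbd y (by rw [hop.frontier_eq]; exact ⟨hy, hfr⟩)
  have h1 : M ≤ A * D ^ 2 := by
    have h2 : u x₀ - g x₀ ≤ u y - g y := hymax (subset_closure hx₀)
    rw [h0] at h2
    simp only [hg, add_neg_cancel, norm_zero] at h2
    have h3 : ‖y + -x₀‖ ^ 2 ≤ D ^ 2 := by
      rw [← sub_eq_add_neg]
      exact pow_le_pow_left₀ (norm_nonneg _) (hD y hy x₀ (subset_closure hx₀)) 2
    have h4 := mul_le_mul_of_nonneg_left h3 hA0.le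
    linarith
  rw [div_le_iff₀ (by positivity)]
  have h5 : M ^ p = M ^ (p - 1) * M := by rw [← rpow_add_one hM.ne']; congr 1; ring
  rw [hA, h5] at h1
  have : M * 2 ≤ M * (M ^ (p - 1) * D ^ 2) := by linarith
  exact le_of_mul_le_mul_left this hM

theorem abs_mul_log_sub_le {p t C : ℝ} (hC : 0 ≤ C) (hp : 2 * C + 2 ≤ p) (ht : t ∈ Icc (-C) 0) :
    |log (1 + t / p)| ≤ 2 * C / p ∧ |p * log (1 + t / p) - t| ≤ 2 * C ^ 2 / p := by
  have hp0 : 0 < p := by linarith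
  set s := t / p with hs
  have hts : t = p * s := by rw [hs]; field_simp
  have hs0 : s ≤ 0 := div_nonpos_of_nonpos_of_nonneg ht.2 hp0.le
  have hsC : -s ≤ C / p := by rw [hs, ← neg_div]; gcongr; linarith [ht.1]
  have hCp : C / p ≤ 1 / 2 := by rw [div_le_div_iff₀ hp0 (by norm_num)]; linarith
  have h1s : 0 < 1 + s := by linarith
  have h1 := one_sub_inv_le_log_of_pos h1s
  have h2 := log_le_sub_one_of_pos h1s
  have h3 : s - 2 * s ^ 2 ≤ 1 - (1 + s)⁻¹ := by
    have : 1 - (1 + s)⁻¹ - (s - 2 * s ^ 2) = s ^ 2 * (1 + 2 * s) / (1 + s) := by field_simp; ring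
    have h : 0 ≤ s ^ 2 * (1 + 2 * s) / (1 + s) := by
      have : 0 ≤ 1 + 2 * s := by linarith
      positivity
    linarith
  have hsq : s ^ 2 ≤ (C / p) ^ 2 := by nlinarith
  have e : p * (2 * (C / p) ^ 2) = 2 * C ^ 2 / p := by field_simp
  constructor
  · rw [abs_of_nonpos (by linarith), mul_div_assoc]
    nlinarith
  · rw [abs_of_nonpos (by nlinarith), ← e]
    nlinarith

/-- `(1 + t/p)^p` converges to `exp t` in `C¹` on compact subsets of `(-∞, 0]`. -/
theorem eventually_one_add_div_rpow (C : ℝ) (hC : 0 ≤ C) {κ : ℝ} (hκ : 0 < κ) :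
    ∀ᶠ p : ℝ in atTop, ∀ t ∈ Icc (-C) 0, 0 < 1 + t / p ∧
      ContDiffAt ℝ 1 (fun t : ℝ => (1 + t / p) ^ p) t ∧ |(1 + t / p) ^ p - exp t| ≤ κ ∧
      |deriv (fun t : ℝ => (1 + t / p) ^ p) t - exp t| ≤ κ := by
  have hlim : Tendsto (fun p : ℝ => (2 * C ^ 2 + 2 * C) / p) atTop (𝓝 0) :=
    tendsto_const_nhds.div_atTop tendsto_id
  filter_upwards [eventually_ge_atTop (2 * C + 2), hlim.eventually_le_const hκ] with p hp hpκ t ht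
  have hp0 : 0 < p := by linarith
  have hpos : 0 < 1 + t / p := by
    have : -(C / p) ≤ t / p := by rw [← neg_div]; gcongr; exact ht.1
    have hCp : C / p ≤ 1 / 2 := by rw [div_le_div_iff₀ hp0 (by norm_num)]; linarith
    linarith
  obtain ⟨h1, h2⟩ := abs_mul_log_sub_le hC hp ht
  have hlog : log (1 + t / p) ≤ 0 := log_nonpos hpos.le (by
    linarith [div_nonpos_of_nonpos_of_nonneg ht.2 hp0.le])
  have hder : HasDerivAt (fun t : ℝ => (1 + t / p) ^ p) ((1 + t / p) ^ (p - 1)) t := by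
    have h3 : HasDerivAt (fun t : ℝ => 1 + t / p) (1 / p) t :=
      ((hasDerivAt_id t).div_const p).const_add 1
    have h4 := h3.rpow_const (p := p) (Or.inl hpos.ne')
    convert h4 using 1
    field_simp
  have hC2 : 0 ≤ C ^ 2 / p := by positivity
  have hC1 : 0 ≤ C / p := by positivity
  rw [add_div, mul_div_assoc, mul_div_assoc] at hpκ
  rw [mul_div_assoc] at h1 h2
  refine ⟨hpos, ?_, ?_, ?_⟩
  · exact (contDiffAt_const.add (contDiffAt_id.div_const p)).rpow_const_of_ne hpos.ne'
  · rw [rpow_def_of_pos hpos, mul_comm]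
    exact (abs_exp_sub_exp_le (mul_nonpos_of_nonneg_of_nonpos hp0.le hlog) ht.2).trans (by linarith)
  · rw [hder.deriv, rpow_def_of_pos hpos, mul_comm]
    refine (abs_exp_sub_exp_le (mul_nonpos_of_nonneg_of_nonpos (by linarith) hlog) ht.2).trans ?_
    rw [abs_le] at *
    constructor <;> linarith [h1.1, h1.2, h2.1, h2.2]

theorem integral_eq_iterated {G : R2 → ℝ} (hG : Integrable G) :
    Integrable (fun s : ℝ => ∫ t : ℝ, G !₂[s, t]) ∧ ∫ y, G y = ∫ s : ℝ, ∫ t : ℝ, G !₂[s, t] := by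
  let e : R2 ≃ᵐ ℝ × ℝ := (MeasurableEquiv.toLp 2 (Fin 2 → ℝ)).symm.trans MeasurableEquiv.finTwoArrow
  have he : MeasurePreserving e :=
    (EuclideanSpace.volume_preserving_symm_measurableEquiv_toLp (Fin 2)).trans
      (volume_preserving_finTwoArrow ℝ)
  have hes : ∀ q : ℝ × ℝ, e.symm q = !₂[q.1, q.2] := fun q => rfl
  have h1 : Integrable fun q : ℝ × ℝ => G !₂[q.1, q.2] := by
    have := he.symm.integrable_comp_emb e.symm.measurableEmbedding (g := G)
    exact this.2 hG
  refine ⟨h1.integral_prod_left, ?_⟩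
  rw [← he.symm.integral_comp' (g := G)]
  exact integral_prod _ h1

theorem le_integral_sq_deriv {f a : ℝ → ℝ} (hf : ∀ t, HasDerivAt f (a t) t) (ha : Continuous a)
    (hi : Integrable fun t => a t ^ 2) {t τ l : ℝ} (hl : 0 < l) (hτ : |τ - t| ≤ l)
    (h1 : 1 / 4 ≤ f t) (h0 : f τ = 0) : 1 / (16 * l) ≤ ∫ s, a s ^ 2 := by
  have h2 : ∫ s in τ..t, a s = f t - f τ :=
    intervalIntegral.integral_eq_sub_of_hasDerivAt (fun s _ => hf s) (ha.intervalIntegrable _ _)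
  have hvol : volume.real (uIoc τ t) ≤ l := by
    rw [measureReal_def, volume_uIoc, ENNReal.toReal_ofReal (abs_nonneg _), abs_sub_comm]
    exact hτ
  have hfin : IsFiniteMeasure (volume.restrict (uIoc τ t)) :=
    ⟨by rw [Measure.restrict_apply_univ, volume_uIoc]; exact ENNReal.ofReal_lt_top⟩
  have h3 : |∫ s in τ..t, a s| ≤ ∫ s in uIoc τ t, (2 * l * a s ^ 2 + 1 / (8 * l)) := by
    refine (intervalIntegral.norm_integral_le_integral_norm_uIoc (f := a)).trans ?_
    refine setIntegral_mono_on ((ha.intervalIntegrable τ t).norm.def') ((hi.integrableOn.const_mul _).add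
      (integrable_const _)) measurableSet_uIoc fun s _ => ?_
    have : 2 * l * a s ^ 2 + 1 / (8 * l) - ‖a s‖ = 2 * l * (‖a s‖ - 1 / (4 * l)) ^ 2 := by
      rw [← sq_abs (a s), Real.norm_eq_abs]; field_simp; ring
    nlinarith [mul_nonneg hl.le (sq_nonneg (‖a s‖ - 1 / (4 * l)))]
  rw [integral_add (hi.integrableOn.const_mul _) (integrable_const _), integral_const_mul,
    setIntegral_const, smul_eq_mul] at h3
  have h4 : ∫ s in uIoc τ t, a s ^ 2 ≤ ∫ s, a s ^ 2 :=
    setIntegral_le_integral hi (Eventually.of_forall fun s => sq_nonneg _)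
  have h5 : volume.real (uIoc τ t) * (1 / (8 * l)) ≤ 1 / 8 := by
    calc _ ≤ l * (1 / (8 * l)) := mul_le_mul_of_nonneg_right hvol (by positivity)
      _ = 1 / 8 := by field_simp
  rw [h2, h0, sub_zero] at h3
  have h6 := le_abs_self (f t)
  have h7 := mul_le_mul_of_nonneg_left h4 (by positivity : 0 ≤ 2 * l)
  rw [div_le_iff₀ (by positivity)]
  linarith

theorem integrable_sq_pd {T : R2 → ℝ} (hT : ContDiff ℝ 1 T) (hc : HasCompactSupport T) (i : Fin 2) :
    Integrable fun y => pd i T y ^ 2 := by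
  have hpd : Continuous (pd i T) := (hT.pd (m := 0) (by norm_num) i).continuous
  have h : Integrable (fun y => pd i T y * pd i T y) :=
    (hpd.mul hpd).integrable_of_hasCompactSupport (HasCompactSupport.mul_right (hc.pd i))
  simpa only [sq] using h

theorem continuous_vec : Continuous fun q : ℝ × ℝ => (!₂[q.1, q.2] : R2) := by
  have h : Continuous fun q : ℝ × ℝ => (![q.1, q.2] : Fin 2 → ℝ) :=
    continuous_pi fun i => by
      fin_cases i
      · exact continuous_fst
      · exact continuous_snd
  exact (PiLp.continuous_toLp 2 _).comp h

theorem toLp_eq_add_smul (s t : ℝ) :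
    (!₂[s, t] : R2) = !₂[s, 0] + t • EuclideanSpace.single 1 1 := by
  ext i; fin_cases i <;> simp

theorem le_integral_sq_pd_of_strip {T : R2 → ℝ} (hT : ContDiff ℝ 1 T) (hc : HasCompactSupport T)
    {a b w l : ℝ} (hw : 0 ≤ w) (hl : 0 < l)
    (h : ∀ s, |s - a| ≤ w → 1 / 4 ≤ T !₂[s, b] ∧ ∃ τ, |τ - b| ≤ l ∧ T !₂[s, τ] = 0) :
    w / (8 * l) ≤ ∫ y, pd 1 T y ^ 2 := by
  have hpd : Continuous (pd 1 T) := (hT.pd (m := 0) (by norm_num) 1).continuous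
  have hint := integrable_sq_pd hT hc 1
  obtain ⟨hi, he⟩ := integral_eq_iterated hint
  have hline : ∀ s t, HasDerivAt (fun t => T !₂[s, t]) (pd 1 T !₂[s, t]) t := fun s t => by
    have h1 := hasDerivAt_line (f := T) (y := !₂[s, 0]) (i := 1) (t := t)
      (hT.differentiable (by norm_num) _)
    have h2 : (fun t => T !₂[s, t]) = fun t : ℝ => T (!₂[s, 0] + t • EuclideanSpace.single 1 1) :=
      funext fun t => by rw [← toLp_eq_add_smul]
    rw [h2, toLp_eq_add_smul s t]
    exact h1
  have hseccont : ∀ s : ℝ, Continuous fun t : ℝ => pd 1 T !₂[s, t] := fun s =>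
    hpd.comp (continuous_vec.comp (Continuous.prodMk_right s))
  have hsec : ∀ s : ℝ, Integrable fun t : ℝ => pd 1 T !₂[s, t] ^ 2 := fun s => by
    refine ((hseccont s).pow 2).integrable_of_hasCompactSupport ?_
    have hK : IsCompact ((fun y : R2 => y 1) '' tsupport (pd 1 T)) :=
      IsCompact.image (hc.pd 1) (by fun_prop)
    refine HasCompactSupport.intro hK fun t ht => ?_
    have : (!₂[s, t] : R2) ∉ tsupport (pd 1 T) := fun hm => ht ⟨_, hm, by simp⟩
    have h0 : pd 1 T !₂[s, t] = 0 := image_eq_zero_of_notMem_tsupport this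
    change pd 1 T !₂[s, t] ^ 2 = 0
    rw [h0]
    norm_num
  have hnn : ∀ s : ℝ, 0 ≤ ∫ t : ℝ, pd 1 T !₂[s, t] ^ 2 := fun s =>
    integral_nonneg fun t => sq_nonneg _
  rw [he]
  calc w / (8 * l) = ∫ s in Icc (a - w) (a + w), 1 / (16 * l) := by
        rw [setIntegral_const, smul_eq_mul, measureReal_def, Real.volume_Icc,
          ENNReal.toReal_ofReal (by linarith)]
        field_simp; ring
    _ ≤ ∫ s in Icc (a - w) (a + w), ∫ t : ℝ, pd 1 T !₂[s, t] ^ 2 := by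
        refine setIntegral_mono_on (integrableOn_const (by simp))
          hi.integrableOn measurableSet_Icc fun s hs => ?_
        obtain ⟨h1, τ, hτ, h0⟩ := h s (by rw [abs_le]; constructor <;> linarith [hs.1, hs.2])
        exact le_integral_sq_deriv (f := fun t => T !₂[s, t]) (hline s)
          (hseccont s) (hsec s) hl hτ h1 h0
    _ ≤ _ := setIntegral_le_integral hi (Eventually.of_forall hnn)

theorem exists_comp_isometry {T : R2 → ℝ} (hT : ContDiff ℝ 1 T) (hc : HasCompactSupport T)
    (e : R2 ≃ᵢ R2) : ContDiff ℝ 1 (fun y => T (e.symm y)) ∧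
      HasCompactSupport (fun y => T (e.symm y)) ∧
      ∫ y, pd 1 (fun y => T (e.symm y)) y ^ 2 ≤ ∫ y, (pd 0 T y ^ 2 + pd 1 T y ^ 2) := by
  let L : R2 ≃ₗᵢ[ℝ] R2 := e.symm.toRealLinearIsometryEquiv
  obtain ⟨b, hL⟩ : ∃ b, (fun y => e.symm y) = fun y => L y + b :=
    ⟨e.symm 0, funext fun y => by simp [L]⟩
  have hLd : ∀ y, HasFDerivAt (fun y => e.symm y) (L : R2 →L[ℝ] R2) y := fun y => by
    rw [hL]
    exact (L : R2 →L[ℝ] R2).hasFDerivAt.add_const _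
  have hC : ContDiff ℝ 1 (fun y => e.symm y) := by
    rw [hL]
    exact L.contDiff.add contDiff_const
  have hcpt : HasCompactSupport (fun y => T (e.symm y)) :=
    hc.comp_homeomorph e.symm.toHomeomorph
  refine ⟨hT.comp hC, hcpt, ?_⟩
  have hint : Integrable fun y => pd 0 T y ^ 2 + pd 1 T y ^ 2 :=
    (integrable_sq_pd hT hc 0).add (integrable_sq_pd hT hc 1)
  have hmp : MeasurePreserving (fun y => e.symm y) := by
    rw [hL]
    exact (measurePreserving_add_right volume b).comp L.measurePreserving
  have hemb : MeasurableEmbedding (fun y => e.symm y) := e.symm.toHomeomorph.measurableEmbedding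
  rw [← hmp.integral_comp hemb fun y => pd 0 T y ^ 2 + pd 1 T y ^ 2]
  refine integral_mono ?_ ((hmp.integrable_comp_emb hemb).2 hint) fun y => ?_
  · exact integrable_sq_pd (hT.comp hC) hcpt 1
  · have h1 : HasFDerivAt (fun y => T (e.symm y))
        ((fderiv ℝ T (e.symm y)).comp (L : R2 →L[ℝ] R2)) y :=
      (hT.differentiable (by norm_num) _).hasFDerivAt.comp y (hLd y)
    set v := L (EuclideanSpace.single 1 1) with hv
    have h2 : pd 1 (fun y => T (e.symm y)) y = v 0 * pd 0 T (e.symm y) + v 1 * pd 1 T (e.symm y) := by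
      rw [← fderiv_eq_pd, pd, h1.fderiv]
      rfl
    have h3 : v 0 ^ 2 + v 1 ^ 2 = 1 := by
      rw [← norm_sq_eq, hv, L.norm_map]
      simp
    rw [h2]
    set p := pd 0 T (e.symm y)
    set q := pd 1 T (e.symm y)
    have h4 : p ^ 2 + q ^ 2 - (v 0 * p + v 1 * q) ^ 2 = (v 0 * q - v 1 * p) ^ 2 := by
      linear_combination (-(p ^ 2) - q ^ 2) * h3
    nlinarith [sq_nonneg (v 0 * q - v 1 * p)]

theorem abs_sub_coord_le (x y : R2) (i : Fin 2) : |x i - y i| ≤ dist x y := by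
  rw [dist_eq_norm]
  simpa using abs_coord_le (x - y) i

theorem dist_le_abs_add (x y : R2) : dist x y ≤ |x 0 - y 0| + |x 1 - y 1| := by
  rw [dist_eq_norm]
  refine abs_le_of_sq_le_sq' ?_ (by positivity) |>.2
  rw [norm_sq_eq]
  have h0 := sq_abs (x 0 - y 0)
  have h1 := sq_abs (x 1 - y 1)
  have h2 : (x - y) 0 = x 0 - y 0 := rfl
  have h3 : (x - y) 1 = x 1 - y 1 := rfl
  rw [h2, h3]
  nlinarith [mul_nonneg (abs_nonneg (x 0 - y 0)) (abs_nonneg (x 1 - y 1))]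

/-- A compactly supported function that vanishes on `∂Ω` and is at least `1/4` near a point at
distance at most `r` from `s ∩ ∂Ω` has Dirichlet energy at least `c`. -/
def CapacityBound (Ω s : Set R2) (c r : ℝ) : Prop :=
  ∀ ξ ∈ s ∩ frontier Ω, ∀ (x : R2) (d : ℝ), dist x ξ = d → 0 < d → d ≤ r → ∀ T : R2 → ℝ,
    ContDiff ℝ 1 T → HasCompactSupport T → (∀ y ∈ frontier Ω, T y = 0) →
    (∀ y ∈ ball x (d / 5), 1 / 4 ≤ T y) → c ≤ ∫ y, (pd 0 T y ^ 2 + pd 1 T y ^ 2)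

theorem SmoothBoundary.exists_capacityBound_nhds {Ω : Set R2} (hsm : SmoothBoundary Ω) {ζ : R2}
    (hζ : ζ ∈ frontier Ω) : ∃ s ∈ 𝓝 ζ, ∃ c > 0, ∃ r > 0, CapacityBound Ω s c r := by
  obtain ⟨V, hV, hζV, e, g, hg, hfr⟩ := hsm ζ hζ
  obtain ⟨ρ₀, hρ₀, hball⟩ := Metric.isOpen_iff.1 hV ζ hζV
  have hgraph : ∀ y ∈ V, y ∈ frontier Ω ↔ e y 1 = g (e y 0) := fun y hy => by
    have h := Set.ext_iff.1 hfr y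
    simp only [mem_inter_iff, mem_ofPred_eq] at h
    exact ⟨fun h1 => (h.1 ⟨h1, hy⟩).2, fun h1 => (h.2 ⟨hy, h1⟩).1⟩
  have hg1 : ContDiffAt ℝ 1 g (e ζ 0) := (hg.of_le (by norm_cast)).contDiffAt
  obtain ⟨K, t, ht, hK⟩ := hg1.exists_lipschitzOnWith
  obtain ⟨η, hη, hηt⟩ := Metric.mem_nhds_iff.1 ht
  have hLip : ∀ a b : ℝ, |a - e ζ 0| < η → |b - e ζ 0| < η → |g a - g b| ≤ K * |a - b| :=
    fun a b ha hb => by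
      have := hK.dist_le_mul a (hηt ha) b (hηt hb)
      simpa [Real.dist_eq] using this
  have hL : (0 : ℝ) ≤ K := K.2
  obtain ⟨L, hLK⟩ : ∃ L : ℝ, (K : ℝ) = L := ⟨_, rfl⟩
  rw [hLK] at hLip hL
  set ρ := min ρ₀ η / (4 * (L + 1)) with hρdef
  have hm : 0 < min ρ₀ η := lt_min hρ₀ hη
  have hρ : 0 < ρ := by positivity
  have hρm : 4 * ρ * (L + 1) = min ρ₀ η := by rw [hρdef]; field_simp
  have hρ1 : 4 * ρ * (L + 1) ≤ ρ₀ := hρm ▸ min_le_left _ _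
  have hρ2 : 4 * ρ * (L + 1) ≤ η := hρm ▸ min_le_right _ _
  have hLρ : 0 ≤ L * ρ := by positivity
  refine ⟨ball ζ ρ, ball_mem_nhds _ hρ, 1 / (80 * (2 * L + 1)), by positivity, ρ, hρ, ?_⟩
  rintro ξ ⟨hξ, hξf⟩ x d hd hd0 hdρ T hT hc h0 hT4
  obtain ⟨hTe, hce, hle⟩ := exists_comp_isometry hT hc e
  refine le_trans ?_ hle
  have hξζ : dist (e ξ) (e ζ) < ρ := by rw [e.dist_eq]; exact hξ
  have hxξ : dist (e x) (e ξ) = d := by rw [e.dist_eq]; exact hd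
  have hξg : e ξ 1 = g (e ξ 0) := (hgraph ξ (hball (by
    rw [mem_ball] at hξ ⊢; nlinarith))).1 hξf
  have hζg : e ζ 1 = g (e ζ 0) := (hgraph ζ hζV).1 hζ
  have key := le_integral_sq_pd_of_strip hTe hce (a := e x 0) (b := e x 1) (w := d / 10)
    (l := (2 * L + 1) * d) (by positivity) (by positivity) (fun s hs => ?_)
  · refine le_trans (le_of_eq ?_) key
    field_simp
    norm_num
  have a1 := (abs_sub_coord_le (e ξ) (e ζ) 0).trans_lt hξζ
  have a2 := (abs_sub_coord_le (e x) (e ξ) 0).trans hxξ.le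
  have a3 := (abs_sub_coord_le (e x) (e ξ) 1).trans hxξ.le
  have a4 : |s - e ξ 0| ≤ 2 * d := by
    have := abs_sub_le s (e x 0) (e ξ 0)
    linarith
  have a5 : |s - e ζ 0| < 3 * ρ := by
    have := abs_sub_le s (e ξ 0) (e ζ 0)
    linarith
  have a6 : |g s - e ξ 1| ≤ L * (2 * d) := by
    rw [hξg]
    exact (hLip _ _ (by nlinarith) (by nlinarith)).trans (by gcongr)
  have a7 : |g s - e ζ 1| ≤ L * (3 * ρ) := by
    rw [hζg]
    exact (hLip _ _ (by nlinarith) (by simpa using hη)).trans (by gcongr)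
  refine ⟨hT4 _ ?_, g s, ?_, h0 _ ?_⟩
  · rw [mem_ball, ← e.dist_eq, e.apply_symm_apply]
    have := dist_le_abs_add !₂[s, e x 1] (e x)
    simp only [Matrix.cons_val_zero, Matrix.cons_val_one, sub_self, abs_zero,
      add_zero] at this
    linarith
  · have := abs_sub_le (g s) (e ξ 1) (e x 1)
    rw [abs_sub_comm (e ξ 1)] at this
    nlinarith
  · have hmem : e.symm !₂[s, g s] ∈ V := by
      refine hball ?_
      rw [mem_ball, ← e.dist_eq, e.apply_symm_apply]
      have := dist_le_abs_add !₂[s, g s] (e ζ)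
      simp only [Matrix.cons_val_zero, Matrix.cons_val_one] at this
      nlinarith
    rw [hgraph _ hmem, e.apply_symm_apply]
    simp

theorem SmoothBoundary.exists_capacityBound {Ω : Set R2} (hsm : SmoothBoundary Ω)
    (hbdd : Bornology.IsBounded Ω) : ∃ c > 0, ∃ r > 0, CapacityBound Ω (frontier Ω) c r := by
  have hcpt : IsCompact (frontier Ω) :=
    Metric.isCompact_of_isClosed_isBounded isClosed_frontier
      (hbdd.closure.subset frontier_subset_closure)
  refine hcpt.induction_on (p := fun s => ∃ c > 0, ∃ r > 0, CapacityBound Ω s c r) ?_ ?_ ?_ ?_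
  · exact ⟨1, one_pos, 1, one_pos, by rintro ξ ⟨h, -⟩; exact h.elim⟩
  · rintro s t hst ⟨c, hc, r, hr, h⟩
    exact ⟨c, hc, r, hr, fun ξ hξ => h ξ ⟨hst hξ.1, hξ.2⟩⟩
  · rintro s t ⟨c, hc, r, hr, h⟩ ⟨c', hc', r', hr', h'⟩
    refine ⟨min c c', lt_min hc hc', min r r', lt_min hr hr', ?_⟩
    rintro ξ ⟨hξ | hξ, hξf⟩ x d hd hd0 hdr T hT hcT h0 h4
    · exact (min_le_left _ _).trans
        (h ξ ⟨hξ, hξf⟩ x d hd hd0 (hdr.trans (min_le_left _ _)) T hT hcT h0 h4)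
    · exact (min_le_right _ _).trans
        (h' ξ ⟨hξ, hξf⟩ x d hd hd0 (hdr.trans (min_le_right _ _)) T hT hcT h0 h4)
  · intro ζ hζ
    obtain ⟨s, hs, h⟩ := hsm.exists_capacityBound_nhds hζ
    exact ⟨s, mem_nhdsWithin_of_mem_nhds hs, h⟩

theorem norm_gradient_sq (f : R2 → ℝ) (x : R2) : ‖gradient f x‖ ^ 2 = pd 0 f x ^ 2 + pd 1 f x ^ 2 := by
  have h : ∀ i : Fin 2, gradient f x i = pd i f x := fun i => by
    have h1 : inner ℝ (gradient f x) (EuclideanSpace.single i (1 : ℝ)) = pd i f x := by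
      rw [gradient, InnerProductSpace.toDual_symm_apply, pd]
    rw [← h1, EuclideanSpace.inner_single_right]
    simp
  rw [norm_sq_eq, h, h]

/-- The truncation `(u/M - 1/4)₊²`, extended by zero outside `Ω`. -/
def trunc (Ω : Set R2) (u : R2 → ℝ) (M : ℝ) : R2 → ℝ :=
  Ω.indicator fun y => max (u y / M - 1 / 4) 0 ^ 2

section trunc

variable {Ω : Set R2} {u : R2 → ℝ} {M : ℝ}

theorem trunc_of_mem {y : R2} (hy : y ∈ Ω) : trunc Ω u M y = max (u y / M - 1 / 4) 0 ^ 2 :=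
  indicator_of_mem hy _

theorem trunc_of_notMem {y : R2} (hy : y ∉ Ω) : trunc Ω u M y = 0 :=
  indicator_of_notMem hy _

theorem le_trunc {y : R2} (hy : y ∈ Ω) (h : 3 / 4 ≤ u y / M) : 1 / 4 ≤ trunc Ω u M y := by
  rw [trunc_of_mem hy]
  nlinarith [le_max_left (u y / M - 1 / 4) 0]

theorem trunc_structure (hop : IsOpen Ω) (hbdd : Bornology.IsBounded Ω)
    (hu : ContDiffOn ℝ 1 u Ω) (hcl : ContinuousOn u (closure Ω))
    (hfr : ∀ x ∈ frontier Ω, u x = 0) :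
    ContDiff ℝ 1 (trunc Ω u M) ∧ HasCompactSupport (trunc Ω u M) ∧ tsupport (trunc Ω u M) ⊆ Ω := by
  set K : Set R2 := closure Ω ∩ (fun y => u y / M) ⁻¹' Ici (1 / 4) with hKdef
  have hKc : IsClosed K :=
    (hcl.div_const M).preimage_isClosed_of_isClosed isClosed_closure isClosed_Ici
  have hKΩ : K ⊆ Ω := by
    rintro y ⟨hy, h⟩
    by_contra hn
    have : u y = 0 := hfr y (by rw [frontier, hop.interior_eq]; exact ⟨hy, hn⟩)
    rw [mem_preimage, this, mem_Ici] at h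
    norm_num at h
  have hzero : ∀ y ∉ K, trunc Ω u M y = 0 := fun y hy => by
    by_cases h : y ∈ Ω
    · have : u y / M < 1 / 4 := by
        by_contra! h1
        exact hy ⟨subset_closure h, h1⟩
      rw [trunc_of_mem h, max_eq_right (by linarith)]
      norm_num
    · exact trunc_of_notMem h
  have hts : tsupport (trunc Ω u M) ⊆ K :=
    closure_minimal (fun y hy => by_contra fun h => hy (hzero y h)) hKc
  have hKcpt : IsCompact K :=
    Metric.isCompact_of_isClosed_isBounded hKc (hbdd.closure.subset inter_subset_left)
  refine ⟨contDiff_iff_contDiffAt.2 fun y => ?_, hKcpt.of_isClosed_subset (isClosed_tsupport _) hts,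
    hts.trans hKΩ⟩
  by_cases hy : y ∈ Ω
  · have h1 : ContDiffAt ℝ 1 (fun y => max (u y / M - 1 / 4) 0 ^ 2) y := by
      have h2 := (contDiff_max_pow 1).contDiffAt (x := u y / M - 1 / 4)
      exact ContDiffAt.comp (g := fun t : ℝ => max t 0 ^ 2) y (by exact_mod_cast h2)
        (((hu.contDiffAt (hop.mem_nhds hy)).div_const M).sub contDiffAt_const)
    exact h1.congr_of_eventuallyEq ((hop.eventually_mem hy).mono fun z hz => trunc_of_mem hz)
  · exact (contDiffAt_const (c := (0 : ℝ))).congr_of_eventuallyEq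
      ((hKc.isOpen_compl.eventually_mem fun h => hy (hKΩ h)).mono hzero)

theorem pd_trunc (hop : IsOpen Ω) (hu : ContDiffOn ℝ 1 u Ω) {y : R2} (hy : y ∈ Ω) (i : Fin 2) :
    pd i (trunc Ω u M) y = 2 / M * max (u y / M - 1 / 4) 0 * pd i u y := by
  rw [pd_congr hop (fun z hz => trunc_of_mem (u := u) (M := M) hz) i hy]
  have h1 := (hasDerivAt_max_pow 0 (u y / M - 1 / 4)).comp (u y)
    (((hasDerivAt_id (u y)).div_const M).sub_const (1 / 4))
  have h2 := pd_comp (G := fun t => max (t / M - 1 / 4) 0 ^ 2) (f := u) h1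
    ((hu.differentiableOn (by norm_num)).differentiableAt (hop.mem_nhds hy)) i
  rw [h2]
  push_cast
  ring

theorem pd_trunc_of_notMem (hts : tsupport (trunc Ω u M) ⊆ Ω) {y : R2} (hy : y ∉ Ω) (i : Fin 2) :
    pd i (trunc Ω u M) y = 0 :=
  image_eq_zero_of_notMem_tsupport fun h => hy (hts (tsupport_pd_subset _ i h))

theorem max_div_sub_le_one (hM : 0 < M) {t : ℝ} (ht : t ≤ M) : max (t / M - 1 / 4) 0 ≤ 1 := by
  have : t / M ≤ 1 := (div_le_one hM).2 ht
  exact max_le (by linarith) zero_le_one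

theorem integral_sq_pd_trunc_le (hop : IsOpen Ω) (hbdd : Bornology.IsBounded Ω)
    (hu : ContDiffOn ℝ 1 u Ω) (hcl : ContinuousOn u (closure Ω))
    (hfr : ∀ x ∈ frontier Ω, u x = 0) (hM : 0 < M) (hle : ∀ x ∈ Ω, u x ≤ M)
    (hint : IntegrableOn (fun y => pd 0 u y ^ 2 + pd 1 u y ^ 2) Ω) :
    ∫ y, (pd 0 (trunc Ω u M) y ^ 2 + pd 1 (trunc Ω u M) y ^ 2) ≤
      4 / M ^ 2 * ∫ y in Ω, (pd 0 u y ^ 2 + pd 1 u y ^ 2) := by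
  obtain ⟨hT, hc, hts⟩ := trunc_structure (M := M) hop hbdd hu hcl hfr
  rw [← integral_const_mul, ← integral_indicator hop.measurableSet]
  refine integral_mono ((integrable_sq_pd hT hc 0).add (integrable_sq_pd hT hc 1))
    ((integrable_indicator_iff hop.measurableSet).2 (hint.const_mul _)) fun y => ?_
  by_cases hy : y ∈ Ω
  · simp only [indicator_of_mem hy, pd_trunc hop hu hy]
    have h1 := max_div_sub_le_one hM (hle y hy)
    have h0 : 0 ≤ max (u y / M - 1 / 4) 0 := le_max_right _ _
    have h2 : max (u y / M - 1 / 4) 0 ^ 2 ≤ 1 := pow_le_one₀ h0 h1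
    calc _ = max (u y / M - 1 / 4) 0 ^ 2 * (4 / M ^ 2 * (pd 0 u y ^ 2 + pd 1 u y ^ 2)) := by
          ring
      _ ≤ _ := mul_le_of_le_one_left (by positivity) h2
  · simp only [indicator_of_notMem hy, pd_trunc_of_notMem hts hy]
    norm_num

theorem integral_trunc_mul_lap_le (hop : IsOpen Ω) (hbdd : Bornology.IsBounded Ω)
    (hu : ContDiffOn ℝ 2 u Ω) (hcl : ContinuousOn u (closure Ω))
    (hfr : ∀ x ∈ frontier Ω, u x = 0) (hM : 0 < M) (hle : ∀ x ∈ Ω, u x ≤ M)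
    (hint : IntegrableOn (fun y => pd 0 u y ^ 2 + pd 1 u y ^ 2) Ω) :
    Integrable (fun y => -lap u y * trunc Ω u M y) ∧
    ∫ y, -lap u y * trunc Ω u M y ≤ 2 / M * ∫ y in Ω, (pd 0 u y ^ 2 + pd 1 u y ^ 2) := by
  have hu1 : ContDiffOn ℝ 1 u Ω := hu.of_le (by norm_num)
  obtain ⟨hT, hc, hts⟩ := trunc_structure (M := M) hop hbdd hu1 hcl hfr
  have hpd : ∀ i, ContDiffOn ℝ 1 (pd i u) Ω := fun i => hu.pd hop (by norm_num) i
  have hpp : ∀ i, Integrable fun y => pd i (pd i u) y * trunc Ω u M y := fun i =>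
    integrable_mul_of_tsupport ((hpd i).pd (m := 0) hop (by norm_num) i).continuousOn
      hT.continuous hc hts
  have hip : ∀ i, Integrable fun y => pd i u y * pd i (trunc Ω u M) y := fun i =>
    integrable_mul_of_tsupport (hpd i).continuousOn (hT.pd (m := 0) (by norm_num) i).continuous
      (hc.pd i) ((tsupport_pd_subset _ i).trans hts)
  have hlap : (fun y => -lap u y * trunc Ω u M y) = fun y =>
      -(pd 0 (pd 0 u) y * trunc Ω u M y) + -(pd 1 (pd 1 u) y * trunc Ω u M y) := by
    funext y
    rw [lap_eq]
    ring
  rw [hlap]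
  have hneg : ∀ i, Integrable fun y => -(pd i (pd i u) y * trunc Ω u M y) := fun i => (hpp i).neg
  refine ⟨(hneg 0).add (hneg 1), ?_⟩
  rw [integral_add (hneg 0) (hneg 1), integral_neg, integral_neg,
    ← integral_mul_pd hop (hpd 0) hT hc hts 0, ← integral_mul_pd hop (hpd 1) hT hc hts 1,
    ← integral_add (hip 0) (hip 1), ← integral_const_mul, ← integral_indicator hop.measurableSet]
  refine integral_mono ((hip 0).add (hip 1))
    ((integrable_indicator_iff hop.measurableSet).2 (hint.const_mul _)) fun y => ?_
  by_cases hy : y ∈ Ω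
  · simp only [indicator_of_mem hy, pd_trunc hop hu1 hy]
    have h1 := max_div_sub_le_one hM (hle y hy)
    calc _ = max (u y / M - 1 / 4) 0 * (2 / M * (pd 0 u y ^ 2 + pd 1 u y ^ 2)) := by
          ring
      _ ≤ _ := mul_le_of_le_one_left (by positivity) h1
  · simp only [indicator_of_notMem hy, pd_trunc_of_notMem hts hy]
    norm_num

end trunc

/-- `u` solves the Lane–Emden problem with exponent `p`, its absolute value is maximal at `x₀` where
`u x₀ ≥ 1/2`, its energy is at most `E/p`, and `ε` is the blow-up scale at `x₀`. -/
structure IsPeak (Ω : Set R2) (E c p : ℝ) (u : R2 → ℝ) (x₀ : R2) (ε : ℝ) : Prop where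
  one_lt : 1 < p
  sol : IsSolution Ω p u
  mem : x₀ ∈ Ω
  half_le : 1 / 2 ≤ u x₀
  abs_le_max : ∀ x ∈ Ω, |u x| ≤ u x₀
  integrable : IntegrableOn (fun y => pd 0 u y ^ 2 + pd 1 u y ^ 2) Ω
  energy_le : p * ∫ y in Ω, (pd 0 u y ^ 2 + pd 1 u y ^ 2) ≤ E
  le_rpow : c ≤ u x₀ ^ (p - 1)
  eps_pos : 0 < ε
  eps_sq : ε ^ 2 * (p * u x₀ ^ (p - 1)) = 1

/-- The blow-up of `u` at `x₀` with scale `ε`. -/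
def blowUp (p : ℝ) (u : R2 → ℝ) (x₀ : R2) (ε : ℝ) (y : R2) : ℝ :=
  p / u x₀ * (u (ε • y + x₀) - u x₀)

namespace IsPeak

variable {Ω : Set R2} {E c p : ℝ} {u : R2 → ℝ} {x₀ : R2} {ε : ℝ}

theorem p_pos (h : IsPeak Ω E c p u x₀ ε) : 0 < p := zero_lt_one.trans h.one_lt

theorem max_pos (h : IsPeak Ω E c p u x₀ ε) : 0 < u x₀ :=
  lt_of_lt_of_le (by norm_num) h.half_le

theorem rpow_eq (h : IsPeak Ω E c p u x₀ ε) : u x₀ ^ p = u x₀ ^ (p - 1) * u x₀ := by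
  rw [rpow_sub_one h.max_pos.ne', div_mul_cancel₀ _ h.max_pos.ne']

theorem scaled_mem (h : IsPeak Ω E c p u x₀ ε) {R : ℝ} (hR : ball x₀ (ε * R) ⊆ Ω) {y : R2}
    (hy : y ∈ ball (0 : R2) R) : ε • y + x₀ ∈ Ω := by
  refine hR ?_
  rw [mem_ball_zero_iff] at hy
  rw [mem_ball, dist_eq_norm, add_sub_cancel_right, norm_smul, Real.norm_eq_abs,
    abs_of_pos h.eps_pos]
  exact mul_lt_mul_of_pos_left hy h.eps_pos

theorem one_add_blowUp_div (h : IsPeak Ω E c p u x₀ ε) (y : R2) :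
    1 + blowUp p u x₀ ε y / p = u (ε • y + x₀) / u x₀ := by
  have := h.p_pos.ne'
  have := h.max_pos.ne'
  rw [blowUp]
  field_simp
  ring

theorem blowUp_zero : blowUp p u x₀ ε 0 = 0 := by simp [blowUp]

theorem blowUp_nonpos (h : IsPeak Ω E c p u x₀ ε) {R : ℝ} (hR : ball x₀ (ε * R) ⊆ Ω) {y : R2}
    (hy : y ∈ ball (0 : R2) R) : blowUp p u x₀ ε y ≤ 0 :=
  mul_nonpos_of_nonneg_of_nonpos (div_pos h.p_pos h.max_pos).le
    (sub_nonpos.2 ((le_abs_self _).trans (h.abs_le_max _ (h.scaled_mem hR hy))))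

theorem contDiffOn_blowUp (h : IsPeak Ω E c p u x₀ ε) {R : ℝ} (hR : ball x₀ (ε * R) ⊆ Ω) :
    ContDiffOn ℝ 2 (blowUp p u x₀ ε) (ball 0 R) := by
  have h1 : ContDiffOn ℝ 2 (fun y => u (ε • y + x₀)) (ball 0 R) :=
    h.sol.1.comp (g := u) ((contDiff_id.const_smul ε).add contDiff_const).contDiffOn
      fun y hy => h.scaled_mem hR hy
  exact contDiffOn_const.mul (h1.sub contDiffOn_const)

theorem lap_blowUp (h : IsPeak Ω E c p u x₀ ε) {R : ℝ} (hR : ball x₀ (ε * R) ⊆ Ω) {y : R2}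
    (hy : y ∈ ball (0 : R2) R) : lap (blowUp p u x₀ ε) y =
      -(p / u x₀ * ε ^ 2 * (|u (ε • y + x₀)| ^ (p - 1) * u (ε • y + x₀))) := by
  have h1 : lap (blowUp p u x₀ ε) y = p / u x₀ * (ε ^ 2 * lap u (ε • y + x₀)) := by
    unfold blowUp
    rw [lap_const_mul, lap_sub_const, lap_comp_smul_add]
  rw [h1, ← h.sol.2.2.1 _ (h.scaled_mem hR hy)]
  ring

theorem coeff_mul_rpow (h : IsPeak Ω E c p u x₀ ε) : p / u x₀ * ε ^ 2 * u x₀ ^ p = 1 := by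
  have := h.max_pos.ne'
  rw [h.rpow_eq]
  calc _ = ε ^ 2 * (p * u x₀ ^ (p - 1)) := by field_simp
    _ = 1 := h.eps_sq

theorem abs_lap_blowUp_le (h : IsPeak Ω E c p u x₀ ε) {R : ℝ} (hR : ball x₀ (ε * R) ⊆ Ω) {y : R2}
    (hy : y ∈ ball (0 : R2) R) : |lap (blowUp p u x₀ ε) y| ≤ 1 := by
  have h0 : 0 ≤ p / u x₀ * ε ^ 2 := mul_nonneg (div_pos h.p_pos h.max_pos).le (sq_nonneg _)
  rw [h.lap_blowUp hR hy, abs_neg, abs_mul, abs_of_nonneg h0]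
  refine le_of_le_of_eq ?_ h.coeff_mul_rpow
  exact mul_le_mul_of_nonneg_left
    (abs_rpow_mul_le h.one_lt h.max_pos (h.abs_le_max _ (h.scaled_mem hR hy))) h0

theorem lap_blowUp_eq_rpow (h : IsPeak Ω E c p u x₀ ε) {R : ℝ} (hR : ball x₀ (ε * R) ⊆ Ω) {y : R2}
    (hy : y ∈ ball (0 : R2) R) (hpos : 0 < 1 + blowUp p u x₀ ε y / p) :
    lap (blowUp p u x₀ ε) y = -(1 + blowUp p u x₀ ε y / p) ^ p := by
  rw [h.one_add_blowUp_div] at hpos ⊢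
  have hu : 0 < u (ε • y + x₀) := by
    have := mul_pos hpos h.max_pos
    rwa [div_mul_cancel₀ _ h.max_pos.ne'] at this
  rw [h.lap_blowUp hR hy, abs_of_pos hu, rpow_sub_one hu.ne', div_mul_cancel₀ _ hu.ne',
    div_rpow hu.le h.max_pos.le, eq_comm, neg_inj, div_eq_iff (rpow_pos_of_pos h.max_pos p).ne']
  linear_combination (-(u (ε • y + x₀) ^ p)) * h.coeff_mul_rpow

theorem neg_le_blowUp {C : ℝ} (hC : ∀ (w : R2 → ℝ) (R B : ℝ), 0 < R → 0 ≤ B →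
      ContDiffOn ℝ 2 w (ball 0 (5 * R)) → (∀ y ∈ ball (0 : R2) (5 * R), 0 ≤ w y) →
      (∀ y ∈ ball (0 : R2) (5 * R), |lap w y| ≤ B) → ∀ y : R2, ‖y‖ ≤ R → w y ≤ C * (w 0 + B * R ^ 2))
    (h : IsPeak Ω E c p u x₀ ε) {R : ℝ} (hR0 : 0 < R) (hR : ball x₀ (ε * (5 * R)) ⊆ Ω) {y : R2}
    (hy : ‖y‖ ≤ R) : -(C * R ^ 2) ≤ blowUp p u x₀ ε y := by
  have h1 := hC (fun y => (-1) * blowUp p u x₀ ε y) R 1 hR0 zero_le_one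
    (contDiffOn_const.mul (h.contDiffOn_blowUp hR))
    (fun y hy => by linarith [h.blowUp_nonpos hR hy])
    (fun y hy => by
      rw [lap_const_mul, abs_mul]
      simpa using h.abs_lap_blowUp_le hR hy) y hy
  simp only [blowUp_zero] at h1
  linarith

theorem three_quarters_le {C : ℝ} (h : IsPeak Ω E c p u x₀ ε) (hp : 4 * C ≤ p) {y : R2}
    (hy : -C ≤ blowUp p u x₀ ε y) : 3 / 4 ≤ u (ε • y + x₀) / u x₀ := by
  rw [← h.one_add_blowUp_div]
  have : -(1 / 4) ≤ blowUp p u x₀ ε y / p := by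
    rw [le_div_iff₀ h.p_pos]
    linarith
  linarith

theorem ball_subset {C c₀ r R : ℝ} (hop : IsOpen Ω) (hbdd : Bornology.IsBounded Ω)
    (hcap : CapacityBound Ω (frontier Ω) c₀ r) (hC0 : 0 < C)
    (hC : ∀ (w : R2 → ℝ) (R B : ℝ), 0 < R → 0 ≤ B →
      ContDiffOn ℝ 2 w (ball 0 (5 * R)) → (∀ y ∈ ball (0 : R2) (5 * R), 0 ≤ w y) →
      (∀ y ∈ ball (0 : R2) (5 * R), |lap w y| ≤ B) → ∀ y : R2, ‖y‖ ≤ R → w y ≤ C * (w 0 + B * R ^ 2))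
    (h : IsPeak Ω E c p u x₀ ε) (hr : 0 < r) (hp1 : 4 * (C * R ^ 2) ≤ p)
    (hp2 : R ^ 2 ≤ r ^ 2 * (p * c)) (hp3 : 16 * E < c₀ * p) : ball x₀ (ε * R) ⊆ Ω := by
  by_contra hnot
  have hne : Ωᶜ.Nonempty := by
    obtain ⟨y, -, hy⟩ := not_subset.1 hnot
    exact ⟨y, hy⟩
  obtain ⟨ξ, hξ, hdξ⟩ := hop.isClosed_compl.exists_infDist_eq_dist hne x₀
  set d := dist x₀ ξ with hd
  have hd0 : 0 < d := dist_pos.2 fun h1 => hξ (h1 ▸ h.mem)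
  have hball : ball x₀ d ⊆ Ω := by
    rw [← hdξ]
    exact ball_infDist_compl_subset
  have hdR : d < ε * R := by
    by_contra! h1
    exact hnot ((ball_subset_ball h1).trans hball)
  have hR0 : 0 < R := by
    by_contra! h1
    nlinarith [h.eps_pos]
  have hξf : ξ ∈ frontier Ω := by
    rw [frontier, hop.interior_eq]
    refine ⟨closure_mono hball ?_, hξ⟩
    rw [closure_ball x₀ hd0.ne', mem_closedBall, dist_comm]
  have hεr : ε * R ≤ r := by
    refine le_of_sq_le_sq ?_ hr.le
    have h1 : ε ^ 2 * (p * c) ≤ 1 := by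
      rw [← h.eps_sq]
      exact mul_le_mul_of_nonneg_left (mul_le_mul_of_nonneg_left h.le_rpow h.p_pos.le) (sq_nonneg _)
    calc (ε * R) ^ 2 = ε ^ 2 * R ^ 2 := by ring
      _ ≤ ε ^ 2 * (r ^ 2 * (p * c)) := by gcongr
      _ = r ^ 2 * (ε ^ 2 * (p * c)) := by ring
      _ ≤ r ^ 2 * 1 := by gcongr
      _ = r ^ 2 := mul_one _
  have hu1 : ContDiffOn ℝ 1 u Ω := h.sol.1.of_le (by norm_num)
  have hle : ∀ x ∈ Ω, u x ≤ u x₀ := fun x hx => (le_abs_self _).trans (h.abs_le_max x hx)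
  have hcl := h.sol.2.1.continuousOn
  obtain ⟨hT, hc, hts⟩ := trunc_structure (M := u x₀) hop hbdd hu1 hcl h.sol.2.2.2
  have hρ : 0 < d / (5 * ε) := div_pos hd0 (mul_pos (by norm_num) h.eps_pos)
  have hρR : d / (5 * ε) ≤ R := by
    rw [div_le_iff₀ (mul_pos (by norm_num) h.eps_pos)]
    nlinarith [mul_pos h.eps_pos hR0]
  have hρd : ε * (5 * (d / (5 * ε))) = d := by
    have := h.eps_pos.ne'
    field_simp
  have hlow : ∀ x ∈ ball x₀ (d / 5), 1 / 4 ≤ trunc Ω u (u x₀) x := fun x hx => by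
    refine le_trunc (hball (ball_subset_ball (by linarith) hx)) ?_
    have hx' : x = ε • (ε⁻¹ • (x - x₀)) + x₀ := by
      rw [smul_smul, mul_inv_cancel₀ h.eps_pos.ne', one_smul, sub_add_cancel]
    have hn : ‖ε⁻¹ • (x - x₀)‖ ≤ d / (5 * ε) := by
      rw [norm_smul, norm_inv, Real.norm_eq_abs, abs_of_pos h.eps_pos, ← dist_eq_norm,
        show d / (5 * ε) = ε⁻¹ * (d / 5) by field_simp]
      exact mul_le_mul_of_nonneg_left (mem_ball.1 hx).le (inv_nonneg.2 h.eps_pos.le)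
    have h1 := neg_le_blowUp hC h hρ (by rw [hρd]; exact hball) hn
    rw [hx']
    refine h.three_quarters_le hp1 (le_trans (neg_le_neg ?_) h1)
    gcongr
  have h1 := hcap ξ ⟨hξf, hξf⟩ x₀ d rfl hd0 (hdR.le.trans hεr) _ hT hc
    (fun y hy => trunc_of_notMem fun hyΩ => by
      rw [frontier, hop.interior_eq] at hy
      exact hy.2 hyΩ) hlow
  have h2 := h1.trans (integral_sq_pd_trunc_le hop hbdd hu1 hcl h.sol.2.2.2 h.max_pos hle
    h.integrable)
  set D := ∫ y in Ω, (pd 0 u y ^ 2 + pd 1 u y ^ 2)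
  have hD : 0 ≤ D := integral_nonneg fun y => by positivity
  have h3 : 4 / u x₀ ^ 2 ≤ 16 := by
    rw [div_le_iff₀ (pow_pos h.max_pos 2)]
    nlinarith [h.half_le]
  have h4 : c₀ * p ≤ 16 * D * p :=
    mul_le_mul_of_nonneg_right (h2.trans (mul_le_mul_of_nonneg_right h3 hD)) h.p_pos.le
  linarith [h.energy_le]

theorem setIntegral_exp_blowUp_le {C κ R : ℝ} (hop : IsOpen Ω) (hbdd : Bornology.IsBounded Ω)
    (h : IsPeak Ω E c p u x₀ ε) (hR : ball x₀ (ε * R) ⊆ Ω) (hp : 4 * C ≤ p)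
    (hlow : ∀ y ∈ ball (0 : R2) R, -C ≤ blowUp p u x₀ ε y)
    (hexp : ∀ t ∈ Icc (-C) 0, |(1 + t / p) ^ p - exp t| ≤ κ) :
    ∫ y in ball 0 R, exp (blowUp p u x₀ ε y) ≤ 32 * E + κ * volume.real (ball (0 : R2) R) := by
  have hle : ∀ x ∈ Ω, u x ≤ u x₀ := fun x hx => (le_abs_self _).trans (h.abs_le_max x hx)
  obtain ⟨hGi, hGle⟩ := integral_trunc_mul_lap_le hop hbdd h.sol.1 h.sol.2.1.continuousOn
    h.sol.2.2.2 h.max_pos hle h.integrable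
  set G : R2 → ℝ := fun y => -lap u y * trunc Ω u (u x₀) y with hG
  set D := ∫ y in Ω, (pd 0 u y ^ 2 + pd 1 u y ^ 2)
  have hMp : 0 < u x₀ ^ p := rpow_pos_of_pos h.max_pos p
  have hGnn : ∀ y, 0 ≤ G y := fun y => by
    by_cases hy : y ∈ Ω
    · simp only [hG]
      rw [h.sol.2.2.1 y hy, trunc_of_mem hy]
      rcases le_or_gt (u y) 0 with hu | hu
      · have : u y / u x₀ ≤ 0 := div_nonpos_of_nonpos_of_nonneg hu h.max_pos.le
        rw [max_eq_right (by linarith)]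
        simp
      · positivity
    · simp [hG, trunc_of_notMem hy]
  have hscaled : Integrable fun y => G (x₀ + ε • y) :=
    (hGi.comp_add_left x₀).comp_smul h.eps_pos.ne'
  have hpt : ∀ y ∈ ball (0 : R2) R,
      exp (blowUp p u x₀ ε y) ≤ 4 / u x₀ ^ p * G (x₀ + ε • y) + κ := fun y hy => by
    have h1 := (abs_le.1 (hexp _ ⟨hlow y hy, h.blowUp_nonpos hR hy⟩)).1
    have h2 := h.three_quarters_le hp (hlow y hy)
    rw [h.one_add_blowUp_div] at h1
    have hmem := h.scaled_mem hR hy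
    have hu : 0 < u (ε • y + x₀) := by
      have := mul_pos (lt_of_lt_of_le (by norm_num) h2) h.max_pos
      rwa [div_mul_cancel₀ _ h.max_pos.ne'] at this
    have h3 := le_trunc hmem h2
    have h4 : G (x₀ + ε • y) = u (ε • y + x₀) ^ p * trunc Ω u (u x₀) (ε • y + x₀) := by
      rw [add_comm]
      simp only [hG]
      rw [h.sol.2.2.1 _ hmem, abs_of_pos hu, rpow_sub_one hu.ne', div_mul_cancel₀ _ hu.ne']
    have h5 : (u (ε • y + x₀) / u x₀) ^ p ≤ 4 / u x₀ ^ p * G (x₀ + ε • y) := by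
      rw [h4, div_rpow hu.le h.max_pos.le, div_mul_eq_mul_div, div_le_div_iff_of_pos_right hMp]
      nlinarith [rpow_pos_of_pos hu p]
    linarith
  have hvol : volume (ball (0 : R2) R) ≠ ⊤ := measure_ball_lt_top.ne
  calc ∫ y in ball 0 R, exp (blowUp p u x₀ ε y)
      ≤ ∫ y in ball 0 R, (4 / u x₀ ^ p * G (x₀ + ε • y) + κ) := by
        refine integral_mono_of_nonneg (Eventually.of_forall fun y => (exp_pos _).le)
          ((hscaled.const_mul _).integrableOn.add (integrableOn_const hvol)) ?_
        exact (ae_restrict_iff' measurableSet_ball).2 (Eventually.of_forall hpt)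
    _ = 4 / u x₀ ^ p * (∫ y in ball 0 R, G (x₀ + ε • y)) + κ * volume.real (ball (0 : R2) R) := by
        rw [integral_add (hscaled.const_mul _).integrableOn (integrableOn_const hvol),
          integral_const_mul, setIntegral_const, smul_eq_mul, mul_comm κ]
    _ ≤ 32 * E + κ * volume.real (ball (0 : R2) R) := by
        refine add_le_add_left ?_ _
        have h1 : ∫ y in ball 0 R, G (x₀ + ε • y) ≤ ∫ y, G (x₀ + ε • y) :=
          setIntegral_le_integral hscaled (Eventually.of_forall fun y => hGnn _)
        rw [integral_comp_affine] at h1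
        have hε : 0 < ε ^ 2 := pow_pos h.eps_pos 2
        have hMp1 : 0 < u x₀ ^ (p - 1) := rpow_pos_of_pos h.max_pos _
        have hεinv : (ε ^ 2)⁻¹ = p * u x₀ ^ (p - 1) := by
          exact inv_eq_of_mul_eq_one_right h.eps_sq
        have hM4 : 1 / u x₀ ^ 2 ≤ 4 := by
          rw [div_le_iff₀ (pow_pos h.max_pos 2)]
          nlinarith [h.half_le]
        have hM := h.max_pos
        have hD : 0 ≤ p * D := mul_nonneg h.p_pos.le (integral_nonneg fun y => by positivity)
        calc _ ≤ 4 / u x₀ ^ p * ((ε ^ 2)⁻¹ * (2 / u x₀ * D)) := by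
              refine mul_le_mul_of_nonneg_left (h1.trans ?_) (div_pos (by norm_num) hMp).le
              exact mul_le_mul_of_nonneg_left hGle (inv_pos.2 hε).le
          _ = 8 * (1 / u x₀ ^ 2) * (p * D) := by
              rw [hεinv, h.rpow_eq]
              field_simp
              ring
          _ ≤ 8 * 4 * (p * D) := by gcongr
          _ ≤ 32 * E := by linarith [h.energy_le]

end IsPeak

theorem CondA.eventually_integrableOn {Ω : Set R2} {u : ℝ → R2 → ℝ} (hA : CondA Ω u) :
    ∀ᶠ p : ℝ in atTop, IntegrableOn (fun y => pd 0 (u p) y ^ 2 + pd 1 (u p) y ^ 2) Ω ∧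
      p * ∫ y in Ω, (pd 0 (u p) y ^ 2 + pd 1 (u p) y ^ 2) ≤ 16 * π * exp 1 + 1 := by
  have h1 : Tendsto (fun p : ℝ => p * ∫ y in Ω, (pd 0 (u p) y ^ 2 + pd 1 (u p) y ^ 2)) atTop
      (𝓝 (16 * π * exp 1)) := by
    simpa only [CondA, norm_gradient_sq] using hA
  have hpos : 0 < 16 * π * exp 1 := by positivity
  filter_upwards [h1.eventually (lt_mem_nhds hpos), h1.eventually (gt_mem_nhds (lt_add_one _))]
    with p hp0 hp1
  refine ⟨?_, hp1.le⟩
  by_contra hn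
  rw [integral_undef hn, mul_zero] at hp0
  exact hp0.false

theorem eventually_isPeak {Ω : Set R2} (hop : IsOpen Ω) (hbdd : Bornology.IsBounded Ω)
    {u : ℝ → R2 → ℝ} (hsol : ∀ p > (1:ℝ), IsSolution Ω p (u p))
    (hnod : ∀ p > (1:ℝ), IsNodal Ω (u p)) {xp xm : ℝ → R2}
    (hxpmem : ∀ p > (1:ℝ), xp p ∈ Ω)
    (hxpmax : ∀ p > (1:ℝ), ∀ x ∈ Ω, u p x ≤ u p (xp p))
    (hxmmin : ∀ p > (1:ℝ), ∀ x ∈ Ω, u p (xm p) ≤ u p x)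
    (hcomp : ∀ p > (1:ℝ), -u p (xm p) ≤ u p (xp p)) (hA : CondA Ω u) :
    ∃ c > 0, ∀ᶠ p : ℝ in atTop,
      IsPeak Ω (16 * π * exp 1 + 1) c p (u p) (xp p) (eps u xp p) := by
  obtain ⟨c, hc, hle⟩ := exists_le_rpow_max hop hbdd
  have hsmall : ∀ᶠ p : ℝ in atTop, (1 / 2 : ℝ) ^ (p - 1) < c :=
    ((tendsto_rpow_atTop_of_base_lt_one (1 / 2 : ℝ) (by norm_num) (by norm_num)).comp
      (tendsto_atTop_add_const_right atTop (-1 : ℝ) tendsto_id)).eventually (gt_mem_nhds hc)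
  refine ⟨c, hc, ?_⟩
  filter_upwards [hA.eventually_integrableOn, hsmall, eventually_gt_atTop 1]
    with p ⟨hint, hE⟩ hps hp
  obtain ⟨y, hy, hy0⟩ := (hnod p hp).1
  have hM : 0 < u p (xp p) := hy0.trans_le (hxpmax p hp y hy)
  have habs : ∀ x ∈ Ω, |u p x| ≤ u p (xp p) := fun x hx =>
    abs_le.2 ⟨by linarith [hxmmin p hp x hx, hcomp p hp], hxpmax p hp x hx⟩
  have hcM := hle p (u p) (xp p) hp (hsol p hp) (hxpmem p hp) hM habs
  have hq : 0 < p * u p (xp p) ^ (p - 1) :=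
    mul_pos (zero_lt_one.trans hp) (rpow_pos_of_pos hM _)
  refine ⟨hp, hsol p hp, hxpmem p hp, ?_, habs, hint, hE, hcM, one_div_pos.2 (sqrt_pos.2 hq), ?_⟩
  · by_contra! h
    exact absurd (rpow_le_rpow hM.le h.le (sub_nonneg.2 hp.le)) (not_le.2 (hps.trans_le hcM))
  · rw [eps, div_pow, Real.sq_sqrt hq.le, one_pow, one_div_mul_cancel hq.ne']

theorem stmt10
    (Ω : Set R2) (hne : Ω.Nonempty) (hop : IsOpen Ω)
    (hbdd : Bornology.IsBounded Ω) (hconn : IsConnected Ω) (hsm : SmoothBoundary Ω)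
    (u : ℝ → R2 → ℝ)
    (hsol : ∀ p > (1:ℝ), IsSolution Ω p (u p))
    (hnod : ∀ p > (1:ℝ), IsNodal Ω (u p))
    (xp xm : ℝ → R2)
    (hxpmem : ∀ p > (1:ℝ), xp p ∈ Ω)
    (hxpmax : ∀ p > (1:ℝ), ∀ x ∈ Ω, u p x ≤ u p (xp p))
    (hxmmem : ∀ p > (1:ℝ), xm p ∈ Ω)
    (hxmmin : ∀ p > (1:ℝ), ∀ x ∈ Ω, u p (xm p) ≤ u p x)
    (hcomp : ∀ p > (1:ℝ), -u p (xm p) ≤ u p (xp p))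
    (hA : CondA Ω u) :
    TendstoC2loc atTop
      (fun p : ℝ => {x : R2 | eps u xp p • x + xp p ∈ Ω ∧ 0 < u p (eps u xp p • x + xp p)})
      (fun p : ℝ => zp u xp p) stdBubble := by
  obtain ⟨c, hc, hpeak⟩ := eventually_isPeak hop hbdd hsol hnod hxpmem hxpmax hxmmin hcomp hA
  obtain ⟨C, hC0, hC⟩ := exists_harnack
  obtain ⟨c₀, hc₀, r, hr, hcap⟩ := hsm.exists_capacityBound hbdd
  set E := 16 * π * exp 1 + 1
  have hball : ∀ R : ℝ, ∀ᶠ p : ℝ in atTop, ball (xp p) (eps u xp p * R) ⊆ Ω := fun R => by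
    filter_upwards [hpeak, eventually_ge_atTop (4 * (C * R ^ 2)),
      eventually_ge_atTop (R ^ 2 / (r ^ 2 * c)), eventually_gt_atTop (16 * E / c₀)]
      with p h h1 h2 h3
    rw [div_le_iff₀ (by positivity)] at h2
    rw [div_lt_iff₀ hc₀] at h3
    exact h.ball_subset hop hbdd hcap hC0 hC hr h1 (by linarith) (by linarith)
  have hlow : ∀ R : ℝ, 0 < R → ∀ᶠ p : ℝ in atTop, ∀ y ∈ ball (0 : R2) R,
      -(C * R ^ 2) ≤ zp u xp p y := fun R hR => by
    filter_upwards [hpeak, hball (5 * R)] with p h hb y hy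
    exact h.neg_le_blowUp hC hR hb (mem_ball_zero_iff.1 hy).le
  intro K hK
  obtain ⟨R, hR0, hKR⟩ := hK.isBounded.subset_ball_lt 0 (0 : R2)
  refine ⟨?_, fun n hn => (tendstoUniformlyOn_stdBubble (M := 32 * E + 1) ?_ ?_ ?_ R hn).mono hKR⟩
  · filter_upwards [hpeak, hball R, hlow R hR0, eventually_ge_atTop (4 * (C * R ^ 2))]
      with p h hb hl hp y hy
    have h1 := h.three_quarters_le hp (hl y (hKR hy))
    have h2 := mul_pos (lt_of_lt_of_le (by norm_num) h1) h.max_pos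
    rw [div_mul_cancel₀ _ h.max_pos.ne'] at h2
    exact ⟨h.scaled_mem hb (hKR hy), h2⟩
  · intro R
    have hm : 0 < max R 1 := lt_max_of_lt_right one_pos
    refine ⟨C * (max R 1) ^ 2, by positivity, fun κ hκ => ?_⟩
    filter_upwards [hpeak, hball (max R 1), hlow (max R 1) hm,
      eventually_one_add_div_rpow (C * (max R 1) ^ 2) (by positivity) hκ] with p h hb hl hexp
    have hsub : ball (0 : R2) R ⊆ ball 0 (max R 1) := ball_subset_ball (le_max_left _ _)
    have hz : ∀ y ∈ ball (0 : R2) R, zp u xp p y ∈ Icc (-(C * (max R 1) ^ 2)) 0 := fun y hy =>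
      ⟨hl y (hsub hy), h.blowUp_nonpos hb (hsub hy)⟩
    refine ⟨(h.contDiffOn_blowUp hb).mono hsub, hz, fun t => (1 + t / p) ^ p,
      fun t ht => (hexp t ht).2, fun y hy => ?_⟩
    exact h.lap_blowUp_eq_rpow hb (hsub hy) (hexp _ (hz y hy)).1
  · exact Eventually.of_forall fun p => IsPeak.blowUp_zero
  · intro R
    have hm : 0 < max R 1 := lt_max_of_lt_right one_pos
    have hsub : ball (0 : R2) R ⊆ ball 0 (max R 1) := ball_subset_ball (le_max_left _ _)
    set κ := 1 / (volume.real (ball (0 : R2) R) + 1)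
    have hκ : 0 < κ := by positivity
    filter_upwards [hpeak, hball R, hlow (max R 1) hm,
      eventually_one_add_div_rpow (C * (max R 1) ^ 2) (by positivity) hκ,
      eventually_ge_atTop (4 * (C * (max R 1) ^ 2))] with p h hb hl hexp hp
    refine (h.setIntegral_exp_blowUp_le hop hbdd hb hp (fun y hy => hl y (hsub hy))
      fun t ht => (hexp t ht).2.2.1).trans ?_
    have : κ * volume.real (ball (0 : R2) R) ≤ 1 := by
      rw [div_mul_eq_mul_div, one_mul, div_le_one (by positivity)]
      linarith
    linarith
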